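/- Let 1 < a ≤ b ≤ c ≤ ab and let (H,z), with H = (H_A,H_B,H_C) traceless, be a non-trivial facet normal of C(a,b,c). Then (H,z) is admissible: the subspace {λ ∈ V : ⟨(H,z), λ⟩ = 0} of V := {(λ_A,λ_B,λ_C) ∈ ℝ^a × ℝ^b × ℝ^c : Σλ_A = Σλ_B = Σλ_C} is spanned by the weights ω_{ijk} := (e_i, e_j, e_k) with H_{A,i} + H_{B,j} + H_{C,k} + z = 0. -/

import Mathlib

open scoped BigOperators

noncomputable section

/-- The reduced density matrix on the first subsystem. -/
def rhoA {a b c : ℕ} (ψ : Fin a × Fin b × Fin c → ℂ) : Matrix (Fin a) (Fin a) ℂ :=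
  Matrix.of fun i i' => ∑ j : Fin b, ∑ k : Fin c, ψ (i, j, k) * (starRingEnd ℂ) (ψ (i', j, k))

/-- The reduced density matrix on the second subsystem. -/
def rhoB {a b c : ℕ} (ψ : Fin a × Fin b × Fin c → ℂ) : Matrix (Fin b) (Fin b) ℂ :=
  Matrix.of fun j j' => ∑ i : Fin a, ∑ k : Fin c, ψ (i, j, k) * (starRingEnd ℂ) (ψ (i, j', k))

/-- The reduced density matrix on the third subsystem. -/
def rhoC {a b c : ℕ} (ψ : Fin a × Fin b × Fin c → ℂ) : Matrix (Fin c) (Fin c) ℂ :=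
  Matrix.of fun k k' => ∑ i : Fin a, ∑ j : Fin b, ψ (i, j, k) * (starRingEnd ℂ) (ψ (i, j, k'))

/-- `lam` is the vector of eigenvalues of `ρ`, listed in nonincreasing order
with multiplicity. -/
def IsSpecDown {n : ℕ} (ρ : Matrix (Fin n) (Fin n) ℂ) (lam : Fin n → ℝ) : Prop :=
  Antitone lam ∧ ∃ (hρ : ρ.IsHermitian) (σ : Equiv.Perm (Fin n)), lam = hρ.eigenvalues ∘ σ

/-- The Kronecker cone `C(a,b,c)`. -/
def KronCone (a b c : ℕ) : Set ((Fin a → ℝ) × (Fin b → ℝ) × (Fin c → ℝ)) :=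
  { lam | ∃ ψ : Fin a × Fin b × Fin c → ℂ,
      IsSpecDown (rhoA ψ) lam.1 ∧ IsSpecDown (rhoB ψ) lam.2.1 ∧ IsSpecDown (rhoC ψ) lam.2.2 }

/-- The pairing `⟨(H,z), λ⟩`. -/
def wtPair {a b c : ℕ} (HA : Fin a → ℝ) (HB : Fin b → ℝ) (HC : Fin c → ℝ) (z : ℝ)
    (lam : (Fin a → ℝ) × (Fin b → ℝ) × (Fin c → ℝ)) : ℝ :=
  (∑ i, HA i * lam.1 i) + (∑ j, HB j * lam.2.1 j) + (∑ k, HC k * lam.2.2 k)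
    + z * ∑ i, lam.1 i

/-- `H = (H_A, H_B, H_C)` is traceless. -/
def Traceless {a b c : ℕ} (HA : Fin a → ℝ) (HB : Fin b → ℝ) (HC : Fin c → ℝ) : Prop :=
  (∑ i, HA i) = 0 ∧ (∑ j, HB j) = 0 ∧ (∑ k, HC k) = 0

/-- `(H, z)` is a facet normal of the Kronecker cone `C(a,b,c)`. -/
def IsFacetNormal (a b c : ℕ) (HA : Fin a → ℝ) (HB : Fin b → ℝ) (HC : Fin c → ℝ)
    (z : ℝ) : Prop :=
  Traceless HA HB HC ∧ ¬(HA = 0 ∧ HB = 0 ∧ HC = 0 ∧ z = 0) ∧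
  (∀ lam ∈ KronCone a b c, 0 ≤ wtPair HA HB HC z lam) ∧
  Module.finrank ℝ
    (affineSpan ℝ {lam ∈ KronCone a b c | wtPair HA HB HC z lam = 0}).direction
    = a + b + c - 3

/-- `(H, z)` is a trivial (Weyl chamber) normal. -/
def IsTrivialNormal {a b c : ℕ} (HA : Fin a → ℝ) (HB : Fin b → ℝ) (HC : Fin c → ℝ)
    (z : ℝ) : Prop :=
  ∃ t : ℝ, 0 < t ∧
    ((∃ i i' : Fin a, i < i' ∧ HA = t • (Pi.single i 1 - Pi.single i' 1) ∧
        HB = 0 ∧ HC = 0 ∧ z = 0) ∨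
     (∃ j j' : Fin b, j < j' ∧ HB = t • (Pi.single j 1 - Pi.single j' 1) ∧
        HA = 0 ∧ HC = 0 ∧ z = 0) ∨
     (∃ k k' : Fin c, k < k' ∧ HC = t • (Pi.single k 1 - Pi.single k' 1) ∧
        HA = 0 ∧ HB = 0 ∧ z = 0))

/-- The subspace of vectors supported on coordinates satisfying `P`. -/
def suppSubmodule {ι : Type*} (P : ι → Prop) : Submodule ℂ (ι → ℂ) where
  carrier := {ψ | ∀ p, ¬ P p → ψ p = 0}
  add_mem' := by
    intro x y hx hy p hp
    simp only [Pi.add_apply, hx p hp, hy p hp, add_zero]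
  zero_mem' := by intro p _; rfl
  smul_mem' := by
    intro r x hx p hp
    simp only [Pi.smul_apply, hx p hp, smul_zero]

/-- The zero-weight space `ℋ₀(H,z)`. -/
def weight0Space {a b c : ℕ} (HA : Fin a → ℝ) (HB : Fin b → ℝ) (HC : Fin c → ℝ)
    (z : ℝ) : Submodule ℂ (Fin a × Fin b × Fin c → ℂ) :=
  suppSubmodule fun p => HA p.1 + HB p.2.1 + HC p.2.2 + z = 0

/-- The negative-weight space `ℋ₋(H,z)`. -/
def weightNegSpace {a b c : ℕ} (HA : Fin a → ℝ) (HB : Fin b → ℝ) (HC : Fin c → ℝ)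
    (z : ℝ) : Submodule ℂ (Fin a × Fin b × Fin c → ℂ) :=
  suppSubmodule fun p => HA p.1 + HB p.2.1 + HC p.2.2 + z < 0

/-- Strictly lower triangular matrices `X` with `X i' i = 0` unless
`i < i'` and `Hv i' < Hv i`. -/
def lowerMod {d : ℕ} (Hv : Fin d → ℝ) : Submodule ℂ (Matrix (Fin d) (Fin d) ℂ) where
  carrier := {X | ∀ i' i, ¬ (i < i' ∧ Hv i' < Hv i) → X i' i = 0}
  add_mem' := by
    intro X Y hX hY i' i h
    simp only [Matrix.add_apply, hX i' i h, hY i' i h, add_zero]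
  zero_mem' := by intro i' i h; rfl
  smul_mem' := by
    intro r X hX i' i h
    simp only [Matrix.smul_apply, hX i' i h, smul_zero]

/-- The nilpotent algebra `𝔫₋(H)`. -/
def nMinusMod {a b c : ℕ} (HA : Fin a → ℝ) (HB : Fin b → ℝ) (HC : Fin c → ℝ) :
    Submodule ℂ (Matrix (Fin a) (Fin a) ℂ × Matrix (Fin b) (Fin b) ℂ ×
      Matrix (Fin c) (Fin c) ℂ) :=
  (lowerMod HA).prod ((lowerMod HB).prod (lowerMod HC))

/-- The infinitesimal action `(X,Y,Z) ↦ (X⊗I⊗I + I⊗Y⊗I + I⊗I⊗Z)ψ`. -/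
def act {a b c : ℕ}
    (t : Matrix (Fin a) (Fin a) ℂ × Matrix (Fin b) (Fin b) ℂ × Matrix (Fin c) (Fin c) ℂ)
    (ψ : Fin a × Fin b × Fin c → ℂ) : Fin a × Fin b × Fin c → ℂ := fun p =>
  (∑ i', t.1 p.1 i' * ψ (i', p.2.1, p.2.2)) +
  (∑ j', t.2.1 p.2.1 j' * ψ (p.1, j', p.2.2)) +
  (∑ k', t.2.2 p.2.2 k' * ψ (p.1, p.2.1, k'))

/-- The action as a linear map in `(X,Y,Z)`. -/
def actL {a b c : ℕ} (ψ : Fin a × Fin b × Fin c → ℂ) :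
    (Matrix (Fin a) (Fin a) ℂ × Matrix (Fin b) (Fin b) ℂ × Matrix (Fin c) (Fin c) ℂ)
      →ₗ[ℂ] (Fin a × Fin b × Fin c → ℂ) where
  toFun t := act t ψ
  map_add' t s := by
    funext p
    simp only [act, Prod.fst_add, Prod.snd_add, Matrix.add_apply, add_mul,
      Finset.sum_add_distrib, Pi.add_apply]
    ring
  map_smul' r t := by
    funext p
    simp only [act, Prod.smul_fst, Prod.smul_snd, Matrix.smul_apply, smul_eq_mul,
      Pi.smul_apply, RingHom.id_apply, Finset.mul_sum, mul_assoc, mul_add]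

/-- The tangent map `T_ψ : 𝔫₋(H) → ℋ₋(H,z)` is a linear isomorphism. -/
def TangentIso {a b c : ℕ} (HA : Fin a → ℝ) (HB : Fin b → ℝ) (HC : Fin c → ℝ)
    (z : ℝ) (ψ : Fin a × Fin b × Fin c → ℂ) : Prop :=
  ∃ h : ∀ t ∈ nMinusMod HA HB HC, actL ψ t ∈ weightNegSpace HA HB HC z,
    Function.Bijective ((actL ψ).restrict h)

/-- The tangent map `T_ψ : 𝔫₋(H) → ℋ₋(H,z)` is surjective. -/
def TangentSurj {a b c : ℕ} (HA : Fin a → ℝ) (HB : Fin b → ℝ) (HC : Fin c → ℝ)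
    (z : ℝ) (ψ : Fin a × Fin b × Fin c → ℂ) : Prop :=
  ∃ h : ∀ t ∈ nMinusMod HA HB HC, actL ψ t ∈ weightNegSpace HA HB HC z,
    Function.Surjective ((actL ψ).restrict h)

/-- `(H,z)` is admissible: the hyperplane `⟨(H,z), ·⟩ = 0` in `V` is spanned by
the weights of zero `(H,z)`-weight. -/
def Admissible {a b c : ℕ} (HA : Fin a → ℝ) (HB : Fin b → ℝ) (HC : Fin c → ℝ)
    (z : ℝ) : Prop :=
  (Submodule.span ℝ
    { w : (Fin a → ℝ) × (Fin b → ℝ) × (Fin c → ℝ) |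
      ∃ i j k, HA i + HB j + HC k + z = 0 ∧
        w = (Pi.single i 1, Pi.single j 1, Pi.single k 1) } : Set _)
  = { lam | (∑ i, lam.1 i) = (∑ j, lam.2.1 j) ∧ (∑ i, lam.1 i) = (∑ k, lam.2.2 k) ∧
        wtPair HA HB HC z lam = 0 }

/-- `(H,z)` is a Ressayre element. -/
def IsRessayre {a b c : ℕ} (HA : Fin a → ℝ) (HB : Fin b → ℝ) (HC : Fin c → ℝ)
    (z : ℝ) : Prop :=
  Traceless HA HB HC ∧ ¬(HA = 0 ∧ HB = 0 ∧ HC = 0 ∧ z = 0) ∧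
  Admissible HA HB HC z ∧
  ∃ ψ ∈ weight0Space HA HB HC z, TangentIso HA HB HC z ψ

/-- `(H_A, H_B)` satisfies the extremal-edge condition. -/
def ExtremalEdge {a b : ℕ} (HA : Fin a → ℝ) (HB : Fin b → ℝ) : Prop :=
  (∑ i, HA i) = 0 ∧ (∑ j, HB j) = 0 ∧ ¬(HA = 0 ∧ HB = 0) ∧
  ∀ (x : Fin a → ℝ) (y : Fin b → ℝ), (∑ i, x i) = 0 → (∑ j, y j) = 0 →
    (∀ i j k l, HA i + HB j = HA k + HB l → x i + y j = x k + y l) →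
    ∃ t : ℝ, x = t • HA ∧ y = t • HB

section

open Matrix

theorem exists_unitary_of_isHermitian {n : ℕ} {ρ : Matrix (Fin n) (Fin n) ℂ}
    (hρ : ρ.IsHermitian) (σ : Equiv.Perm (Fin n)) :
    ∃ k ∈ Matrix.unitaryGroup (Fin n) ℂ,
      ρ = k * diagonal (fun i => (((hρ.eigenvalues ∘ σ) i : ℝ) : ℂ)) * kᴴ := by
  refine ⟨(hρ.eigenvectorUnitary : Matrix (Fin n) (Fin n) ℂ).submatrix id σ, ?_, ?_⟩
  · rw [Matrix.mem_unitaryGroup_iff]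
    have h := (Matrix.mem_unitaryGroup_iff).1 hρ.eigenvectorUnitary.2
    rw [star_eq_conjTranspose] at h ⊢
    rw [conjTranspose_submatrix, submatrix_mul_equiv, h]
    simp
  · have h := hρ.spectral_theorem
    rw [Unitary.conjStarAlgAut_apply] at h
    conv_lhs => rw [h]
    rw [star_eq_conjTranspose, conjTranspose_submatrix]
    have : diagonal (fun i => (((hρ.eigenvalues ∘ σ) i : ℝ) : ℂ)) =
        (diagonal (fun i => ((hρ.eigenvalues i : ℝ) : ℂ))).submatrix σ σ := by
      rw [submatrix_diagonal_equiv]; rfl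
    rw [this, submatrix_mul_equiv, submatrix_mul_equiv]
    rfl

theorem exists_perm_antitone {n : ℕ} (f : Fin n → ℝ) :
    ∃ σ : Equiv.Perm (Fin n), Antitone (f ∘ σ) := by
  refine ⟨Tuple.sort (fun i => - f i), fun i j hij => ?_⟩
  have := Tuple.monotone_sort (fun i => - f i) hij
  simpa using this

theorem exists_perm_monotone {n : ℕ} (f : Fin n → ℝ) :
    ∃ σ : Equiv.Perm (Fin n), Monotone (f ∘ σ) :=
  ⟨Tuple.sort f, Tuple.monotone_sort f⟩

theorem exists_isSpecDown {n : ℕ} {ρ : Matrix (Fin n) (Fin n) ℂ} (hρ : ρ.IsHermitian) :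
    ∃ lam, IsSpecDown ρ lam := by
  obtain ⟨σ, hσ⟩ := exists_perm_antitone hρ.eigenvalues
  exact ⟨_, hσ, hρ, σ, rfl⟩

theorem IsSpecDown.exists_unitary {n : ℕ} {ρ : Matrix (Fin n) (Fin n) ℂ} {lam : Fin n → ℝ}
    (h : IsSpecDown ρ lam) :
    ∃ k ∈ Matrix.unitaryGroup (Fin n) ℂ, ρ = k * diagonal (fun i => (lam i : ℂ)) * kᴴ := by
  obtain ⟨-, hρ, σ, rfl⟩ := h
  exact exists_unitary_of_isHermitian hρ σ

theorem isHermitian_conj_diagonal {n : ℕ} (k : Matrix (Fin n) (Fin n) ℂ) (lam : Fin n → ℝ) :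
    (k * diagonal (fun i => (lam i : ℂ)) * kᴴ).IsHermitian := by
  have : (diagonal (fun i => (lam i : ℂ))).IsHermitian := by
    rw [isHermitian_diagonal_iff]
    intro i; simp [IsSelfAdjoint]
  exact isHermitian_mul_mul_conjTranspose k this

theorem isSpecDown_of_unitary {n : ℕ} {ρ : Matrix (Fin n) (Fin n) ℂ} {lam : Fin n → ℝ}
    (hlam : Antitone lam) {k : Matrix (Fin n) (Fin n) ℂ} (hk : k ∈ Matrix.unitaryGroup (Fin n) ℂ)
    (h : ρ = k * diagonal (fun i => (lam i : ℂ)) * kᴴ) : IsSpecDown ρ lam := by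
  have hρ : ρ.IsHermitian := h ▸ isHermitian_conj_diagonal k lam
  obtain ⟨σ, hσ⟩ := exists_perm_antitone hρ.eigenvalues
  refine ⟨hlam, hρ, σ, ?_⟩
  have hk' : kᴴ * k = 1 := (Matrix.mem_unitaryGroup_iff').1 hk
  have h1 : ρ.charpoly = (diagonal (fun i => (lam i : ℂ))).charpoly := by
    rw [h, Matrix.charpoly_mul_comm, ← Matrix.mul_assoc, hk', Matrix.one_mul]
  have h2 := hρ.roots_charpoly_eq_eigenvalues
  rw [h1, Matrix.charpoly_diagonal, Polynomial.roots_prod _ _ (by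
    simp [Finset.prod_ne_zero_iff, Polynomial.X_sub_C_ne_zero])] at h2
  have h3 : Multiset.map lam Finset.univ.val =
      Multiset.map (hρ.eigenvalues ∘ σ) Finset.univ.val := by
    have h4 : Multiset.map (fun i => ((lam i : ℝ) : ℂ)) Finset.univ.val =
        Multiset.map (fun i => ((hρ.eigenvalues i : ℝ) : ℂ)) Finset.univ.val := by
      simpa [Multiset.bind_singleton] using h2
    have h5 := congrArg (Multiset.map Complex.re) h4
    simp only [Multiset.map_map, Function.comp_def, Complex.ofReal_re] at h5
    rw [h5]
    have : (Finset.univ.val : Multiset (Fin n)) = Multiset.map σ Finset.univ.val := by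
      simp
    conv_lhs => rw [this, Multiset.map_map]
  rw [Fin.univ_val_map, Fin.univ_val_map, Multiset.coe_eq_coe] at h3
  exact List.ofFn_injective
    (h3.eq_of_sortedGE hlam.sortedGE_ofFn hσ.sortedGE_ofFn)

end

section

open Matrix Kronecker

/-- The matrix of the operator `P ⊗ Q ⊗ R`. -/
def tens {a b c : ℕ} (P : Matrix (Fin a) (Fin a) ℂ) (Q : Matrix (Fin b) (Fin b) ℂ)
    (R : Matrix (Fin c) (Fin c) ℂ) : Matrix (Fin a × Fin b × Fin c) (Fin a × Fin b × Fin c) ℂ :=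
  P ⊗ₖ (Q ⊗ₖ R)

/-- The squared Euclidean norm. -/
def nsq {ι : Type*} [Fintype ι] (ψ : ι → ℂ) : ℝ := ∑ p, ‖ψ p‖ ^ 2

section
variable {a b c : ℕ}

theorem tens_mul (P P' : Matrix (Fin a) (Fin a) ℂ) (Q Q' : Matrix (Fin b) (Fin b) ℂ)
    (R R' : Matrix (Fin c) (Fin c) ℂ) :
    tens (P * P') (Q * Q') (R * R') = tens P Q R * tens P' Q' R' := by
  simp only [tens, mul_kronecker_mul]

theorem tens_mulVec_mulVec (P P' : Matrix (Fin a) (Fin a) ℂ) (Q Q' : Matrix (Fin b) (Fin b) ℂ)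
    (R R' : Matrix (Fin c) (Fin c) ℂ) (ψ : Fin a × Fin b × Fin c → ℂ) :
    tens P Q R *ᵥ (tens P' Q' R' *ᵥ ψ) = tens (P * P') (Q * Q') (R * R') *ᵥ ψ := by
  rw [tens_mul, mulVec_mulVec]

@[simp] theorem tens_one : tens (1 : Matrix (Fin a) (Fin a) ℂ) (1 : Matrix (Fin b) (Fin b) ℂ)
    (1 : Matrix (Fin c) (Fin c) ℂ) = 1 := by
  simp [tens]

theorem tens_mulVec_apply (P : Matrix (Fin a) (Fin a) ℂ) (Q : Matrix (Fin b) (Fin b) ℂ)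
    (R : Matrix (Fin c) (Fin c) ℂ) (ψ : Fin a × Fin b × Fin c → ℂ) (p : Fin a × Fin b × Fin c) :
    (tens P Q R *ᵥ ψ) p = ∑ q, P p.1 q.1 * (Q p.2.1 q.2.1 * R p.2.2 q.2.2) * ψ q := by
  simp [tens, mulVec, dotProduct, kroneckerMap_apply]

theorem tens_diagonal_mulVec (x : Fin a → ℂ) (y : Fin b → ℂ) (w : Fin c → ℂ)
    (ψ : Fin a × Fin b × Fin c → ℂ) (p : Fin a × Fin b × Fin c) :
    (tens (diagonal x) (diagonal y) (diagonal w) *ᵥ ψ) p =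
      x p.1 * (y p.2.1 * w p.2.2) * ψ p := by
  rw [tens, diagonal_kronecker_diagonal, diagonal_kronecker_diagonal, mulVec_diagonal]

/-- Exchange of the first two tensor factors. -/
def swapAB (ψ : Fin a × Fin b × Fin c → ℂ) : Fin b × Fin a × Fin c → ℂ :=
  fun p => ψ (p.2.1, p.1, p.2.2)

/-- Moving the last tensor factor to the front. -/
def rotC (ψ : Fin a × Fin b × Fin c → ℂ) : Fin c × Fin a × Fin b → ℂ :=
  fun p => ψ (p.2.1, p.2.2, p.1)

theorem rhoB_eq (ψ : Fin a × Fin b × Fin c → ℂ) : rhoB ψ = rhoA (swapAB ψ) := rfl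

theorem rhoC_eq (ψ : Fin a × Fin b × Fin c → ℂ) : rhoC ψ = rhoA (rotC ψ) := rfl

theorem swapAB_tens (P : Matrix (Fin a) (Fin a) ℂ) (Q : Matrix (Fin b) (Fin b) ℂ)
    (R : Matrix (Fin c) (Fin c) ℂ) (ψ : Fin a × Fin b × Fin c → ℂ) :
    swapAB (tens P Q R *ᵥ ψ) = tens Q P R *ᵥ swapAB ψ := by
  funext p
  simp only [swapAB, tens_mulVec_apply, Fintype.sum_prod_type]
  rw [Finset.sum_comm]
  refine Finset.sum_congr rfl fun _ _ => Finset.sum_congr rfl fun _ _ =>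
    Finset.sum_congr rfl fun _ _ => by ring

theorem rotC_tens (P : Matrix (Fin a) (Fin a) ℂ) (Q : Matrix (Fin b) (Fin b) ℂ)
    (R : Matrix (Fin c) (Fin c) ℂ) (ψ : Fin a × Fin b × Fin c → ℂ) :
    rotC (tens P Q R *ᵥ ψ) = tens R P Q *ᵥ rotC ψ := by
  funext p
  simp only [rotC, tens_mulVec_apply]
  exact Fintype.sum_equiv ⟨fun q => (q.2.2, q.1, q.2.1), fun q => (q.2.1, q.2.2, q.1),
    fun _ => rfl, fun _ => rfl⟩ _ _ fun _ => by simp only [Equiv.coe_fn_mk]; ring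

theorem nsq_swapAB (ψ : Fin a × Fin b × Fin c → ℂ) : nsq (swapAB ψ) = nsq ψ := by
  simp only [nsq, swapAB, Fintype.sum_prod_type]
  rw [Finset.sum_comm]

theorem nsq_rotC (ψ : Fin a × Fin b × Fin c → ℂ) : nsq (rotC ψ) = nsq ψ := by
  simp only [nsq, rotC, Fintype.sum_prod_type]
  rw [Finset.sum_comm]
  exact Finset.sum_congr rfl fun _ _ => Finset.sum_comm

/-- The flattening of a tensor along the first factor. -/
def flatA (ψ : Fin a × Fin b × Fin c → ℂ) : Matrix (Fin a) (Fin b × Fin c) ℂ :=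
  of fun i p => ψ (i, p)

theorem rhoA_eq_flatA (ψ : Fin a × Fin b × Fin c → ℂ) : rhoA ψ = flatA ψ * (flatA ψ)ᴴ := by
  ext i i'
  simp [rhoA, flatA, mul_apply, Fintype.sum_prod_type]

theorem isHermitian_rhoA (ψ : Fin a × Fin b × Fin c → ℂ) : (rhoA ψ).IsHermitian := by
  rw [rhoA_eq_flatA]; exact isHermitian_mul_conjTranspose_self _

theorem isHermitian_rhoB (ψ : Fin a × Fin b × Fin c → ℂ) : (rhoB ψ).IsHermitian := by
  rw [rhoB_eq]; exact isHermitian_rhoA _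

theorem isHermitian_rhoC (ψ : Fin a × Fin b × Fin c → ℂ) : (rhoC ψ).IsHermitian := by
  rw [rhoC_eq]; exact isHermitian_rhoA _

theorem flatA_tens (P : Matrix (Fin a) (Fin a) ℂ) (Q : Matrix (Fin b) (Fin b) ℂ)
    (R : Matrix (Fin c) (Fin c) ℂ) (ψ : Fin a × Fin b × Fin c → ℂ) :
    flatA (tens P Q R *ᵥ ψ) = P * flatA ψ * (Q ⊗ₖ R)ᵀ := by
  ext i p
  simp only [flatA, of_apply, tens_mulVec_apply, mul_apply, transpose_apply, kroneckerMap_apply,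
    Fintype.sum_prod_type (f := fun q : Fin a × Fin b × Fin c => _), Finset.sum_mul]
  rw [Finset.sum_comm]
  refine Finset.sum_congr rfl fun _ _ => Finset.sum_congr rfl fun _ _ => by ring

theorem rhoA_tens (P : Matrix (Fin a) (Fin a) ℂ) {Q : Matrix (Fin b) (Fin b) ℂ}
    {R : Matrix (Fin c) (Fin c) ℂ} (hQ : Q ∈ unitaryGroup (Fin b) ℂ)
    (hR : R ∈ unitaryGroup (Fin c) ℂ) (ψ : Fin a × Fin b × Fin c → ℂ) :
    rhoA (tens P Q R *ᵥ ψ) = P * rhoA ψ * Pᴴ := by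
  have hQ' : Qᴴ * Q = 1 := mem_unitaryGroup_iff'.1 hQ
  have hR' : Rᴴ * R = 1 := mem_unitaryGroup_iff'.1 hR
  have h : (Q ⊗ₖ R)ᵀ * ((Q ⊗ₖ R)ᵀ)ᴴ = 1 := by
    have : ((Q ⊗ₖ R)ᵀ)ᴴ = ((Q ⊗ₖ R)ᴴ)ᵀ := rfl
    rw [this, ← transpose_mul, conjTranspose_kronecker,
      ← mul_kronecker_mul, hQ', hR', one_kronecker_one, transpose_one]
  rw [rhoA_eq_flatA, flatA_tens, rhoA_eq_flatA, conjTranspose_mul, conjTranspose_mul]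
  calc _ = P * flatA ψ * ((Q ⊗ₖ R)ᵀ * ((Q ⊗ₖ R)ᵀ)ᴴ) * ((flatA ψ)ᴴ * Pᴴ) := by
        simp only [Matrix.mul_assoc]
    _ = _ := by rw [h]; simp only [Matrix.mul_assoc, Matrix.one_mul]

theorem rhoB_tens {P : Matrix (Fin a) (Fin a) ℂ} (Q : Matrix (Fin b) (Fin b) ℂ)
    {R : Matrix (Fin c) (Fin c) ℂ} (hP : P ∈ unitaryGroup (Fin a) ℂ)
    (hR : R ∈ unitaryGroup (Fin c) ℂ) (ψ : Fin a × Fin b × Fin c → ℂ) :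
    rhoB (tens P Q R *ᵥ ψ) = Q * rhoB ψ * Qᴴ := by
  rw [rhoB_eq, swapAB_tens, rhoA_tens _ hP hR, rhoB_eq]

theorem rhoC_tens {P : Matrix (Fin a) (Fin a) ℂ} {Q : Matrix (Fin b) (Fin b) ℂ}
    (R : Matrix (Fin c) (Fin c) ℂ) (hP : P ∈ unitaryGroup (Fin a) ℂ)
    (hQ : Q ∈ unitaryGroup (Fin b) ℂ) (ψ : Fin a × Fin b × Fin c → ℂ) :
    rhoC (tens P Q R *ᵥ ψ) = R * rhoC ψ * Rᴴ := by
  rw [rhoC_eq, rotC_tens, rhoA_tens _ hP hQ, rhoC_eq]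

theorem rhoA_smul (t : ℂ) (ψ : Fin a × Fin b × Fin c → ℂ) :
    rhoA (t • ψ) = ((‖t‖ ^ 2 : ℝ) : ℂ) • rhoA ψ := by
  ext i i'
  simp only [rhoA, of_apply, Pi.smul_apply, smul_eq_mul, map_mul, Matrix.smul_apply, Finset.mul_sum]
  refine Finset.sum_congr rfl fun _ _ => Finset.sum_congr rfl fun _ _ => ?_
  have : ((‖t‖ ^ 2 : ℝ) : ℂ) = t * (starRingEnd ℂ) t := by
    rw [Complex.mul_conj, Complex.normSq_eq_norm_sq]
  rw [this]; ring

theorem rhoA_apply_self (ψ : Fin a × Fin b × Fin c → ℂ) (i : Fin a) :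
    rhoA ψ i i = ((∑ j, ∑ k, ‖ψ (i, j, k)‖ ^ 2 : ℝ) : ℂ) := by
  simp [rhoA, Complex.mul_conj, Complex.normSq_eq_norm_sq]

theorem sum_mul_rhoA (x : Fin a → ℝ) (ψ : Fin a × Fin b × Fin c → ℂ) :
    ∑ i, x i * (rhoA ψ i i).re = ∑ p, x p.1 * ‖ψ p‖ ^ 2 := by
  simp only [rhoA_apply_self, Complex.ofReal_re, Fintype.sum_prod_type, Finset.mul_sum]

theorem sum_mul_rhoB (y : Fin b → ℝ) (ψ : Fin a × Fin b × Fin c → ℂ) :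
    ∑ j, y j * (rhoB ψ j j).re = ∑ p, y p.2.1 * ‖ψ p‖ ^ 2 := by
  rw [rhoB_eq, sum_mul_rhoA]
  simp only [swapAB, Fintype.sum_prod_type]
  rw [Finset.sum_comm]

theorem sum_mul_rhoC (w : Fin c → ℝ) (ψ : Fin a × Fin b × Fin c → ℂ) :
    ∑ k, w k * (rhoC ψ k k).re = ∑ p, w p.2.2 * ‖ψ p‖ ^ 2 := by
  rw [rhoC_eq, sum_mul_rhoA]
  simp only [rotC, Fintype.sum_prod_type]
  rw [Finset.sum_comm]
  exact Finset.sum_congr rfl fun _ _ => Finset.sum_comm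

theorem sum_weight_mul (x : Fin a → ℝ) (y : Fin b → ℝ) (w : Fin c → ℝ)
    (ψ : Fin a × Fin b × Fin c → ℂ) :
    ∑ p, (x p.1 + y p.2.1 + w p.2.2) * ‖ψ p‖ ^ 2 =
      ∑ i, x i * (rhoA ψ i i).re + ∑ j, y j * (rhoB ψ j j).re + ∑ k, w k * (rhoC ψ k k).re := by
  rw [sum_mul_rhoA, sum_mul_rhoB, sum_mul_rhoC, ← Finset.sum_add_distrib,
    ← Finset.sum_add_distrib]
  exact Finset.sum_congr rfl fun _ _ => by ring

theorem conj_cancel {n : ℕ} {k : Matrix (Fin n) (Fin n) ℂ} (hk : k ∈ unitaryGroup (Fin n) ℂ)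
    (D : Matrix (Fin n) (Fin n) ℂ) : kᴴ * (k * D * kᴴ) * kᴴᴴ = D := by
  have hk' : kᴴ * k = 1 := mem_unitaryGroup_iff'.1 hk
  rw [conjTranspose_conjTranspose]
  calc _ = (kᴴ * k) * D * (kᴴ * k) := by simp only [Matrix.mul_assoc]
    _ = D := by rw [hk', Matrix.one_mul, Matrix.mul_one]

theorem conjTranspose_mem_unitaryGroup {n : ℕ} {k : Matrix (Fin n) (Fin n) ℂ}
    (hk : k ∈ unitaryGroup (Fin n) ℂ) : kᴴ ∈ unitaryGroup (Fin n) ℂ :=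
  Unitary.star_mem hk

theorem mem_kronCone_iff {lam : (Fin a → ℝ) × (Fin b → ℝ) × (Fin c → ℝ)} :
    lam ∈ KronCone a b c ↔ (Antitone lam.1 ∧ Antitone lam.2.1 ∧ Antitone lam.2.2) ∧
      ∃ ψ : Fin a × Fin b × Fin c → ℂ, rhoA ψ = diagonal (fun i => (lam.1 i : ℂ)) ∧
        rhoB ψ = diagonal (fun i => (lam.2.1 i : ℂ)) ∧
        rhoC ψ = diagonal (fun i => (lam.2.2 i : ℂ)) := by
  constructor
  · rintro ⟨ψ, hA, hB, hC⟩
    obtain ⟨p, hp, hpe⟩ := hA.exists_unitary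
    obtain ⟨q, hq, hqe⟩ := hB.exists_unitary
    obtain ⟨r, hr, hre⟩ := hC.exists_unitary
    have hp' := conjTranspose_mem_unitaryGroup hp
    have hq' := conjTranspose_mem_unitaryGroup hq
    have hr' := conjTranspose_mem_unitaryGroup hr
    refine ⟨⟨hA.1, hB.1, hC.1⟩, tens pᴴ qᴴ rᴴ *ᵥ ψ, ?_, ?_, ?_⟩
    · rw [rhoA_tens _ hq' hr', hpe, conj_cancel hp]
    · rw [rhoB_tens _ hp' hr', hqe, conj_cancel hq]
    · rw [rhoC_tens _ hp' hq', hre, conj_cancel hr]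
  · rintro ⟨⟨h1, h2, h3⟩, ψ, hA, hB, hC⟩
    exact ⟨ψ, isSpecDown_of_unitary h1 (one_mem _) (by simp [hA]),
      isSpecDown_of_unitary h2 (one_mem _) (by simp [hB]),
      isSpecDown_of_unitary h3 (one_mem _) (by simp [hC])⟩

end
end

section

open Matrix

theorem MvPolynomial.finitePresentation_bind₁ {ι τ : Type} [Finite ι] [Finite τ]
    (m : ι → MvPolynomial τ ℂ) :
    RingHom.FinitePresentation
      (MvPolynomial.bind₁ m : MvPolynomial ι ℂ →ₐ[ℂ] MvPolynomial τ ℂ).toRingHom := by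
  rw [← RingHom.FinitePresentation.of_finiteType]
  refine RingHom.FiniteType.of_comp_finiteType (f := MvPolynomial.C) ?_
  have : ((MvPolynomial.bind₁ m : MvPolynomial ι ℂ →ₐ[ℂ] MvPolynomial τ ℂ).toRingHom).comp
      MvPolynomial.C = algebraMap ℂ (MvPolynomial τ ℂ) := by
    ext x : 1
    simp [MvPolynomial.algebraMap_eq]
  rw [this, RingHom.finiteType_algebraMap]
  infer_instance

/-- Chevalley's theorem for polynomial maps: a polynomial map with Zariski dense image
contains a nonempty principal Zariski open set in its image. -/
theorem MvPolynomial.exists_vanishing_or_image {ι τ : Type} [Finite ι] [Finite τ]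
    (m : ι → MvPolynomial τ ℂ) :
    (∃ f : MvPolynomial ι ℂ, f ≠ 0 ∧
      ∀ y : τ → ℂ, MvPolynomial.eval (fun p => MvPolynomial.eval y (m p)) f = 0) ∨
    ∃ f : MvPolynomial ι ℂ, f ≠ 0 ∧
      ∀ y : ι → ℂ, MvPolynomial.eval y f ≠ 0 → ∃ x, ∀ p, MvPolynomial.eval x (m p) = y p := by
  classical
  set φ := (MvPolynomial.bind₁ m : MvPolynomial ι ℂ →ₐ[ℂ] MvPolynomial τ ℂ).toRingHom with hφ
  have hev : ∀ (x : τ → ℂ) f, MvPolynomial.eval x (φ f) =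
      MvPolynomial.eval (fun p => MvPolynomial.eval x (m p)) f := by
    intro x f
    simpa [hφ] using MvPolynomial.eval₂Hom_bind₁ (RingHom.id ℂ) x m f
  by_cases hinj : Function.Injective φ
  · right
    obtain ⟨S, hS⟩ := PrimeSpectrum.exists_constructibleSetData_iff.2
      (PrimeSpectrum.isConstructible_range_comap (MvPolynomial.finitePresentation_bind₁ m))
    have hbot : (⊥ : PrimeSpectrum (MvPolynomial ι ℂ)) ∈ Set.range (PrimeSpectrum.comap φ) := by
      refine ⟨⊥, ?_⟩
      ext1
      rw [PrimeSpectrum.comap_asIdeal]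
      change Ideal.comap φ ⊥ = ⊥
      rw [← RingHom.ker_eq_comap_bot, (RingHom.injective_iff_ker_eq_bot φ).1 hinj]
    rw [← hS] at hbot
    simp only [PrimeSpectrum.ConstructibleSetData.toSet, Set.mem_iUnion, exists_prop] at hbot
    obtain ⟨C, hC, hbC⟩ := hbot
    have hg : ∀ i, C.g i = 0 := by
      intro i
      have := hbC.1 ⟨i, rfl⟩
      simpa using this
    have hf : C.f ≠ 0 := by
      intro h0
      apply hbC.2
      simp [h0]
    refine ⟨C.f, hf, fun y hy => ?_⟩
    have hmax : (MvPolynomial.vanishingIdeal ℂ {y}).IsMaximal :=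
      MvPolynomial.isMaximal_iff_eq_vanishingIdeal_singleton.2 ⟨y, rfl⟩
    have hmem : (⟨MvPolynomial.vanishingIdeal ℂ {y}, hmax.isPrime⟩ :
        PrimeSpectrum (MvPolynomial ι ℂ)) ∈ Set.range (PrimeSpectrum.comap φ) := by
      rw [← hS]
      simp only [PrimeSpectrum.ConstructibleSetData.toSet, Set.mem_iUnion, exists_prop]
      refine ⟨C, hC, ?_, ?_⟩
      · rw [PrimeSpectrum.mem_zeroLocus]
        rintro _ ⟨i, rfl⟩
        rw [hg i]
        exact Ideal.zero_mem _
      · rw [PrimeSpectrum.mem_zeroLocus, Set.singleton_subset_iff]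
        intro h
        have := (MvPolynomial.mem_vanishingIdeal_singleton_iff y C.f).1 h
        exact hy (by simpa [MvPolynomial.aeval_eq_eval] using this)
    obtain ⟨q, hq⟩ := hmem
    obtain ⟨M, hM, hqM⟩ := Ideal.exists_le_maximal q.asIdeal q.isPrime.ne_top
    obtain ⟨x, rfl⟩ := MvPolynomial.isMaximal_iff_eq_vanishingIdeal_singleton.1 hM
    refine ⟨x, fun p => ?_⟩
    have h1 : (MvPolynomial.X p - MvPolynomial.C (y p) : MvPolynomial ι ℂ) ∈
        MvPolynomial.vanishingIdeal ℂ {y} := by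
      rw [MvPolynomial.mem_vanishingIdeal_singleton_iff]
      simp
    have h2 : φ (MvPolynomial.X p - MvPolynomial.C (y p)) ∈ q.asIdeal := by
      have h3 := congrArg PrimeSpectrum.asIdeal hq
      rw [PrimeSpectrum.comap_asIdeal] at h3
      rw [← Ideal.mem_comap, h3]
      exact h1
    have h4 := (MvPolynomial.mem_vanishingIdeal_singleton_iff x _).1 (hqM h2)
    rw [MvPolynomial.aeval_eq_eval] at h4
    have h5 := hev x (MvPolynomial.X p - MvPolynomial.C (y p))
    simp only [map_sub, MvPolynomial.eval_X, MvPolynomial.eval_C] at h5 h4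
    have h6 : MvPolynomial.eval x (m p) - y p = 0 := by
      rw [← h5]; simpa using h4
    exact sub_eq_zero.1 h6
  · left
    rw [injective_iff_map_eq_zero] at hinj
    push Not at hinj
    obtain ⟨f, hf, hf0⟩ := hinj
    exact ⟨f, hf0, fun y => by rw [← hev, hf, map_zero]⟩

/-- The complement of a hypersurface is dense. -/
theorem MvPolynomial.exists_seq_tendsto_eval_ne_zero {ι : Type} [Finite ι]
    {f : MvPolynomial ι ℂ} (hf : f ≠ 0) (y : ι → ℂ) :
    ∃ u : ℕ → ι → ℂ, Filter.Tendsto u Filter.atTop (nhds y) ∧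
      ∀ n, MvPolynomial.eval (u n) f ≠ 0 := by
  obtain ⟨x, hx⟩ : ∃ x, MvPolynomial.eval x f ≠ 0 := by
    by_contra! h
    exact hf (MvPolynomial.funext fun x => by simpa using h x)
  set g : Polynomial ℂ := MvPolynomial.aeval
    (fun p => Polynomial.C (y p) + Polynomial.X * Polynomial.C (x p - y p)) f with hg
  have hge : ∀ t : ℂ, g.eval t = MvPolynomial.eval (fun p => y p + t * (x p - y p)) f := by
    intro t
    have := MvPolynomial.map_aeval (fun p => Polynomial.C (y p) + Polynomial.X *
      Polynomial.C (x p - y p)) (Polynomial.evalRingHom t) f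
    rw [Polynomial.coe_evalRingHom] at this
    rw [hg, this, MvPolynomial.eval]
    have h2 : (Polynomial.evalRingHom t).comp (algebraMap ℂ (Polynomial ℂ)) = RingHom.id ℂ := by
      ext z; simp
    rw [h2]
    simp
  have hg0 : g ≠ 0 := by
    intro h
    have := hge 1
    rw [h] at this
    apply hx
    simpa using this.symm
  have hfin : {t : ℂ | g.eval t = 0}.Finite := by
    refine (g.roots.toFinset.finite_toSet).subset fun t ht => ?_
    simpa [hg0] using ht
  have hd : Dense {t : ℂ | g.eval t = 0}ᶜ := hfin.countable.dense_compl ℂ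
  obtain ⟨t, ht, htl⟩ := mem_closure_iff_seq_limit.1 (hd 0)
  refine ⟨fun n p => y p + t n * (x p - y p), ?_, fun n => ?_⟩
  · rw [tendsto_pi_nhds]
    intro p
    have := (htl.mul_const (x p - y p)).const_add (y p)
    simpa using this
  · rw [← hge]; exact ht n

/-- A polynomial map either takes values in a hypersurface or has dense image. -/
theorem MvPolynomial.exists_vanishing_or_dense {ι τ : Type} [Finite ι] [Finite τ]
    (m : ι → MvPolynomial τ ℂ) :
    (∃ f : MvPolynomial ι ℂ, f ≠ 0 ∧
      ∀ y : τ → ℂ, MvPolynomial.eval (fun p => MvPolynomial.eval y (m p)) f = 0) ∨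
    ∀ z : ι → ℂ, ∃ u : ℕ → τ → ℂ,
      Filter.Tendsto (fun n p => MvPolynomial.eval (u n) (m p)) Filter.atTop (nhds z) := by
  rcases MvPolynomial.exists_vanishing_or_image m with h | ⟨f, hf, h⟩
  · exact Or.inl h
  · right
    intro z
    obtain ⟨w, hw, hne⟩ := MvPolynomial.exists_seq_tendsto_eval_ne_zero hf z
    choose u hu using fun n => h (w n) (hne n)
    refine ⟨u, ?_⟩
    convert hw using 2 with n
    funext p
    exact hu n p

end

section

open Matrix

theorem sum_mul_le_of_prefix_sum_le_nat {X Y : ℕ → ℝ} (hX : Antitone X) {C : ℝ}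
    (m : ℕ) (hC : ∀ r ≤ m, ∑ i ∈ Finset.range r, Y i ≤ C) :
    ∑ i ∈ Finset.range m, X i * Y i ≤
      C * (X 0 - X m) + X m * ∑ i ∈ Finset.range m, Y i := by
  induction m with
  | zero => simp
  | succ m ih =>
    have h1 := ih fun r hr => hC r (by omega)
    have h2 := hC (m + 1) le_rfl
    have h3 := hX (Nat.le_succ m)
    rw [Finset.sum_range_succ] at h2 ⊢
    rw [Finset.sum_range_succ]
    nlinarith [mul_nonneg (sub_nonneg.2 h3) (sub_nonneg.2 h2)]

/-- Abel summation: prefix sums bounded above give a bound on antitone weighted sums. -/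
theorem sum_mul_le_of_prefix_sum_le {n : ℕ} {x y : Fin n → ℝ} (hx : Antitone x)
    (hy : ∑ i, y i = 0) {C D : ℝ} (hC0 : 0 ≤ C) (hD0 : 0 ≤ D) (hD : ∀ i j, x i - x j ≤ D)
    (hC : ∀ r : ℕ, ∑ i with i.1 < r, y i ≤ C) : ∑ i, x i * y i ≤ C * D := by
  rcases Nat.eq_zero_or_pos n with rfl | hn
  · simpa using mul_nonneg hC0 hD0
  · set X : ℕ → ℝ := fun i => x ⟨min i (n - 1), by omega⟩ with hX
    set Y : ℕ → ℝ := fun i => if h : i < n then y ⟨i, h⟩ else 0 with hY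
    have hXa : Antitone X := fun i j hij => hx (by simp only [Fin.mk_le_mk]; omega)
    have hXe : ∀ i : Fin n, X i = x i := fun i => by
      simp only [hX]; congr; omega
    have hYe : ∀ i : Fin n, Y i = y i := fun i => by simp [hY]
    have hpre : ∀ r ≤ n, ∑ i ∈ Finset.range r, Y i = ∑ i with i.1 < r, y i := by
      intro r hr
      rw [Finset.sum_filter]
      simp only [← hYe]
      rw [Fin.sum_univ_eq_sum_range (fun i => if i < r then Y i else 0), ← Finset.sum_filter]
      congr 1
      ext i
      simp only [Finset.mem_range, Finset.mem_filter]
      omega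
    have h := sum_mul_le_of_prefix_sum_le_nat hXa (Y := Y) (C := C) n
      fun r hr => by rw [hpre r hr]; exact hC r
    have hYt : ∑ i ∈ Finset.range n, Y i = 0 := by
      rw [← Fin.sum_univ_eq_sum_range]; simp only [hYe, hy]
    rw [← Fin.sum_univ_eq_sum_range (fun i => X i * Y i), hYt] at h
    simp only [hXe, hYe, mul_zero, add_zero] at h
    exact h.trans (mul_le_mul_of_nonneg_left (hD _ _) hC0)

/-- Lower unitriangular matrices. -/
def IsLowerUni {n : ℕ} (v : Matrix (Fin n) (Fin n) ℂ) : Prop :=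
  (∀ i, v i i = 1) ∧ ∀ i j, i < j → v i j = 0

section
variable {n : ℕ}

local notation "𝔼" => EuclideanSpace ℂ (Fin n)

open InnerProductSpace

theorem sub_sum_inner_smul_mem_orthogonal {ι : Type*} {E : Type*} [NormedAddCommGroup E]
    [InnerProductSpace ℂ E] {v : ι → E} (hv : Orthonormal ℂ v) (s : Finset ι) (x : E) :
    x - ∑ i ∈ s, (inner ℂ (v i) x : ℂ) • v i ∈ (Submodule.span ℂ (v '' s))ᗮ := by
  rw [Submodule.mem_orthogonal]
  intro u hu
  induction hu using Submodule.span_induction with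
  | mem u hu =>
    obtain ⟨i, hi, rfl⟩ := hu
    rw [inner_sub_right, hv.inner_right_sum _ hi, sub_self]
  | zero => simp
  | add u u' _ _ h h' => rw [inner_add_left, h, h', add_zero]
  | smul t u _ h => rw [inner_smul_left, h, mul_zero]

theorem sum_norm_sq_inner_eq_of_span_eq {ι κ : Type*} {E : Type*} [NormedAddCommGroup E]
    [InnerProductSpace ℂ E] {v : ι → E} {w : κ → E} {s : Finset ι} {t : Finset κ}
    (hv : Orthonormal ℂ v) (hw : Orthonormal ℂ w)
    (h : Submodule.span ℂ (v '' s) = Submodule.span ℂ (w '' t)) (x : E) :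
    ∑ i ∈ s, ‖inner ℂ (v i) x‖ ^ 2 = ∑ j ∈ t, ‖inner ℂ (w j) x‖ ^ 2 := by
  classical
  set y := ∑ i ∈ s, inner ℂ (v i) x • v i with hy
  set y' := ∑ j ∈ t, inner ℂ (w j) x • w j with hy'
  have hyF : y ∈ Submodule.span ℂ (v '' s) :=
    Submodule.sum_mem _ fun i hi =>
      Submodule.smul_mem _ _ (Submodule.subset_span ⟨i, hi, rfl⟩)
  have hyF' : y' ∈ Submodule.span ℂ (v '' s) := by
    rw [h]
    exact Submodule.sum_mem _ fun i hi =>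
      Submodule.smul_mem _ _ (Submodule.subset_span ⟨i, hi, rfl⟩)
  have ho : x - y ∈ (Submodule.span ℂ (v '' s))ᗮ :=
    sub_sum_inner_smul_mem_orthogonal hv s x
  have ho' : x - y' ∈ (Submodule.span ℂ (v '' s))ᗮ := by
    rw [h]
    exact sub_sum_inner_smul_mem_orthogonal hw t x
  have hyy : y = y' := by
    have h1 : y - y' ∈ (Submodule.span ℂ (v '' s))ᗮ := by
      have := Submodule.sub_mem _ ho' ho
      simpa using this
    have h2 := Submodule.sub_mem _ hyF hyF'
    exact sub_eq_zero.1 (Submodule.disjoint_def.1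
      (Submodule.orthogonal_disjoint _) _ h2 h1)
  have e1 : (inner ℂ y x : ℂ) = ((∑ i ∈ s, ‖inner ℂ (v i) x‖ ^ 2 : ℝ) : ℂ) := by
    rw [hy, sum_inner]
    push_cast
    exact Finset.sum_congr rfl fun i _ => by
      rw [inner_smul_left, RCLike.conj_mul]; rfl
  have e2 : (inner ℂ y' x : ℂ) = ((∑ j ∈ t, ‖inner ℂ (w j) x‖ ^ 2 : ℝ) : ℂ) := by
    rw [hy', sum_inner]
    push_cast
    exact Finset.sum_congr rfl fun i _ => by
      rw [inner_smul_left, RCLike.conj_mul]; rfl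
  rw [hyy, e2] at e1
  exact_mod_cast e1.symm

theorem sum_diag_le_of_triangular {v : Fin n → 𝔼} (hv : LinearIndependent ℂ v)
    (hv0 : ∀ i j, i < j → v j i = 0) {lam : Fin n → ℝ} (hlam : Antitone lam) {ι : Type*}
    {e : ι → 𝔼} (he : Orthonormal ℂ e) (s : Finset ι) (J : Finset (Fin n))
    (hspan : Submodule.span ℂ (e '' s) = Submodule.span ℂ (v '' J)) :
    ∑ m ∈ s, ∑ i, lam i * ‖e m i‖ ^ 2 ≤ ∑ j ∈ J, lam j := by
  set f : (J)ᵒᵈ → 𝔼 := fun j => v (OrderDual.ofDual j).1 with hf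
  have hfi : LinearIndependent ℂ f :=
    hv.comp (fun j : (J)ᵒᵈ => (OrderDual.ofDual j).1) fun i j hij => by
      simpa [Subtype.ext_iff] using hij
  set w := gramSchmidtNormed ℂ f with hw
  have hwo : Orthonormal ℂ w := gramSchmidtNormed_orthonormal hfi
  have hwspan : Submodule.span ℂ (w '' (Finset.univ : Finset (J)ᵒᵈ)) =
      Submodule.span ℂ (v '' J) := by
    rw [Finset.coe_univ, Set.image_univ, hw, span_gramSchmidtNormed_range, span_gramSchmidt]
    congr 1
    ext y
    simp [hf]
  have h1 : ∀ i, ∑ m ∈ s, ‖e m i‖ ^ 2 = ∑ j, ‖w j i‖ ^ 2 := by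
    intro i
    have := sum_norm_sq_inner_eq_of_span_eq he hwo (hspan.trans hwspan.symm)
      (EuclideanSpace.single i 1)
    simpa [EuclideanSpace.inner_single_right] using this
  have hw0 : ∀ j : (J)ᵒᵈ, ∀ i, i < (OrderDual.ofDual j).1 → w j i = 0 := by
    intro j i hij
    have h2 : gramSchmidt ℂ f j ∈ Submodule.span ℂ (f '' Set.Iic j) :=
      gramSchmidt_mem_span ℂ f le_rfl
    have h3 : Submodule.span ℂ (f '' Set.Iic j) ≤
        LinearMap.ker (EuclideanSpace.proj (𝕜 := ℂ) i : 𝔼 →L[ℂ] ℂ).toLinearMap := by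
      rw [Submodule.span_le]
      rintro _ ⟨l, hl, rfl⟩
      have : (OrderDual.ofDual j).1 ≤ (OrderDual.ofDual l).1 := hl
      simpa [hf] using hv0 i _ (lt_of_lt_of_le hij this)
    have h4 : gramSchmidt ℂ f j i = 0 := by simpa using h3 h2
    simp [hw, gramSchmidtNormed, h4]
  calc ∑ m ∈ s, ∑ i, lam i * ‖e m i‖ ^ 2 = ∑ i, lam i * ∑ m ∈ s, ‖e m i‖ ^ 2 := by
        rw [Finset.sum_comm]; simp only [Finset.mul_sum]
    _ = ∑ j, ∑ i, lam i * ‖w j i‖ ^ 2 := by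
        simp only [h1, Finset.mul_sum]; rw [Finset.sum_comm]
    _ ≤ ∑ j : (J)ᵒᵈ, lam (OrderDual.ofDual j).1 := by
        refine Finset.sum_le_sum fun j _ => ?_
        have hn : ∑ i, ‖w j i‖ ^ 2 = 1 := by
          rw [← EuclideanSpace.norm_sq_eq, hwo.1 j]; norm_num
        calc ∑ i, lam i * ‖w j i‖ ^ 2 ≤ ∑ i, lam (OrderDual.ofDual j).1 * ‖w j i‖ ^ 2 := by
              refine Finset.sum_le_sum fun i _ => ?_
              rcases lt_or_ge i (OrderDual.ofDual j).1 with h | h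
              · rw [hw0 j i h]; simp
              · exact mul_le_mul_of_nonneg_right (hlam h) (by positivity)
          _ = _ := by rw [← Finset.mul_sum, hn, mul_one]
    _ = ∑ j ∈ J, lam j := by
        rw [← Finset.sum_coe_sort J lam]
        exact Fintype.sum_equiv OrderDual.ofDual _ _ fun _ => rfl

theorem span_gramSchmidt_of_isLowerSet (f : Fin n → 𝔼) {s : Set (Fin n)} (hs : IsLowerSet s) :
    Submodule.span ℂ (gramSchmidt ℂ f '' s) = Submodule.span ℂ (f '' s) := by
  have h : ∀ i ∈ s, Set.Iic i ⊆ s := fun i hi j hj => hs hj hi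
  refine Submodule.span_eq_span (Set.image_subset_iff.2 fun i hi => ?_)
    (Set.image_subset_iff.2 fun i hi => ?_)
  · exact Submodule.span_mono (Set.image_mono (h i hi)) (gramSchmidt_mem_span ℂ f le_rfl)
  · exact Submodule.span_mono (Set.image_mono (h i hi)) (mem_span_gramSchmidt ℂ f le_rfl)

theorem norm_sq_sum_conj_diag (k : Matrix (Fin n) (Fin n) ℂ) (lam : Fin n → ℝ) (i : Fin n) :
    (kᴴ * diagonal (fun i => (lam i : ℂ)) * k) i i =
      ((∑ r, lam r * ‖k r i‖ ^ 2 : ℝ) : ℂ) := by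
  rw [mul_apply]
  push_cast
  refine Finset.sum_congr rfl fun r _ => ?_
  rw [mul_diagonal, conjTranspose_apply, mul_right_comm, mul_comm]
  congr 1
  exact RCLike.conj_mul _

/-- For `v` lower unitriangular and real weights `x` there is a unitary `k` such that `kᴴ v` is
block triangular for `x`, and rotating a diagonal matrix by `k` decreases its `x`-weight. -/
theorem exists_unitary_triangular {lam : Fin n → ℝ} (hlam : Antitone lam)
    {v : Matrix (Fin n) (Fin n) ℂ} (hv : IsLowerUni v) (x : Fin n → ℝ) :
    ∃ k ∈ unitaryGroup (Fin n) ℂ, (∀ i j, (kᴴ * v) i j ≠ 0 → x j ≤ x i) ∧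
      ∑ i, x i * ((kᴴ * diagonal (fun i => (lam i : ℂ)) * k) i i).re ≤ ∑ i, x i * lam i := by
  obtain ⟨σ, hσ⟩ := exists_perm_antitone x
  set V : Fin n → 𝔼 := fun j => WithLp.toLp 2 (fun i => v i j) with hV
  have hVapp : ∀ i j, V j i = v i j := fun _ _ => rfl
  have hdet : v.det = 1 := by
    rw [det_of_isLowerTriangular (M := v) (fun i j hij => hv.2 i j hij)]
    simp [hv.1]
  have hVi : LinearIndependent ℂ V := by
    have h1 : LinearIndependent ℂ v.col := by
      rw [Matrix.linearIndependent_cols_iff_isUnit, isUnit_iff_isUnit_det, hdet]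
      exact isUnit_one
    have := h1.map' (WithLp.linearEquiv 2 ℂ (Fin n → ℂ)).symm.toLinearMap
      (LinearEquiv.ker _)
    exact this
  have hVs : LinearIndependent ℂ (V ∘ σ) := hVi.comp σ σ.injective
  set e := gramSchmidtNormed ℂ (V ∘ σ) with he
  have heo : Orthonormal ℂ e := gramSchmidtNormed_orthonormal hVs
  set k : Matrix (Fin n) (Fin n) ℂ := of fun i m => e (σ.symm m) i with hk
  have hkk : kᴴ * k = 1 := by
    ext i j
    have h1 := (orthonormal_iff_ite.1 heo) (σ.symm i) (σ.symm j)
    rw [PiLp.inner_apply] at h1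
    simp only [mul_apply, conjTranspose_apply, one_apply, hk, of_apply]
    simp only [EmbeddingLike.apply_eq_iff_eq] at h1
    rw [← h1]
    refine Finset.sum_congr rfl fun r _ => ?_
    simp [mul_comm]
  have hku : k ∈ unitaryGroup (Fin n) ℂ := mem_unitaryGroup_iff'.2 hkk
  refine ⟨k, hku, ?_, ?_⟩
  · intro i j hij
    by_contra! hlt
    apply hij
    have h1 : (kᴴ * v) i j = inner ℂ (e (σ.symm i)) (V j) := by
      rw [PiLp.inner_apply]
      simp only [mul_apply, conjTranspose_apply, hk, of_apply]
      refine Finset.sum_congr rfl fun r _ => ?_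
      simp [mul_comm, hVapp]
    have h2 : σ.symm j < σ.symm i := by
      by_contra! h
      have := hσ h
      simp only [Function.comp_apply, Equiv.apply_symm_apply] at this
      linarith
    have h3 := gramSchmidt_inv_triangular ℂ (V ∘ σ) h2
    rw [h1, he, gramSchmidtNormed, inner_smul_left]
    simp only [Function.comp_apply, Equiv.apply_symm_apply] at h3
    rw [h3, mul_zero]
  · simp only [norm_sq_sum_conj_diag, Complex.ofReal_re]
    set y : Fin n → ℝ := fun m => ∑ r, lam r * ‖e m r‖ ^ 2 - lam (σ m) with hy
    have hyt : ∑ m, y m = 0 := by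
      have h1 : ∑ i, (kᴴ * diagonal (fun i => (lam i : ℂ)) * k) i i = ∑ i, (lam i : ℂ) := by
        have : (kᴴ * diagonal (fun i => (lam i : ℂ)) * k).trace = ∑ i, (lam i : ℂ) := by
          rw [Matrix.mul_assoc, trace_mul_comm, Matrix.mul_assoc,
            show k * kᴴ = 1 from mem_unitaryGroup_iff.1 hku, Matrix.mul_one, trace_diagonal]
        exact this
      simp only [norm_sq_sum_conj_diag] at h1
      have h2 : ∑ i, ∑ r, lam r * ‖k r i‖ ^ 2 = ∑ i, lam i := by exact_mod_cast h1
      rw [hy, Finset.sum_sub_distrib, Equiv.sum_comp σ lam, ← h2, sub_eq_zero]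
      exact Fintype.sum_equiv σ _ _ fun m => by simp [hk]
    have hpre : ∀ r : ℕ, ∑ i with i.1 < r, y i ≤ 0 := by
      intro r
      rw [hy, Finset.sum_sub_distrib, sub_nonpos]
      have h1 := sum_diag_le_of_triangular hVi (fun i j hij => hv.2 i j hij) hlam heo
        (Finset.univ.filter fun i : Fin n => i.1 < r)
        ((Finset.univ.filter fun i : Fin n => i.1 < r).map σ.toEmbedding) (by
          rw [he, span_gramSchmidtNormed, span_gramSchmidt_of_isLowerSet]
          · rw [Finset.coe_map, Equiv.coe_toEmbedding, Set.image_comp]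
          · intro i j hij hi
            simp only [Finset.coe_filter, Finset.mem_univ, true_and, Set.mem_ofPred_eq] at hi ⊢
            exact lt_of_le_of_lt hij hi)
      simpa using h1
    have h := sum_mul_le_of_prefix_sum_le hσ hyt le_rfl
      (D := ∑ i, ∑ j, |x i - x j|) (by positivity) (by
        intro i j
        refine (le_abs_self _).trans ?_
        refine (Finset.single_le_sum (f := fun j => |x (σ i) - x j|)
          (fun _ _ => abs_nonneg _) (Finset.mem_univ (σ j))).trans ?_
        exact Finset.single_le_sum (f := fun i => ∑ j, |x i - x j|)
          (fun _ _ => Finset.sum_nonneg fun _ _ => abs_nonneg _) (Finset.mem_univ (σ i))) hpre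
    rw [zero_mul] at h
    simp only [hy, mul_sub, Finset.sum_sub_distrib, Function.comp_apply] at h
    rw [Equiv.sum_comp σ (fun i => x i * lam i), sub_nonpos] at h
    refine le_trans (le_of_eq ?_) h
    symm
    exact Fintype.sum_equiv σ _ _ fun m => by simp [hk]

end
end

section

open Matrix Filter Topology

section
variable {a b c : ℕ}

/-- The orbit of the tensors supported on `S` under lower unitriangular triples is dense. -/
def DenseOrbit (S : Finset (Fin a × Fin b × Fin c)) : Prop :=
  ∀ z : Fin a × Fin b × Fin c → ℂ, ∃ (u : ℕ → Matrix (Fin a) (Fin a) ℂ)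
    (v : ℕ → Matrix (Fin b) (Fin b) ℂ) (w : ℕ → Matrix (Fin c) (Fin c) ℂ)
    (ξ : ℕ → Fin a × Fin b × Fin c → ℂ),
    (∀ n, IsLowerUni (u n) ∧ IsLowerUni (v n) ∧ IsLowerUni (w n) ∧ ∀ p ∉ S, ξ n p = 0) ∧
    Tendsto (fun n => tens (u n) (v n) (w n) *ᵥ ξ n) atTop (𝓝 z)

/-- A lower unitriangular matrix of variables, evaluated. -/
def lowerUniOf {n : ℕ} {R : Type*} [CommRing R] (x : Fin n × Fin n → R) :
    Matrix (Fin n) (Fin n) R :=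
  of fun i j => if i = j then 1 else if j < i then x (i, j) else 0

theorem isLowerUni_lowerUniOf {n : ℕ} (x : Fin n × Fin n → ℂ) : IsLowerUni (lowerUniOf x) := by
  refine ⟨fun i => by simp [lowerUniOf], fun i j hij => ?_⟩
  simp [lowerUniOf, hij.ne, hij.not_gt]

theorem lowerUniOf_self {n : ℕ} {v : Matrix (Fin n) (Fin n) ℂ} (hv : IsLowerUni v) :
    lowerUniOf (fun p => v p.1 p.2) = v := by
  ext i j
  simp only [lowerUniOf, of_apply]
  split_ifs with h1 h2
  · rw [h1, hv.1]
  · rfl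
  · exact (hv.2 i j (lt_of_le_of_ne (not_lt.1 h2) h1)).symm

theorem eval_lowerUniOf {n : ℕ} {τ : Type*} (x : Fin n × Fin n → MvPolynomial τ ℂ) (y : τ → ℂ)
    (i j : Fin n) : MvPolynomial.eval y (lowerUniOf x i j) =
      lowerUniOf (fun p => MvPolynomial.eval y (x p)) i j := by
  simp only [lowerUniOf, of_apply]
  split_ifs <;> simp

theorem exists_vanishing_or_denseOrbit (S : Finset (Fin a × Fin b × Fin c)) :
    (∃ f : MvPolynomial (Fin a × Fin b × Fin c) ℂ, f ≠ 0 ∧ ∀ u v w ξ, IsLowerUni u →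
      IsLowerUni v → IsLowerUni w → (∀ p ∉ S, ξ p = 0) →
      MvPolynomial.eval (tens u v w *ᵥ ξ) f = 0) ∨ DenseOrbit S := by
  classical
  let τ := (Fin a × Fin a) ⊕ (Fin b × Fin b) ⊕ (Fin c × Fin c) ⊕ (Fin a × Fin b × Fin c)
  let xA : Fin a × Fin a → MvPolynomial τ ℂ := fun p => MvPolynomial.X (Sum.inl p)
  let xB : Fin b × Fin b → MvPolynomial τ ℂ := fun p => MvPolynomial.X (Sum.inr (Sum.inl p))
  let xC : Fin c × Fin c → MvPolynomial τ ℂ :=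
    fun p => MvPolynomial.X (Sum.inr (Sum.inr (Sum.inl p)))
  let xS : Fin a × Fin b × Fin c → MvPolynomial τ ℂ :=
    fun p => if p ∈ S then MvPolynomial.X (Sum.inr (Sum.inr (Sum.inr p))) else 0
  let m : Fin a × Fin b × Fin c → MvPolynomial τ ℂ := fun p =>
    ∑ q, lowerUniOf xA p.1 q.1 * (lowerUniOf xB p.2.1 q.2.1 * lowerUniOf xC p.2.2 q.2.2) * xS q
  have hm : ∀ y : τ → ℂ, (fun p => MvPolynomial.eval y (m p)) =
      tens (lowerUniOf fun p => y (Sum.inl p)) (lowerUniOf fun p => y (Sum.inr (Sum.inl p)))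
        (lowerUniOf fun p => y (Sum.inr (Sum.inr (Sum.inl p)))) *ᵥ
        fun p => if p ∈ S then y (Sum.inr (Sum.inr (Sum.inr p))) else 0 := by
    intro y
    funext p
    rw [tens_mulVec_apply]
    simp only [m, map_sum, map_mul, eval_lowerUniOf, xA, xB, xC, xS, MvPolynomial.eval_X]
    refine Finset.sum_congr rfl fun q _ => ?_
    split_ifs <;> simp
  rcases MvPolynomial.exists_vanishing_or_dense m with ⟨f, hf, h⟩ | h
  · refine Or.inl ⟨f, hf, fun u v w ξ hu hv hw hξ => ?_⟩
    have h1 := h (Sum.elim (fun p => u p.1 p.2) (Sum.elim (fun p => v p.1 p.2)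
      (Sum.elim (fun p => w p.1 p.2) ξ)))
    rw [hm] at h1
    simp only [Sum.elim_inl, Sum.elim_inr, lowerUniOf_self hu, lowerUniOf_self hv,
      lowerUniOf_self hw] at h1
    have h2 : (fun p => if p ∈ S then ξ p else 0) = ξ := by
      funext p
      split_ifs with hp
      · rfl
      · exact (hξ p hp).symm
    rwa [h2] at h1
  · right
    intro z
    obtain ⟨y, hy⟩ := h z
    refine ⟨fun n => lowerUniOf fun p => y n (Sum.inl p),
      fun n => lowerUniOf fun p => y n (Sum.inr (Sum.inl p)),
      fun n => lowerUniOf fun p => y n (Sum.inr (Sum.inr (Sum.inl p))),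
      fun n p => if p ∈ S then y n (Sum.inr (Sum.inr (Sum.inr p))) else 0,
      fun n => ⟨isLowerUni_lowerUniOf _, isLowerUni_lowerUniOf _, isLowerUni_lowerUniOf _,
        fun p hp => if_neg hp⟩, ?_⟩
    exact hy.congr fun n => hm (y n)

/-- The inequalities cut out by all densely orbiting supports. -/
def DualGood (lam : (Fin a → ℝ) × (Fin b → ℝ) × (Fin c → ℝ)) : Prop :=
  ∀ S : Finset (Fin a × Fin b × Fin c), DenseOrbit S →
    ∀ (x : Fin a → ℝ) (y : Fin b → ℝ) (w : Fin c → ℝ),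
      (∀ p ∈ S, 0 ≤ x p.1 + y p.2.1 + w p.2.2) →
      0 ≤ ∑ i, x i * lam.1 i + ∑ j, y j * lam.2.1 j + ∑ k, w k * lam.2.2 k

theorem DualGood.add {lam mu : (Fin a → ℝ) × (Fin b → ℝ) × (Fin c → ℝ)} (h : DualGood lam)
    (h' : DualGood mu) : DualGood (lam + mu) := by
  intro S hS x y w hx
  have h1 := h S hS x y w hx
  have h2 := h' S hS x y w hx
  simp only [Prod.fst_add, Prod.snd_add, Pi.add_apply, mul_add, Finset.sum_add_distrib]
  linarith

theorem continuous_rhoA : Continuous (rhoA : (Fin a × Fin b × Fin c → ℂ) → _) := by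
  refine continuous_matrix fun i j => ?_
  simp only [rhoA, of_apply]
  fun_prop

theorem continuous_rhoB : Continuous (rhoB : (Fin a × Fin b × Fin c → ℂ) → _) := by
  refine continuous_matrix fun i j => ?_
  simp only [rhoB, of_apply]
  fun_prop

theorem continuous_rhoC : Continuous (rhoC : (Fin a × Fin b × Fin c → ℂ) → _) := by
  refine continuous_matrix fun i j => ?_
  simp only [rhoC, of_apply]
  fun_prop

/-- The sum of the absolute values of the entries. -/
def entrySum {n : ℕ} (M : Matrix (Fin n) (Fin n) ℂ) : ℝ := ∑ i, ∑ j, ‖M i j‖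

theorem norm_conj_apply_le {n : ℕ} {k : Matrix (Fin n) (Fin n) ℂ}
    (hk : k ∈ unitaryGroup (Fin n) ℂ) (M : Matrix (Fin n) (Fin n) ℂ) (i : Fin n) :
    ‖(kᴴ * M * k) i i‖ ≤ entrySum M := by
  have hk1 : ∀ i j, ‖k i j‖ ≤ 1 := entry_norm_bound_of_unitary hk
  rw [Matrix.mul_assoc, mul_apply]
  refine (norm_sum_le _ _).trans (Finset.sum_le_sum fun r _ => ?_)
  rw [norm_mul, mul_apply, conjTranspose_apply, norm_star]
  calc ‖k r i‖ * ‖∑ s, M r s * k s i‖ ≤ 1 * ‖∑ s, M r s * k s i‖ :=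
        mul_le_mul_of_nonneg_right (hk1 r i) (norm_nonneg _)
    _ = ‖∑ s, M r s * k s i‖ := one_mul _
    _ ≤ ∑ s, ‖M r s‖ := by
      refine (norm_sum_le _ _).trans (Finset.sum_le_sum fun s _ => ?_)
      rw [norm_mul]
      exact mul_le_of_le_one_right (norm_nonneg _) (hk1 s i)

/-- A quantitative version of `exists_unitary_triangular` for matrices near a diagonal one. -/
theorem exists_unitary_triangular_near {n : ℕ} {lam : Fin n → ℝ} (hlam : Antitone lam)
    {v : Matrix (Fin n) (Fin n) ℂ} (hv : IsLowerUni v) (x : Fin n → ℝ)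
    (ρ : Matrix (Fin n) (Fin n) ℂ) :
    ∃ k ∈ unitaryGroup (Fin n) ℂ, (∀ i j, (kᴴ * v) i j ≠ 0 → x j ≤ x i) ∧
      ∑ i, x i * ((kᴴ * ρ * k) i i).re ≤ ∑ i, x i * lam i +
        (∑ i, |x i|) * entrySum (ρ - diagonal (fun i => (lam i : ℂ))) := by
  obtain ⟨k, hk, h1, h2⟩ := exists_unitary_triangular hlam hv x
  refine ⟨k, hk, h1, ?_⟩
  set M := ρ - diagonal (fun i => (lam i : ℂ)) with hM
  have hρ : ρ = diagonal (fun i => (lam i : ℂ)) + M := by rw [hM]; abel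
  have h3 : ∀ i, ((kᴴ * ρ * k) i i).re =
      ((kᴴ * diagonal (fun i => (lam i : ℂ)) * k) i i).re + ((kᴴ * M * k) i i).re := by
    intro i
    rw [hρ, Matrix.mul_add, Matrix.add_mul, Matrix.add_apply, Complex.add_re]
  simp only [h3, mul_add, Finset.sum_add_distrib]
  refine add_le_add h2 ?_
  rw [Finset.sum_mul]
  refine Finset.sum_le_sum fun i _ => (le_abs_self _).trans ?_
  rw [abs_mul]
  exact mul_le_mul_of_nonneg_left
    ((Complex.abs_re_le_norm _).trans (norm_conj_apply_le hk M i)) (abs_nonneg _)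

theorem mem_kronCone.dualGood {lam : (Fin a → ℝ) × (Fin b → ℝ) × (Fin c → ℝ)}
    (h : lam ∈ KronCone a b c) : DualGood lam := by
  rw [mem_kronCone_iff] at h
  obtain ⟨⟨h1, h2, h3⟩, ψ, hA, hB, hC⟩ := h
  intro S hS x y w hx
  obtain ⟨u, v, r, ξ, hn, hlim⟩ := hS ψ
  set φ : ℕ → Fin a × Fin b × Fin c → ℂ := fun n => tens (u n) (v n) (r n) *ᵥ ξ n with hφ
  have key : ∀ n, 0 ≤ ∑ i, x i * lam.1 i + ∑ j, y j * lam.2.1 j + ∑ k, w k * lam.2.2 k +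
      ((∑ i, |x i|) * entrySum (rhoA (φ n) - diagonal (fun i => (lam.1 i : ℂ))) +
       (∑ i, |y i|) * entrySum (rhoB (φ n) - diagonal (fun i => (lam.2.1 i : ℂ))) +
       (∑ i, |w i|) * entrySum (rhoC (φ n) - diagonal (fun i => (lam.2.2 i : ℂ)))) := by
    intro n
    obtain ⟨hu, hv, hr, hξ⟩ := hn n
    obtain ⟨kA, hkA, sA, eA⟩ := exists_unitary_triangular_near h1 hu x (rhoA (φ n))
    obtain ⟨kB, hkB, sB, eB⟩ := exists_unitary_triangular_near h2 hv y (rhoB (φ n))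
    obtain ⟨kC, hkC, sC, eC⟩ := exists_unitary_triangular_near h3 hr w (rhoC (φ n))
    have hkA' := conjTranspose_mem_unitaryGroup hkA
    have hkB' := conjTranspose_mem_unitaryGroup hkB
    have hkC' := conjTranspose_mem_unitaryGroup hkC
    have hsum := sum_weight_mul x y w (tens kAᴴ kBᴴ kCᴴ *ᵥ φ n)
    rw [rhoA_tens _ hkB' hkC', rhoB_tens _ hkA' hkC', rhoC_tens _ hkA' hkB'] at hsum
    simp only [conjTranspose_conjTranspose] at hsum
    have hpos : 0 ≤ ∑ p : Fin a × Fin b × Fin c, (x p.1 + y p.2.1 + w p.2.2) *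
        ‖(tens kAᴴ kBᴴ kCᴴ *ᵥ φ n) p‖ ^ 2 := by
      refine Finset.sum_nonneg fun p _ => ?_
      by_cases hp : (tens kAᴴ kBᴴ kCᴴ *ᵥ φ n) p = 0
      · simp [hp]
      · refine mul_nonneg ?_ (by positivity)
        rw [hφ, tens_mulVec_mulVec, tens_mulVec_apply] at hp
        obtain ⟨q, -, hq⟩ := Finset.exists_ne_zero_of_sum_ne_zero hp
        have hqS : q ∈ S := by
          by_contra hqS
          exact hq (by rw [hξ q hqS, mul_zero])
        have hq' := left_ne_zero_of_mul hq
        have q1 := sA _ _ (left_ne_zero_of_mul hq')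
        have q2 := sB _ _ (left_ne_zero_of_mul (right_ne_zero_of_mul hq'))
        have q3 := sC _ _ (right_ne_zero_of_mul (right_ne_zero_of_mul hq'))
        have := hx q hqS
        linarith
    linarith
  have hlim2 : Tendsto (fun n => ∑ i, x i * lam.1 i + ∑ j, y j * lam.2.1 j +
      ∑ k, w k * lam.2.2 k +
      ((∑ i, |x i|) * entrySum (rhoA (φ n) - diagonal (fun i => (lam.1 i : ℂ))) +
       (∑ i, |y i|) * entrySum (rhoB (φ n) - diagonal (fun i => (lam.2.1 i : ℂ))) +
       (∑ i, |w i|) * entrySum (rhoC (φ n) - diagonal (fun i => (lam.2.2 i : ℂ))))) atTop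
      (𝓝 (∑ i, x i * lam.1 i + ∑ j, y j * lam.2.1 j + ∑ k, w k * lam.2.2 k +
      ((∑ i, |x i|) * entrySum (rhoA ψ - diagonal (fun i => (lam.1 i : ℂ))) +
       (∑ i, |y i|) * entrySum (rhoB ψ - diagonal (fun i => (lam.2.1 i : ℂ))) +
       (∑ i, |w i|) * entrySum (rhoC ψ - diagonal (fun i => (lam.2.2 i : ℂ)))))) := by
    have hcont : ∀ n : ℕ, Continuous (entrySum : Matrix (Fin n) (Fin n) ℂ → ℝ) := by
      intro n
      unfold entrySum
      fun_prop
    have hc : Continuous fun φ : Fin a × Fin b × Fin c → ℂ => ∑ i, x i * lam.1 i +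
      ∑ j, y j * lam.2.1 j + ∑ k, w k * lam.2.2 k +
      ((∑ i, |x i|) * entrySum (rhoA φ - diagonal (fun i => (lam.1 i : ℂ))) +
       (∑ i, |y i|) * entrySum (rhoB φ - diagonal (fun i => (lam.2.1 i : ℂ))) +
       (∑ i, |w i|) * entrySum (rhoC φ - diagonal (fun i => (lam.2.2 i : ℂ)))) := by
      have cA := (hcont a).comp
        ((continuous_rhoA (b := b) (c := c)).sub
          (continuous_const (y := diagonal (fun i => (lam.1 i : ℂ)))))
      have cB := (hcont b).comp
        ((continuous_rhoB (a := a) (c := c)).sub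
          (continuous_const (y := diagonal (fun i => (lam.2.1 i : ℂ)))))
      have cC := (hcont c).comp
        ((continuous_rhoC (a := a) (b := b)).sub
          (continuous_const (y := diagonal (fun i => (lam.2.2 i : ℂ)))))
      exact continuous_const.add (((cA.const_mul _).add (cB.const_mul _)).add (cC.const_mul _))
    exact (hc.tendsto ψ).comp hlim
  have := ge_of_tendsto' hlim2 key
  simpa [hA, hB, hC, entrySum] using this

theorem isLowerUni_one {n : ℕ} : IsLowerUni (1 : Matrix (Fin n) (Fin n) ℂ) :=
  ⟨fun i => by simp, fun i j hij => by simp [hij.ne]⟩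

theorem denseOrbit_univ : DenseOrbit (Finset.univ : Finset (Fin a × Fin b × Fin c)) := by
  intro z
  refine ⟨fun _ => 1, fun _ => 1, fun _ => 1, fun _ => z, fun n =>
    ⟨isLowerUni_one, isLowerUni_one, isLowerUni_one, by simp⟩, ?_⟩
  simp

/-- There is a tensor for which every support reachable by lower unitriangular triples has a
dense orbit. -/
theorem exists_generic : ∃ ψ : Fin a × Fin b × Fin c → ℂ,
    ∀ u v w ξ, IsLowerUni u → IsLowerUni v → IsLowerUni w → tens u v w *ᵥ ξ = ψ →
      ∀ S : Finset (Fin a × Fin b × Fin c), (∀ p ∉ S, ξ p = 0) → DenseOrbit S := by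
  classical
  have h : ∀ S : Finset (Fin a × Fin b × Fin c), ∃ f : MvPolynomial (Fin a × Fin b × Fin c) ℂ,
      f ≠ 0 ∧ (DenseOrbit S ∨ ∀ u v w ξ, IsLowerUni u →
      IsLowerUni v → IsLowerUni w → (∀ p ∉ S, ξ p = 0) →
      MvPolynomial.eval (tens u v w *ᵥ ξ) f = 0) := by
    intro S
    rcases exists_vanishing_or_denseOrbit S with ⟨f, hf, h⟩ | h
    · exact ⟨f, hf, Or.inr h⟩
    · exact ⟨1, one_ne_zero, Or.inl h⟩
  choose f hf0 hf using h
  have hprod : ∏ S, f S ≠ 0 := Finset.prod_ne_zero_iff.2 fun S _ => hf0 S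
  obtain ⟨ψ, hψ⟩ : ∃ x, MvPolynomial.eval x (∏ S, f S) ≠ 0 := by
    by_contra! h
    exact hprod (MvPolynomial.funext fun x => by simpa using h x)
  rw [map_prod, Finset.prod_ne_zero_iff] at hψ
  refine ⟨ψ, fun u v w ξ hu hv hw he S hS => ?_⟩
  rcases hf S with h | h
  · exact h
  · exact absurd (he ▸ h u v w ξ hu hv hw hS) (hψ S (Finset.mem_univ S))

end
end

section

open Matrix Filter Topology
open scoped ComplexOrder

/-- Invertible lower triangular matrices. -/
def IsLowerInv {n : ℕ} (P : Matrix (Fin n) (Fin n) ℂ) : Prop :=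
  (∀ i, P i i ≠ 0) ∧ ∀ i j, i < j → P i j = 0

/-- The modulus of the character of weight `lam` of the group of lower triangular matrices. -/
def chi {n : ℕ} (lam : Fin n → ℝ) (P : Matrix (Fin n) (Fin n) ℂ) : ℝ :=
  ∏ i, ‖P i i‖ ^ lam i

theorem IsLowerInv.det {n : ℕ} {P : Matrix (Fin n) (Fin n) ℂ} (hP : IsLowerInv P) :
    P.det = ∏ i, P i i :=
  det_of_isLowerTriangular (M := P) fun i j hij => hP.2 i j hij

theorem IsLowerInv.isUnit_det {n : ℕ} {P : Matrix (Fin n) (Fin n) ℂ} (hP : IsLowerInv P) :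
    IsUnit P.det := by
  rw [hP.det, isUnit_iff_ne_zero]
  exact Finset.prod_ne_zero_iff.2 fun i _ => hP.1 i

theorem IsLowerUni.isLowerInv {n : ℕ} {P : Matrix (Fin n) (Fin n) ℂ} (hP : IsLowerUni P) :
    IsLowerInv P :=
  ⟨fun i => by simp [hP.1], hP.2⟩

theorem chi_pos {n : ℕ} (lam : Fin n → ℝ) {P : Matrix (Fin n) (Fin n) ℂ} (hP : IsLowerInv P) :
    0 < chi lam P :=
  Finset.prod_pos fun i _ => Real.rpow_pos_of_pos (norm_pos_iff.2 (hP.1 i)) _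

theorem chi_eq_exp {n : ℕ} (lam : Fin n → ℝ) {P : Matrix (Fin n) (Fin n) ℂ}
    (hP : IsLowerInv P) : chi lam P = Real.exp (∑ i, lam i * Real.log ‖P i i‖) := by
  rw [chi, Real.exp_sum]
  refine Finset.prod_congr rfl fun i _ => ?_
  rw [Real.rpow_def_of_pos (norm_pos_iff.2 (hP.1 i)), mul_comm]

theorem norm_det_of_mem_unitaryGroup {n : ℕ} {k : Matrix (Fin n) (Fin n) ℂ}
    (hk : k ∈ unitaryGroup (Fin n) ℂ) : ‖k.det‖ = 1 := by
  have h := det_of_mem_unitary hk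
  exact CStarRing.norm_of_mem_unitary h

/-- Singular value decomposition with increasing logarithmic singular values. -/
theorem exists_svd {n : ℕ} {P : Matrix (Fin n) (Fin n) ℂ} (hP : IsUnit P.det) :
    ∃ κ ∈ unitaryGroup (Fin n) ℂ, ∃ q ∈ unitaryGroup (Fin n) ℂ, ∃ d : Fin n → ℝ, Monotone d ∧
      P = κ * diagonal (fun i => ((Real.exp (d i) : ℝ) : ℂ)) * qᴴ := by
  have hpd : (Pᴴ * P).PosDef := by
    apply PosDef.conjTranspose_mul_self
    exact mulVec_injective_iff_isUnit.2 ((isUnit_iff_isUnit_det _).2 hP)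
  have hH := hpd.1
  obtain ⟨σ, hσ⟩ := exists_perm_monotone hH.eigenvalues
  obtain ⟨q, hq, hqe⟩ := exists_unitary_of_isHermitian hH σ
  set μ := hH.eigenvalues ∘ σ with hμ
  have hμ0 : ∀ i, 0 < μ i := fun i => hpd.eigenvalues_pos _
  set d : Fin n → ℝ := fun i => Real.log (μ i) / 2 with hd
  have hexp : ∀ i, Real.exp (-d i) * μ i * Real.exp (-d i) = 1 := by
    intro i
    have : μ i = Real.exp (d i) * Real.exp (d i) := by
      rw [← Real.exp_add, hd]
      simp only [add_halves]
      rw [Real.exp_log (hμ0 i)]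
    rw [this, Real.exp_neg]
    have := Real.exp_ne_zero (d i)
    field_simp
  have hqq : q * qᴴ = 1 := mem_unitaryGroup_iff.1 hq
  have hqq' : qᴴ * q = 1 := mem_unitaryGroup_iff'.1 hq
  set E : Matrix (Fin n) (Fin n) ℂ := diagonal (fun i => ((Real.exp (-d i) : ℝ) : ℂ)) with hE
  have hEH : Eᴴ = E := by
    rw [hE, diagonal_conjTranspose]
    congr 1
    funext i
    exact Complex.conj_ofReal _
  refine ⟨P * q * E, ?_, q, hq, d, ?_, ?_⟩
  · rw [mem_unitaryGroup_iff']
    change (P * q * E)ᴴ * (P * q * E) = 1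
    rw [conjTranspose_mul, conjTranspose_mul, hEH]
    calc _ = E * (qᴴ * (Pᴴ * P) * q) * E := by simp only [Matrix.mul_assoc]
      _ = E * ((qᴴ * q) * diagonal (fun i => ((μ i : ℝ) : ℂ)) * (qᴴ * q)) * E := by
        rw [hqe]; simp only [Matrix.mul_assoc]
      _ = 1 := by
        rw [hqq', Matrix.one_mul, Matrix.mul_one, hE, diagonal_mul_diagonal,
          diagonal_mul_diagonal, ← diagonal_one]
        congr 1
        funext i
        exact_mod_cast hexp i
  · intro i j hij
    have := Real.log_le_log (hμ0 i) (hσ hij)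
    simp only [hd]
    linarith
  · have : E * diagonal (fun i => ((Real.exp (d i) : ℝ) : ℂ)) = 1 := by
      rw [hE, diagonal_mul_diagonal, ← diagonal_one]
      congr 1
      funext i
      rw [← Complex.ofReal_mul, ← Real.exp_add]
      simp
    rw [Matrix.mul_assoc _ E, this, Matrix.mul_one, Matrix.mul_assoc, hqq, Matrix.mul_one]

/-- Bruhat normal form: an invertible matrix can be multiplied on the right by a lower
unitriangular matrix so that the last nonzero entries of the columns lie in distinct rows. -/
theorem exists_bruhat {n : ℕ} {g : Matrix (Fin n) (Fin n) ℂ} (hg : IsUnit g.det) :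
    ∃ (σ : Equiv.Perm (Fin n)) (v : Matrix (Fin n) (Fin n) ℂ), IsLowerUni v ∧
      (∀ m i, (g * v) m i ≠ 0 → m ≤ σ i) ∧ ∀ i, (g * v) (σ i) i ≠ 0 := by
  classical
  have hinj : Function.Injective g.mulVec :=
    mulVec_injective_iff_isUnit.2 ((isUnit_iff_isUnit_det _).2 hg)
  let Q : Fin n → ℕ → Prop := fun i k => ∃ x : Fin n → ℂ, x i = 1 ∧ (∀ j < i, x j = 0) ∧
    ∀ m : Fin n, k < m.1 → (g *ᵥ x) m = 0
  have hQ : ∀ i, ∃ k, Q i k := fun i => ⟨n, Pi.single i 1, by simp,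
    fun j hj => by simp [hj.ne], fun m hm => absurd m.2 (by omega)⟩
  let t : Fin n → ℕ := fun i => Nat.find (hQ i)
  choose x hx1 hx0 hxt using fun i => Nat.find_spec (hQ i)
  have hmin : ∀ i k, Q i k → t i ≤ k := fun i k hk => Nat.find_min' (hQ i) hk
  have htop : ∀ i, ∃ m : Fin n, m.1 = t i ∧ (g *ᵥ x i) m ≠ 0 := by
    intro i
    by_contra! h
    have hxne : g *ᵥ x i ≠ 0 := by
      intro h0
      have : x i = 0 := hinj (by rw [h0, mulVec_zero])
      have h1 := hx1 i
      rw [this] at h1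
      simp at h1
    apply hxne
    funext m
    by_cases ht : t i = 0
    · rcases Nat.eq_zero_or_pos m.1 with h0 | h0
      · exact h m (by rw [h0, ht])
      · exact hxt i m (by change t i < _; omega)
    · exfalso
      have : Q i (t i - 1) := by
        refine ⟨x i, hx1 i, hx0 i, fun m hm => ?_⟩
        rcases eq_or_ne m.1 (t i) with h1 | h1
        · exact h m h1
        · exact hxt i m (by change t i < _; omega)
      have := hmin i _ this
      omega
  choose τ hτ hτ0 using htop
  have hτinj' : ∀ i j, i < j → τ i ≠ τ j := by
    intro i j hij he
    set r := (g *ᵥ x i) (τ i) / (g *ᵥ x j) (τ i) with hr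
    have hne : (g *ᵥ x j) (τ i) ≠ 0 := by rw [he]; exact hτ0 j
    have hz : ∀ m : Fin n, t i ≤ m.1 → (g *ᵥ (x i - r • x j)) m = 0 := by
      intro m hm
      rw [mulVec_sub, mulVec_smul, Pi.sub_apply, Pi.smul_apply, smul_eq_mul]
      rcases eq_or_lt_of_le hm with h1 | h1
      · have : m = τ i := Fin.ext (by rw [hτ i, h1])
        rw [this, hr, div_mul_cancel₀ _ hne, sub_self]
      · have htj : t j = t i := by rw [← hτ i, ← hτ j, he]
        rw [hxt i m h1, hxt j m (by change t j < _; omega), mul_zero, sub_zero]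
    have hc1 : (x i - r • x j) i = 1 := by simp [hx1 i, hx0 j i hij]
    have hc0 : ∀ l < i, (x i - r • x j) l = 0 := fun l hl => by
      simp [hx0 i l hl, hx0 j l (hl.trans hij)]
    by_cases ht : t i = 0
    · have : g *ᵥ (x i - r • x j) = 0 := funext fun m => hz m (by omega)
      have h0 : x i - r • x j = 0 := hinj (by rw [this, mulVec_zero])
      rw [h0] at hc1
      simp at hc1
    · have := hmin i (t i - 1) ⟨_, hc1, hc0, fun m hm => hz m (by omega)⟩
      omega
  have hτinj : Function.Injective τ := by
    intro i j he
    rcases lt_trichotomy i j with h | h | h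
    · exact absurd he (hτinj' i j h)
    · exact h
    · exact absurd he.symm (hτinj' j i h)
  have hgv : ∀ m i, (g * of fun r i => x i r) m i = (g *ᵥ x i) m := fun m i => rfl
  refine ⟨Equiv.ofBijective τ (Finite.injective_iff_bijective.1 hτinj), of fun r i => x i r,
    ⟨fun i => hx1 i, fun i j hij => hx0 j i hij⟩, fun m i h => ?_, fun i => ?_⟩
  · rw [hgv] at h
    rw [Equiv.ofBijective_apply, Fin.le_def, hτ i]
    by_contra! hlt
    exact h (hxt i m hlt)
  · rw [hgv, Equiv.ofBijective_apply]
    exact hτ0 i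

end

section

open Matrix Filter Topology

/-- The submatrix with columns `t ≥ r` and rows `σ t` for `t ≥ r`. -/
def permMinor {n : ℕ} (σ : Equiv.Perm (Fin n)) (r : ℕ) (A : Matrix (Fin n) (Fin n) ℂ) :
    Matrix {i : Fin n // r ≤ i.1} {i : Fin n // r ≤ i.1} ℂ :=
  A.submatrix (fun t => σ t.1) Subtype.val

theorem det_permMinor_mul {n : ℕ} (σ : Equiv.Perm (Fin n)) (r : ℕ)
    (A : Matrix (Fin n) (Fin n) ℂ) {P : Matrix (Fin n) (Fin n) ℂ}
    (hP : ∀ i j, i < j → P i j = 0) :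
    (permMinor σ r (A * P)).det =
      (permMinor σ r A).det * ∏ t : {i : Fin n // r ≤ i.1}, P t.1 t.1 := by
  have h1 : permMinor σ r (A * P) = permMinor σ r A *
      P.submatrix (Subtype.val : {i : Fin n // r ≤ i.1} → Fin n) Subtype.val := by
    ext s t
    simp only [permMinor, submatrix_apply, mul_apply]
    have hsub : ∑ l with r ≤ l.1, A (σ s.1) l * P l t.1 =
        ∑ l : {i : Fin n // r ≤ i.1}, A (σ s.1) l.1 * P l.1 t.1 :=
      Finset.sum_subtype _ (by simp) fun l : Fin n => A (σ s.1) l * P l t.1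
    refine Eq.trans (Eq.symm ?_) hsub
    refine Finset.sum_subset (Finset.subset_univ _) fun l _ hl => ?_
    rw [hP l t.1 (Fin.lt_def.2 (by simp at hl; have := t.2; omega)), mul_zero]
  rw [h1, det_mul]
  congr 1
  exact det_of_isLowerTriangular (M := P.submatrix Subtype.val Subtype.val)
    fun i j hij => hP _ _ hij

theorem det_permMinor_ne_zero {n : ℕ} {σ : Equiv.Perm (Fin n)} (r : ℕ)
    {B : Matrix (Fin n) (Fin n) ℂ} (h1 : ∀ m i, B m i ≠ 0 → m ≤ σ i)
    (h2 : ∀ i, B (σ i) i ≠ 0) : (permMinor σ r B).det ≠ 0 := by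
  classical
  intro h0
  obtain ⟨x, hx, hBx⟩ := exists_mulVec_eq_zero_iff.2 h0
  have hne : (Finset.univ.filter fun t => x t ≠ 0).Nonempty := by
    obtain ⟨t, ht⟩ := Function.ne_iff.1 hx
    exact ⟨t, by simpa using ht⟩
  obtain ⟨t, ht, hmax⟩ := Finset.exists_max_image _ (fun t => σ t.1) hne
  have h := congrFun hBx t
  rw [mulVec, dotProduct, Finset.sum_eq_single t] at h
  · exact (mul_ne_zero (h2 t) (Finset.mem_filter.1 ht).2) h
  · intro s _ hst
    by_contra hne
    obtain ⟨h3, h4⟩ := mul_ne_zero_iff.1 hne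
    have h5 := h1 _ _ h3
    have h6 := hmax s (by simpa using h4)
    exact hst (Subtype.ext (σ.injective (le_antisymm h6 h5)))
  · simp

theorem norm_det_permMinor_le {n : ℕ} (σ : Equiv.Perm (Fin n)) (r : ℕ)
    {κ : Matrix (Fin n) (Fin n) ℂ} (hκ : κ ∈ unitaryGroup (Fin n) ℂ) :
    ‖(permMinor σ r κ).det‖ ≤ n.factorial := by
  have h := det_le (A := permMinor σ r κ) (abv := NormedField.toAbsoluteValue ℂ) (x := 1)
    fun i j => entry_norm_bound_of_unitary hκ _ _
  refine h.trans ?_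
  rw [one_pow, nsmul_eq_mul, mul_one]
  exact_mod_cast Nat.factorial_le ((Fintype.card_subtype_le _).trans (by simp))

theorem exists_chi_le {n : ℕ} {lam : Fin n → ℝ} (hlam : Antitone lam)
    (q₀ : Matrix (Fin n) (Fin n) ℂ) (σ : Equiv.Perm (Fin n)) {v : Matrix (Fin n) (Fin n) ℂ}
    (hv : IsLowerUni v) (h1 : ∀ m i, (q₀ᴴ * v) m i ≠ 0 → m ≤ σ i)
    (h2 : ∀ i, (q₀ᴴ * v) (σ i) i ≠ 0) :
    ∃ C > 0, ∀ᶠ q in 𝓝 q₀, ∀ κ ∈ unitaryGroup (Fin n) ℂ, q ∈ unitaryGroup (Fin n) ℂ →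
      ∀ (P : Matrix (Fin n) (Fin n) ℂ) (d : Fin n → ℝ), IsLowerInv P →
      P = κ * diagonal (fun i => ((Real.exp (d i) : ℝ) : ℂ)) * qᴴ →
      chi lam P ≤ C * Real.exp (∑ i, lam i * d (σ i)) := by
  have hminor : ∀ r, ‖(permMinor σ r q₀ᴴ).det‖ ≠ 0 := by
    intro r h0
    have := det_permMinor_ne_zero r h1 h2
    rw [det_permMinor_mul σ r _ hv.2, norm_eq_zero.1 h0, zero_mul] at this
    exact this rfl
  obtain ⟨δ, hδ0, hδ⟩ : ∃ δ > 0, ∀ᶠ q in 𝓝 q₀, ∀ r ≤ n, δ < ‖(permMinor σ r qᴴ).det‖ := by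
    have hcont : ∀ r, Continuous fun q : Matrix (Fin n) (Fin n) ℂ =>
        ‖(permMinor σ r qᴴ).det‖ := fun r =>
      (Continuous.matrix_det ((continuous_id.matrix_conjTranspose).matrix_submatrix _ _)).norm
    obtain ⟨r₀, _, hr₀⟩ := Finset.exists_min_image (Finset.range (n + 1))
      (fun r => ‖(permMinor σ r q₀ᴴ).det‖) ⟨0, by simp⟩
    have hpos : 0 < ‖(permMinor σ r₀ q₀ᴴ).det‖ := lt_of_le_of_ne (norm_nonneg _) (hminor r₀).symm
    refine ⟨‖(permMinor σ r₀ q₀ᴴ).det‖ / 2, half_pos hpos, ?_⟩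
    have : ∀ᶠ q in 𝓝 q₀, ∀ r ∈ Finset.range (n + 1),
        ‖(permMinor σ r₀ q₀ᴴ).det‖ / 2 < ‖(permMinor σ r qᴴ).det‖ :=
      (Finset.eventually_all _).2 fun r hr =>
        (hcont r).continuousAt.eventually_const_lt
          (lt_of_lt_of_le (half_lt_self hpos) (hr₀ r hr))
    filter_upwards [this] with q hq r hr
    exact hq r (by simpa [Nat.lt_succ_iff] using hr)
  obtain ⟨D, hD0, hD⟩ : ∃ D : ℝ, 0 ≤ D ∧ ∀ i j, lam i - lam j ≤ D := by
    refine ⟨∑ p : Fin n × Fin n, |lam p.1 - lam p.2|,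
      Finset.sum_nonneg fun _ _ => abs_nonneg _, fun i j => (le_abs_self _).trans ?_⟩
    exact Finset.single_le_sum (f := fun p : Fin n × Fin n => |lam p.1 - lam p.2|)
      (fun _ _ => abs_nonneg _) (Finset.mem_univ (i, j))
  set K : ℝ := max 0 (Real.log (n.factorial / δ)) with hK
  refine ⟨Real.exp (K * D), Real.exp_pos _, ?_⟩
  filter_upwards [hδ] with q hq κ hκ hqu P d hP hPe
  have hκκ : κᴴ * κ = 1 := mem_unitaryGroup_iff'.1 hκ
  have hfac : κᴴ * P = diagonal (fun i => ((Real.exp (d i) : ℝ) : ℂ)) * qᴴ := by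
    rw [hPe, Matrix.mul_assoc, ← Matrix.mul_assoc, hκκ, Matrix.one_mul]
  have hPpos : ∀ i, 0 < ‖P i i‖ := fun i => norm_pos_iff.2 (hP.1 i)
  have htot : ∑ i, Real.log ‖P i i‖ = ∑ i, d i := by
    have h := congrArg (fun M => ‖M.det‖) hPe
    simp only [det_mul, norm_mul, norm_det_of_mem_unitaryGroup hκ,
      norm_det_of_mem_unitaryGroup (conjTranspose_mem_unitaryGroup hqu), one_mul, mul_one,
      hP.det, det_diagonal, norm_prod, Complex.norm_real, Real.norm_eq_abs, Real.abs_exp] at h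
    rw [← Real.log_prod fun i _ => (hPpos i).ne', h, Real.log_prod fun i _ => Real.exp_ne_zero _]
    simp
  have hkey : ∀ r ≤ n, ∑ i with r ≤ i.1, (d (σ i) - Real.log ‖P i i‖) ≤ K := by
    intro r hr
    have h3 := det_permMinor_mul σ r κᴴ hP.2
    have h4 : permMinor σ r (diagonal (fun i => ((Real.exp (d i) : ℝ) : ℂ)) * qᴴ) =
        of fun s t => ((Real.exp (d (σ s.1)) : ℝ) : ℂ) * permMinor σ r qᴴ s t := by
      ext s t
      simp [permMinor, diagonal_mul]
    rw [hfac, h4, det_mul_column] at h3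
    have h5 := congrArg norm h3
    simp only [norm_mul, norm_prod, Complex.norm_real, Real.norm_eq_abs, Real.abs_exp] at h5
    set X := ∏ t : {i : Fin n // r ≤ i.1}, Real.exp (d (σ t.1)) with hX
    set Y := ∏ t : {i : Fin n // r ≤ i.1}, ‖P t.1 t.1‖ with hY
    have hX0 : 0 < X := Finset.prod_pos fun _ _ => Real.exp_pos _
    have hY0 : 0 < Y := Finset.prod_pos fun _ _ => hPpos _
    have h6 : X * δ ≤ n.factorial * Y := by
      calc X * δ ≤ X * ‖(permMinor σ r qᴴ).det‖ :=
            mul_le_mul_of_nonneg_left (hq r hr).le hX0.le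
        _ = _ := h5
        _ ≤ _ := mul_le_mul_of_nonneg_right
            (norm_det_permMinor_le σ r (conjTranspose_mem_unitaryGroup hκ)) hY0.le
    have h7 : Real.log (X / Y) ≤ Real.log (n.factorial / δ) := by
      apply Real.log_le_log (div_pos hX0 hY0)
      rw [div_le_div_iff₀ hY0 hδ0]
      linarith
    refine le_trans (le_of_eq ?_) (h7.trans (le_max_right _ _))
    rw [Real.log_div hX0.ne' hY0.ne', hX, hY, Real.log_prod fun i _ => Real.exp_ne_zero _,
      Real.log_prod fun i _ => (hPpos i.1).ne', ← Finset.sum_sub_distrib]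
    simp only [Real.log_exp]
    exact Finset.sum_subtype _ (by simp) fun i : Fin n => d (σ i) - Real.log ‖P i i‖
  have hy0 : ∑ i, (Real.log ‖P i i‖ - d (σ i)) = 0 := by
    rw [Finset.sum_sub_distrib, htot, Equiv.sum_comp σ d, sub_self]
  have hA := sum_mul_le_of_prefix_sum_le hlam hy0 (le_max_left 0 _) hD0 hD (C := K) (by
    intro r
    have hs : ∑ i with i.1 < r, (Real.log ‖P i i‖ - d (σ i)) =
        ∑ i with r ≤ i.1, (d (σ i) - Real.log ‖P i i‖) := by
      rw [← Finset.sum_filter_add_sum_filter_not _ (fun i : Fin n => i.1 < r)] at hy0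
      simp only [not_lt] at hy0
      rw [eq_neg_of_add_eq_zero_left hy0, ← Finset.sum_neg_distrib]
      simp
    rw [hs]
    rcases le_or_gt r n with hr | hr
    · exact hkey r hr
    · refine le_trans (le_of_eq ?_) (le_max_left 0 _)
      exact Finset.sum_eq_zero fun i hi => absurd (Finset.mem_filter.1 hi).2 (by omega))
  rw [chi_eq_exp lam hP, ← Real.exp_add, Real.exp_le_exp]
  have : ∑ i, lam i * (Real.log ‖P i i‖ - d (σ i)) =
      ∑ i, lam i * Real.log ‖P i i‖ - ∑ i, lam i * d (σ i) := by
    rw [← Finset.sum_sub_distrib]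
    exact Finset.sum_congr rfl fun i _ => mul_sub _ _ _
  linarith
end

section

open Matrix Filter Topology

section
variable {a b c : ℕ}

theorem norm_sq_le_nsq {ι : Type*} [Fintype ι] (ψ : ι → ℂ) (p : ι) : ‖ψ p‖ ^ 2 ≤ nsq ψ :=
  Finset.single_le_sum (f := fun p => ‖ψ p‖ ^ 2) (fun _ _ => sq_nonneg _) (Finset.mem_univ p)

theorem trace_rhoA (ψ : Fin a × Fin b × Fin c → ℂ) : (rhoA ψ).trace.re = nsq ψ := by
  have := sum_mul_rhoA (fun _ => 1) ψ
  simp only [one_mul] at this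
  rw [trace, Complex.re_sum, nsq, ← this]
  rfl

theorem trace_rhoB (ψ : Fin a × Fin b × Fin c → ℂ) : (rhoB ψ).trace.re = nsq ψ := by
  rw [rhoB_eq, trace_rhoA, nsq_swapAB]

theorem trace_rhoC (ψ : Fin a × Fin b × Fin c → ℂ) : (rhoC ψ).trace.re = nsq ψ := by
  rw [rhoC_eq, trace_rhoA, nsq_rotC]

theorem nsq_tens_unitary {P : Matrix (Fin a) (Fin a) ℂ} {Q : Matrix (Fin b) (Fin b) ℂ}
    {R : Matrix (Fin c) (Fin c) ℂ} (hP : P ∈ unitaryGroup (Fin a) ℂ)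
    (hQ : Q ∈ unitaryGroup (Fin b) ℂ) (hR : R ∈ unitaryGroup (Fin c) ℂ)
    (ψ : Fin a × Fin b × Fin c → ℂ) : nsq (tens P Q R *ᵥ ψ) = nsq ψ := by
  have hP' : Pᴴ * P = 1 := mem_unitaryGroup_iff'.1 hP
  rw [← trace_rhoA, rhoA_tens P hQ hR, Matrix.mul_assoc, trace_mul_comm, Matrix.mul_assoc, hP',
    Matrix.mul_one, trace_rhoA]

/-- The lower bound of `nsq (P ⊗ Q ⊗ R) ψ` by characters, over all `P, Q, R` having the given
right singular vectors. -/
def SvdBound (ψ : Fin a × Fin b × Fin c → ℂ)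
    (lam : (Fin a → ℝ) × (Fin b → ℝ) × (Fin c → ℝ)) (m : ℝ)
    (U : Matrix (Fin a) (Fin a) ℂ × Matrix (Fin b) (Fin b) ℂ × Matrix (Fin c) (Fin c) ℂ) : Prop :=
  ∀ κA ∈ unitaryGroup (Fin a) ℂ, ∀ κB ∈ unitaryGroup (Fin b) ℂ, ∀ κC ∈ unitaryGroup (Fin c) ℂ,
    U.1 ∈ unitaryGroup (Fin a) ℂ → U.2.1 ∈ unitaryGroup (Fin b) ℂ →
    U.2.2 ∈ unitaryGroup (Fin c) ℂ →
    ∀ P Q R dA dB dC, Monotone dA → Monotone dB → Monotone dC →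
    IsLowerInv P → IsLowerInv Q → IsLowerInv R →
    P = κA * diagonal (fun i => ((Real.exp (dA i) : ℝ) : ℂ)) * U.1ᴴ →
    Q = κB * diagonal (fun i => ((Real.exp (dB i) : ℝ) : ℂ)) * U.2.1ᴴ →
    R = κC * diagonal (fun i => ((Real.exp (dC i) : ℝ) : ℂ)) * U.2.2ᴴ →
    (m * (chi lam.1 P * chi lam.2.1 Q * chi lam.2.2 R)) ^ 2 ≤ nsq (tens P Q R *ᵥ ψ)

theorem exists_leading_coordinate {gA : Matrix (Fin a) (Fin a) ℂ}
    {gB : Matrix (Fin b) (Fin b) ℂ} {gC : Matrix (Fin c) (Fin c) ℂ}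
    {σA : Equiv.Perm (Fin a)} {σB : Equiv.Perm (Fin b)} {σC : Equiv.Perm (Fin c)}
    (hA1 : ∀ m i, gA m i ≠ 0 → m ≤ σA i) (hA2 : ∀ i, gA (σA i) i ≠ 0)
    (hB1 : ∀ m i, gB m i ≠ 0 → m ≤ σB i) (hB2 : ∀ i, gB (σB i) i ≠ 0)
    (hC1 : ∀ m i, gC m i ≠ 0 → m ≤ σC i) (hC2 : ∀ i, gC (σC i) i ≠ 0)
    {ξ : Fin a × Fin b × Fin c → ℂ} (hξ : ∃ p, ξ p ≠ 0)
    {dA : Fin a → ℝ} {dB : Fin b → ℝ} {dC : Fin c → ℝ}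
    (hdA : Monotone dA) (hdB : Monotone dB) (hdC : Monotone dC) :
    ∃ p : Fin a × Fin b × Fin c, (tens gA gB gC *ᵥ ξ) (σA p.1, σB p.2.1, σC p.2.2) ≠ 0 ∧ ∀ q, ξ q ≠ 0 →
      dA (σA q.1) + dB (σB q.2.1) + dC (σC q.2.2) ≤
        dA (σA p.1) + dB (σB p.2.1) + dC (σC p.2.2) := by
  classical
  have hne : (Finset.univ.filter fun p => ξ p ≠ 0).Nonempty := by
    obtain ⟨p, hp⟩ := hξ
    exact ⟨p, by simpa using hp⟩
  obtain ⟨p, hp, hmax⟩ := Finset.exists_max_image _ (fun p : Fin a × Fin b × Fin c =>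
    toLex (dA (σA p.1) + dB (σB p.2.1) + dC (σC p.2.2),
      (σA p.1).1 + (σB p.2.1).1 + (σC p.2.2).1)) hne
  have hp0 : ξ p ≠ 0 := (Finset.mem_filter.1 hp).2
  have hmax' : ∀ q, ξ q ≠ 0 → (dA (σA q.1) + dB (σB q.2.1) + dC (σC q.2.2) <
        dA (σA p.1) + dB (σB p.2.1) + dC (σC p.2.2)) ∨
      (dA (σA q.1) + dB (σB q.2.1) + dC (σC q.2.2) =
        dA (σA p.1) + dB (σB p.2.1) + dC (σC p.2.2) ∧
        (σA q.1).1 + (σB q.2.1).1 + (σC q.2.2).1 ≤ (σA p.1).1 + (σB p.2.1).1 + (σC p.2.2).1) := by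
    intro q hq
    have := hmax q (by simpa using hq)
    rwa [Prod.Lex.toLex_le_toLex] at this
  refine ⟨p, ?_, fun q hq => ?_⟩
  · rw [tens_mulVec_apply, Finset.sum_eq_single p]
    · exact mul_ne_zero (mul_ne_zero (hA2 _) (mul_ne_zero (hB2 _) (hC2 _))) hp0
    · intro q _ hqp
      by_contra hne
      simp only [mul_eq_zero, not_or] at hne
      obtain ⟨⟨h1, h2, h3⟩, h4⟩ := hne
      have e1 := hA1 _ _ h1
      have e2 := hB1 _ _ h2
      have e3 := hC1 _ _ h3
      have f1 := hdA e1
      have f2 := hdB e2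
      have f3 := hdC e3
      rcases hmax' q h4 with h | ⟨_, h⟩
      · linarith
      · rw [Fin.le_def] at e1 e2 e3
        apply hqp
        refine Prod.ext (σA.injective (Fin.ext ?_))
          (Prod.ext (σB.injective (Fin.ext ?_)) (σC.injective (Fin.ext ?_))) <;> omega
    · simp
  · rcases hmax' q hq with h | ⟨h, _⟩
    · exact h.le
    · exact h.le

theorem continuous_tens_conjTranspose_apply (ψ : Fin a × Fin b × Fin c → ℂ)
    (p : Fin a × Fin b × Fin c) :
    Continuous fun U : Matrix (Fin a) (Fin a) ℂ × Matrix (Fin b) (Fin b) ℂ ×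
      Matrix (Fin c) (Fin c) ℂ => ‖(tens U.1ᴴ U.2.1ᴴ U.2.2ᴴ *ᵥ ψ) p‖ := by
  simp only [tens_mulVec_apply, conjTranspose_apply]
  fun_prop

theorem svdBound_local {ψ : Fin a × Fin b × Fin c → ℂ}
    (hψ : ∀ u v w ξ, IsLowerUni u → IsLowerUni v → IsLowerUni w → tens u v w *ᵥ ξ = ψ →
      ∀ S : Finset (Fin a × Fin b × Fin c), (∀ p ∉ S, ξ p = 0) → DenseOrbit S)
    {lam : (Fin a → ℝ) × (Fin b → ℝ) × (Fin c → ℝ)} (hlam : DualGood lam)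
    (h1 : Antitone lam.1) (h2 : Antitone lam.2.1) (h3 : Antitone lam.2.2)
    (hs : ∑ i, lam.1 i = 1)
    {U₀ : Matrix (Fin a) (Fin a) ℂ × Matrix (Fin b) (Fin b) ℂ × Matrix (Fin c) (Fin c) ℂ}
    (hA : U₀.1 ∈ unitaryGroup (Fin a) ℂ) (hB : U₀.2.1 ∈ unitaryGroup (Fin b) ℂ)
    (hC : U₀.2.2 ∈ unitaryGroup (Fin c) ℂ) :
    ∃ m > 0, ∀ᶠ U in 𝓝 U₀, SvdBound ψ lam m U := by
  classical
  have hdet : ∀ {n : ℕ} {k : Matrix (Fin n) (Fin n) ℂ}, k ∈ unitaryGroup (Fin n) ℂ →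
      IsUnit kᴴ.det := fun {n k} hk => by
    rw [isUnit_iff_ne_zero, ← norm_ne_zero_iff,
      norm_det_of_mem_unitaryGroup (conjTranspose_mem_unitaryGroup hk)]
    exact one_ne_zero
  obtain ⟨σA, vA, hvA, hA1, hA2⟩ := exists_bruhat (hdet hA)
  obtain ⟨σB, vB, hvB, hB1, hB2⟩ := exists_bruhat (hdet hB)
  obtain ⟨σC, vC, hvC, hC1, hC2⟩ := exists_bruhat (hdet hC)
  obtain ⟨CA, hCA, evA⟩ := exists_chi_le h1 U₀.1 σA hvA hA1 hA2
  obtain ⟨CB, hCB, evB⟩ := exists_chi_le h2 U₀.2.1 σB hvB hB1 hB2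
  obtain ⟨CC, hCC, evC⟩ := exists_chi_le h3 U₀.2.2 σC hvC hC1 hC2
  set ξ := tens vA⁻¹ vB⁻¹ vC⁻¹ *ᵥ ψ with hξ
  have hξψ : tens vA vB vC *ᵥ ξ = ψ := by
    rw [hξ, tens_mulVec_mulVec, mul_nonsing_inv _ hvA.isLowerInv.isUnit_det,
      mul_nonsing_inv _ hvB.isLowerInv.isUnit_det, mul_nonsing_inv _ hvC.isLowerInv.isUnit_det,
      tens_one, one_mulVec]
  set S := Finset.univ.filter fun p => ξ p ≠ 0 with hS
  have hdense : DenseOrbit S := hψ vA vB vC ξ hvA hvB hvC hξψ S fun p hp => by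
    simpa [hS] using hp
  have hξne : ∃ p, ξ p ≠ 0 := by
    by_contra! h
    have := hlam S hdense (fun _ => -1) 0 0 fun p hp => absurd (h p) (by simpa [hS] using hp)
    simp [hs] at this
    linarith
  set φ := tens U₀.1ᴴ U₀.2.1ᴴ U₀.2.2ᴴ *ᵥ ψ with hφ
  have hφξ : φ = tens (U₀.1ᴴ * vA) (U₀.2.1ᴴ * vB) (U₀.2.2ᴴ * vC) *ᵥ ξ := by
    rw [← tens_mulVec_mulVec, hξψ]
  obtain ⟨δ, hδ0, hδ⟩ : ∃ δ > 0, ∀ p, φ p ≠ 0 → δ < ‖φ p‖ := by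
    rcases (Finset.univ.filter fun p => φ p ≠ 0).eq_empty_or_nonempty with he | hne
    · refine ⟨1, one_pos, fun p hp => ?_⟩
      have : p ∈ Finset.univ.filter fun p => φ p ≠ 0 := by simpa using hp
      rw [he] at this
      simp at this
    · obtain ⟨p, hp, hmin⟩ := Finset.exists_min_image _ (fun p => ‖φ p‖) hne
      have : 0 < ‖φ p‖ := norm_pos_iff.2 (Finset.mem_filter.1 hp).2
      exact ⟨‖φ p‖ / 2, half_pos this, fun q hq =>
        lt_of_lt_of_le (half_lt_self this) (hmin q (by simpa using hq))⟩
  have evφ : ∀ᶠ U in 𝓝 U₀, ∀ p, φ p ≠ 0 → δ < ‖(tens U.1ᴴ U.2.1ᴴ U.2.2ᴴ *ᵥ ψ) p‖ := by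
    rw [Filter.eventually_all]
    intro p
    by_cases hp : φ p = 0
    · exact Eventually.of_forall fun U h => absurd hp h
    · filter_upwards [(continuous_tens_conjTranspose_apply ψ p).continuousAt.eventually_const_lt
        (hδ p hp)] with U hU _ using hU
  refine ⟨δ / (CA * CB * CC), by positivity, ?_⟩
  have tA : Tendsto (fun U : Matrix (Fin a) (Fin a) ℂ × Matrix (Fin b) (Fin b) ℂ ×
      Matrix (Fin c) (Fin c) ℂ => U.1) (𝓝 U₀) (𝓝 U₀.1) := continuous_fst.continuousAt
  have tB : Tendsto (fun U : Matrix (Fin a) (Fin a) ℂ × Matrix (Fin b) (Fin b) ℂ ×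
      Matrix (Fin c) (Fin c) ℂ => U.2.1) (𝓝 U₀) (𝓝 U₀.2.1) :=
    (continuous_fst.comp continuous_snd).continuousAt
  have tC : Tendsto (fun U : Matrix (Fin a) (Fin a) ℂ × Matrix (Fin b) (Fin b) ℂ ×
      Matrix (Fin c) (Fin c) ℂ => U.2.2) (𝓝 U₀) (𝓝 U₀.2.2) :=
    (continuous_snd.comp continuous_snd).continuousAt
  filter_upwards [evφ, tA.eventually evA, tB.eventually evB, tC.eventually evC]
    with U hUφ hUA hUB hUC
  intro κA hκA κB hκB κC hκC hU1 hU2 hU3 P Q R dA dB dC hdA hdB hdC hP hQ hR hPe hQe hRe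
  obtain ⟨p, hp, hmax⟩ := exists_leading_coordinate hA1 hA2 hB1 hB2 hC1 hC2 hξne hdA hdB hdC
  rw [← hφξ] at hp
  set M := dA (σA p.1) + dB (σB p.2.1) + dC (σC p.2.2) with hM
  have hdual : ∑ i, lam.1 i * dA (σA i) + ∑ j, lam.2.1 j * dB (σB j) +
      ∑ k, lam.2.2 k * dC (σC k) ≤ M := by
    have h := hlam S hdense (fun i => M - dA (σA i)) (fun j => - dB (σB j))
      (fun k => - dC (σC k)) fun q hq => by
        have := hmax q (by simpa [hS] using hq)
        linarith
    simp only [sub_mul, Finset.sum_sub_distrib, ← Finset.mul_sum, hs, neg_mul,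
      Finset.sum_neg_distrib, mul_one] at h
    simp only [mul_comm (lam.1 _), mul_comm (lam.2.1 _), mul_comm (lam.2.2 _)]
    linarith
  have hchi : chi lam.1 P * chi lam.2.1 Q * chi lam.2.2 R ≤ CA * CB * CC * Real.exp M := by
    have g1 := hUA κA hκA hU1 P dA hP hPe
    have g2 := hUB κB hκB hU2 Q dB hQ hQe
    have g3 := hUC κC hκC hU3 R dC hR hRe
    have p1 := (chi_pos lam.1 hP).le
    have p2 := (chi_pos lam.2.1 hQ).le
    have p3 := (chi_pos lam.2.2 hR).le
    calc _ ≤ (CA * Real.exp (∑ i, lam.1 i * dA (σA i))) *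
          (CB * Real.exp (∑ j, lam.2.1 j * dB (σB j))) *
          (CC * Real.exp (∑ k, lam.2.2 k * dC (σC k))) := by gcongr
      _ = CA * CB * CC * Real.exp (∑ i, lam.1 i * dA (σA i) + ∑ j, lam.2.1 j * dB (σB j) +
          ∑ k, lam.2.2 k * dC (σC k)) := by rw [Real.exp_add, Real.exp_add]; ring
      _ ≤ _ := by gcongr
  have hnsq : nsq (tens P Q R *ᵥ ψ) =
      nsq (tens (diagonal (fun i => ((Real.exp (dA i) : ℝ) : ℂ)))
        (diagonal (fun i => ((Real.exp (dB i) : ℝ) : ℂ)))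
        (diagonal (fun i => ((Real.exp (dC i) : ℝ) : ℂ))) *ᵥ
        (tens U.1ᴴ U.2.1ᴴ U.2.2ᴴ *ᵥ ψ)) := by
    rw [hPe, hQe, hRe, ← tens_mulVec_mulVec, ← tens_mulVec_mulVec,
      nsq_tens_unitary hκA hκB hκC]
  rw [hnsq]
  refine le_trans ?_ (norm_sq_le_nsq _ (σA p.1, σB p.2.1, σC p.2.2))
  rw [tens_diagonal_mulVec]
  have hm := (mul_pos (mul_pos (chi_pos lam.1 hP) (chi_pos lam.2.1 hQ)) (chi_pos lam.2.2 hR)).le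
  refine pow_le_pow_left₀ (by positivity) ?_ 2
  rw [norm_mul, norm_mul, norm_mul, Complex.norm_real, Complex.norm_real, Complex.norm_real,
    Real.norm_eq_abs, Real.norm_eq_abs, Real.norm_eq_abs, Real.abs_exp, Real.abs_exp,
    Real.abs_exp, ← Real.exp_add, ← Real.exp_add, ← add_assoc, ← hM]
  calc δ / (CA * CB * CC) * (chi lam.1 P * chi lam.2.1 Q * chi lam.2.2 R)
      ≤ δ / (CA * CB * CC) * (CA * CB * CC * Real.exp M) := by gcongr
    _ = Real.exp M * δ := by field_simp
    _ ≤ _ := mul_le_mul_of_nonneg_left (hUφ _ hp).le (Real.exp_pos _).le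

theorem isCompact_unitaryGroup {n : ℕ} :
    IsCompact {U : Matrix (Fin n) (Fin n) ℂ | U ∈ unitaryGroup (Fin n) ℂ} := by
  have hK : IsCompact (Set.pi Set.univ fun _ : Fin n => Set.pi Set.univ fun _ : Fin n =>
      Metric.closedBall (0 : ℂ) 1) :=
    isCompact_univ_pi fun _ => isCompact_univ_pi fun _ => isCompact_closedBall _ _
  refine IsCompact.of_isClosed_subset hK ?_ ?_
  · have : IsClosed {U : Matrix (Fin n) (Fin n) ℂ | U * star U = 1} :=
      isClosed_eq (by fun_prop) continuous_const
    have he : {U : Matrix (Fin n) (Fin n) ℂ | U ∈ unitaryGroup (Fin n) ℂ} =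
        {U | U * star U = 1} := Set.ext fun U => mem_unitaryGroup_iff
    rwa [he]
  · intro U hU i _ j _
    simpa using entry_norm_bound_of_unitary hU i j

theorem exists_chi_bound {ψ : Fin a × Fin b × Fin c → ℂ}
    (hψ : ∀ u v w ξ, IsLowerUni u → IsLowerUni v → IsLowerUni w → tens u v w *ᵥ ξ = ψ →
      ∀ S : Finset (Fin a × Fin b × Fin c), (∀ p ∉ S, ξ p = 0) → DenseOrbit S)
    {lam : (Fin a → ℝ) × (Fin b → ℝ) × (Fin c → ℝ)} (hlam : DualGood lam)
    (h1 : Antitone lam.1) (h2 : Antitone lam.2.1) (h3 : Antitone lam.2.2)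
    (hs : ∑ i, lam.1 i = 1) : ∃ m > 0, ∀ P Q R, IsLowerInv P → IsLowerInv Q → IsLowerInv R →
      (m * (chi lam.1 P * chi lam.2.1 Q * chi lam.2.2 R)) ^ 2 ≤ nsq (tens P Q R *ᵥ ψ) := by
  have hmono : ∀ {m m' U}, 0 < m → m ≤ m' → SvdBound ψ lam m' U → SvdBound ψ lam m U := by
    intro m m' U hm hmm h κA hκA κB hκB κC hκC hU1 hU2 hU3 P Q R dA dB dC hdA hdB hdC hP hQ hR
      hPe hQe hRe
    refine le_trans ?_ (h κA hκA κB hκB κC hκC hU1 hU2 hU3 P Q R dA dB dC hdA hdB hdC hP hQ hR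
      hPe hQe hRe)
    have := (mul_pos (mul_pos (chi_pos lam.1 hP) (chi_pos lam.2.1 hQ)) (chi_pos lam.2.2 hR)).le
    exact pow_le_pow_left₀ (mul_nonneg hm.le this) (mul_le_mul_of_nonneg_right hmm this) 2
  have hcpt := (isCompact_unitaryGroup (n := a)).prod
    ((isCompact_unitaryGroup (n := b)).prod (isCompact_unitaryGroup (n := c)))
  obtain ⟨m, hm, hall⟩ := hcpt.induction_on (p := fun s => ∃ m > 0, ∀ U ∈ s, SvdBound ψ lam m U)
    ⟨1, one_pos, by simp⟩
    (fun s t hst ⟨m, hm, h⟩ => ⟨m, hm, fun U hU => h U (hst hU)⟩)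
    (fun s t ⟨m, hm, h⟩ ⟨m', hm', h'⟩ => ⟨min m m', lt_min hm hm', fun U hU => by
      rcases hU with hU | hU
      · exact hmono (lt_min hm hm') (min_le_left _ _) (h U hU)
      · exact hmono (lt_min hm hm') (min_le_right _ _) (h' U hU)⟩)
    (fun U hU => by
      obtain ⟨m, hm, hev⟩ := svdBound_local hψ hlam h1 h2 h3 hs hU.1 hU.2.1 hU.2.2
      exact ⟨_, mem_nhdsWithin_of_mem_nhds hev, m, hm, fun U h => h⟩)
  refine ⟨m, hm, fun P Q R hP hQ hR => ?_⟩
  obtain ⟨κA, hκA, qA, hqA, dA, hdA, hPe⟩ := exists_svd hP.isUnit_det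
  obtain ⟨κB, hκB, qB, hqB, dB, hdB, hQe⟩ := exists_svd hQ.isUnit_det
  obtain ⟨κC, hκC, qC, hqC, dC, hdC, hRe⟩ := exists_svd hR.isUnit_det
  exact hall (qA, qB, qC) ⟨hqA, hqB, hqC⟩ κA hκA κB hκB κC hκC hqA hqB hqC P Q R dA dB dC
    hdA hdB hdC hP hQ hR hPe hQe hRe
end
end

section

open Matrix Filter Topology

theorem mul_apply_self_of_lower {n : ℕ} {P Q : Matrix (Fin n) (Fin n) ℂ}
    (hP : ∀ i j, i < j → P i j = 0) (hQ : ∀ i j, i < j → Q i j = 0) (i : Fin n) :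
    (P * Q) i i = P i i * Q i i := by
  rw [mul_apply, Finset.sum_eq_single i]
  · intro j _ hj
    rcases lt_or_gt_of_ne hj with h | h
    · rw [hQ j i h, mul_zero]
    · rw [hP i j h, zero_mul]
  · simp

theorem IsLowerInv.mul {n : ℕ} {P Q : Matrix (Fin n) (Fin n) ℂ} (hP : IsLowerInv P)
    (hQ : IsLowerInv Q) : IsLowerInv (P * Q) := by
  refine ⟨fun i => ?_, fun i j hij => ?_⟩
  · rw [mul_apply_self_of_lower hP.2 hQ.2]
    exact mul_ne_zero (hP.1 i) (hQ.1 i)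
  · rw [mul_apply]
    refine Finset.sum_eq_zero fun k _ => ?_
    rcases le_or_gt k i with h | h
    · rw [hQ.2 k j (h.trans_lt hij), mul_zero]
    · rw [hP.2 i k h, zero_mul]

theorem chi_mul {n : ℕ} (lam : Fin n → ℝ) {P Q : Matrix (Fin n) (Fin n) ℂ}
    (hP : IsLowerInv P) (hQ : IsLowerInv Q) : chi lam (P * Q) = chi lam P * chi lam Q := by
  rw [chi, chi, chi, ← Finset.prod_mul_distrib]
  refine Finset.prod_congr rfl fun i _ => ?_
  rw [mul_apply_self_of_lower hP.2 hQ.2, norm_mul,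
    Real.mul_rpow (norm_nonneg _) (norm_nonneg _)]

theorem chi_one {n : ℕ} (lam : Fin n → ℝ) : chi lam (1 : Matrix (Fin n) (Fin n) ℂ) = 1 := by
  simp [chi]

theorem isLowerInv_one {n : ℕ} : IsLowerInv (1 : Matrix (Fin n) (Fin n) ℂ) :=
  isLowerUni_one.isLowerInv

theorem trace_transvection_conj {n : ℕ} (ρ : Matrix (Fin n) (Fin n) ℂ) (i j : Fin n) (t : ℂ) :
    ((1 + single i j t) * ρ * (1 + single i j t)ᴴ).trace =
      ρ.trace + t * ρ j i + star t * ρ i j + t * star t * ρ j j := by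
  rw [conjTranspose_add, conjTranspose_one, conjTranspose_single, Matrix.add_mul,
    Matrix.mul_add]
  simp only [Matrix.one_mul, Matrix.mul_one, Matrix.add_mul, trace_add]
  have h1 : (single i j t * ρ).trace = t * ρ j i := by
    rw [trace_single_mul, smul_eq_mul]
  have h2 : (ρ * single j i (star t)).trace = star t * ρ i j := by
    rw [trace_mul_single, op_smul_eq_mul, mul_comm]
  have h3 : (single i j t * ρ * single j i (star t)).trace = t * star t * ρ j j := by
    rw [Matrix.mul_assoc, trace_single_mul, mul_single_apply_same]
    ring
  rw [h1, h2, h3]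
  ring

/-- The minimality condition for characters determines a density matrix. -/
theorem eq_diagonal_of_chi_le {n : ℕ} {ρ : Matrix (Fin n) (Fin n) ℂ} (hρ : ρ.IsHermitian)
    (htr : ρ.trace.re = 1) {lam : Fin n → ℝ}
    (h : ∀ P, IsLowerInv P → chi lam P ^ 2 ≤ (P * ρ * Pᴴ).trace.re) :
    ρ = diagonal (fun i => (lam i : ℂ)) := by
  have hlow : ∀ i j, j < i → ρ j i = 0 := by
    intro i j hij
    have hre : ∀ s : ℝ, 0 ≤ -2 * s * ‖ρ j i‖ ^ 2 + s ^ 2 * ‖ρ j i‖ ^ 2 * (ρ j j).re := by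
      intro s
      set t : ℂ := -(s : ℂ) * star (ρ j i) with ht
      have hP : IsLowerUni (1 + single i j t) := by
        refine ⟨fun k => ?_, fun k l hkl => ?_⟩
        · have : ¬ (i = k ∧ j = k) := by rintro ⟨rfl, rfl⟩; exact lt_irrefl _ hij
          simp [this]
        · have : ¬ (i = k ∧ j = l) := by rintro ⟨rfl, rfl⟩; exact lt_asymm hij hkl
          simp [this, hkl.ne]
      have h1 := h _ hP.isLowerInv
      have hchi : chi lam (1 + single i j t) = 1 := by simp only [chi, hP.1]; simp
      rw [hchi, trace_transvection_conj] at h1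
      have e1 : t * ρ j i = ((-s * ‖ρ j i‖ ^ 2 : ℝ) : ℂ) := by
        have := Complex.mul_conj (ρ j i)
        rw [Complex.normSq_eq_norm_sq] at this
        rw [ht, mul_assoc, mul_comm (star _), Complex.star_def, this]
        push_cast; ring
      have e2 : star t * ρ i j = ((-s * ‖ρ j i‖ ^ 2 : ℝ) : ℂ) := by
        rw [← hρ.apply i j, ← star_mul', e1, Complex.star_def, Complex.conj_ofReal]
      have e3 : t * star t = ((s ^ 2 * ‖ρ j i‖ ^ 2 : ℝ) : ℂ) := by
        rw [Complex.star_def, Complex.mul_conj, Complex.normSq_eq_norm_sq, ht, norm_mul, norm_neg,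
          Complex.norm_real, norm_star, mul_pow, Real.norm_eq_abs, sq_abs]
      rw [e1, e2, e3] at h1
      simp only [Complex.add_re, htr, Complex.ofReal_re, Complex.re_ofReal_mul] at h1
      linarith
    by_contra hne
    have hpos : 0 < ‖ρ j i‖ ^ 2 := by positivity
    have h2 : ∀ s : ℝ, 0 ≤ -2 * s + s ^ 2 * (ρ j j).re := fun s => by
      have := hre s
      refine le_of_mul_le_mul_right (a := ‖ρ j i‖ ^ 2) ?_ hpos
      linarith
    have h3 := h2 (1 / (|(ρ j j).re| + 1))
    have h4 : 0 < |(ρ j j).re| + 1 := by positivity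
    have h5 : (1 / (|(ρ j j).re| + 1)) ^ 2 * (ρ j j).re ≤ 1 / (|(ρ j j).re| + 1) := by
      rw [div_pow, one_pow, div_mul_eq_mul_div, one_mul, div_le_div_iff₀ (by positivity) h4]
      nlinarith [le_abs_self (ρ j j).re]
    have h6 : 0 < 1 / (|(ρ j j).re| + 1) := by positivity
    linarith
  ext i j
  rcases lt_trichotomy i j with hij | rfl | hij
  · rw [diagonal_apply_ne _ hij.ne, hlow j i hij]
  · rw [diagonal_apply_eq]
    have him : ρ i i = ((ρ i i).re : ℂ) := (hρ.coe_re_apply_self i).symm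
    rw [him]
    congr 1
    set r := (ρ i i).re with hr
    have hmin : ∀ s : ℝ, 0 < s → (s ^ lam i) ^ 2 ≤ 1 + (s ^ 2 - 1) * r := by
      intro s hs
      have hdiag : ∀ k, (1 + single i i ((s : ℂ) - 1)) k k = if k = i then (s : ℂ) else 1 := by
        intro k
        by_cases hk : k = i
        · subst hk; simp
        · simp [hk, Ne.symm hk]
      have hP : IsLowerInv (1 + single i i ((s : ℂ) - 1)) := by
        refine ⟨fun k => ?_, fun k l hkl => ?_⟩
        · rw [hdiag]
          split_ifs
          · exact_mod_cast hs.ne'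
          · exact one_ne_zero
        · have : ¬ (i = k ∧ i = l) := by rintro ⟨rfl, rfl⟩; exact lt_irrefl _ hkl
          simp [this, hkl.ne]
      have h1 := h _ hP
      have hchi : chi lam (1 + single i i ((s : ℂ) - 1)) = s ^ lam i := by
        simp only [chi, hdiag]
        rw [Finset.prod_eq_single i]
        · simp [abs_of_pos hs]
        · intro k _ hk; simp [hk]
        · simp
      rw [hchi, trace_transvection_conj, him] at h1
      have e : star ((s : ℂ) - 1) = ((s - 1 : ℝ) : ℂ) := by
        simp
      have e' : (s : ℂ) - 1 = ((s - 1 : ℝ) : ℂ) := by push_cast; rfl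
      rw [e, e', ← Complex.ofReal_mul, ← Complex.ofReal_mul, ← Complex.ofReal_mul] at h1
      simp only [Complex.add_re, htr, Complex.ofReal_re] at h1
      linarith
    have hloc : IsLocalMin (fun s : ℝ => 1 + (s ^ 2 - 1) * r - (s ^ lam i) ^ 2) 1 := by
      filter_upwards [lt_mem_nhds (zero_lt_one (α := ℝ))] with s hs
      have := hmin s hs
      change 1 + ((1 : ℝ) ^ 2 - 1) * r - ((1 : ℝ) ^ lam i) ^ 2 ≤
        1 + (s ^ 2 - 1) * r - (s ^ lam i) ^ 2
      rw [Real.one_rpow]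
      linarith
    have hder : HasDerivAt (fun s : ℝ => 1 + (s ^ 2 - 1) * r - (s ^ lam i) ^ 2)
        (2 * r - 2 * lam i) 1 := by
      have d1 := ((((hasDerivAt_id (1 : ℝ)).pow 2).sub_const 1).mul_const r).const_add 1
      have d2 := (Real.hasDerivAt_rpow_const (p := lam i) (Or.inl (one_ne_zero (α := ℝ)))).pow 2
      exact (d1.sub d2).congr_deriv (by simp)
    have := hloc.hasDerivAt_eq_zero hder
    linarith
  · rw [diagonal_apply_ne _ hij.ne', ← hρ.apply, hlow i j hij, star_zero]

section
variable {a b c : ℕ}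

theorem nsq_smul {ι : Type*} [Fintype ι] (t : ℂ) (ψ : ι → ℂ) :
    nsq (t • ψ) = ‖t‖ ^ 2 * nsq ψ := by
  simp only [nsq, Pi.smul_apply, norm_smul, mul_pow, Finset.mul_sum]

theorem continuous_nsq {ι : Type*} [Fintype ι] : Continuous (nsq : (ι → ℂ) → ℝ) := by
  unfold nsq
  fun_prop

theorem isCompact_nsq_eq_one {ι : Type*} [Fintype ι] : IsCompact {φ : ι → ℂ | nsq φ = 1} := by
  refine IsCompact.of_isClosed_subset (isCompact_univ_pi fun _ : ι =>
    isCompact_closedBall (0 : ℂ) 1) (isClosed_eq continuous_nsq continuous_const) ?_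
  intro φ hφ i _
  have := norm_sq_le_nsq φ i
  rw [hφ] at this
  rw [mem_closedBall_zero_iff]
  exact (sq_le_one_iff₀ (norm_nonneg _)).1 this

/-- Minimizing the quotient of the norm and the character. -/
theorem exists_minimizer {ψ : Fin a × Fin b × Fin c → ℂ} (lA : Fin a → ℝ) (lB : Fin b → ℝ)
    (lC : Fin c → ℝ)
    (h : ∃ m > 0, ∀ P Q R, IsLowerInv P → IsLowerInv Q → IsLowerInv R →
      (m * (chi lA P * chi lB Q * chi lC R)) ^ 2 ≤ nsq (tens P Q R *ᵥ ψ)) :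
    ∃ φ : Fin a × Fin b × Fin c → ℂ, nsq φ = 1 ∧
      ∀ P Q R, IsLowerInv P → IsLowerInv Q → IsLowerInv R →
      (chi lA P * chi lB Q * chi lC R) ^ 2 ≤ nsq (tens P Q R *ᵥ φ) := by
  obtain ⟨m, hm, hb⟩ := h
  let G := {x : Matrix (Fin a) (Fin a) ℂ × Matrix (Fin b) (Fin b) ℂ × Matrix (Fin c) (Fin c) ℂ //
    IsLowerInv x.1 ∧ IsLowerInv x.2.1 ∧ IsLowerInv x.2.2}
  let X : G → ℝ := fun x => chi lA x.1.1 * chi lB x.1.2.1 * chi lC x.1.2.2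
  let N : G → ℝ := fun x => nsq (tens x.1.1 x.1.2.1 x.1.2.2 *ᵥ ψ)
  have hX : ∀ x, 0 < X x := fun x =>
    mul_pos (mul_pos (chi_pos _ x.2.1) (chi_pos _ x.2.2.1)) (chi_pos _ x.2.2.2)
  have hG : Nonempty G := ⟨⟨(1, 1, 1), isLowerInv_one, isLowerInv_one, isLowerInv_one⟩⟩
  have hlow : ∀ x, m ^ 2 ≤ N x / X x ^ 2 := fun x => by
    rw [le_div_iff₀ (pow_pos (hX x) 2), ← mul_pow]
    exact hb _ _ _ x.2.1 x.2.2.1 x.2.2.2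
  set I := ⨅ x, N x / X x ^ 2 with hI
  have hbdd : BddBelow (Set.range fun x => N x / X x ^ 2) := ⟨m ^ 2, by
    rintro _ ⟨x, rfl⟩
    exact hlow x⟩
  have hI0 : 0 < I := lt_of_lt_of_le (pow_pos hm 2) (le_ciInf hlow)
  have hIle : ∀ x, I * X x ^ 2 ≤ N x := fun x => by
    rw [← le_div_iff₀ (pow_pos (hX x) 2)]
    exact ciInf_le hbdd x
  have hN : ∀ x, 0 < N x := fun x => lt_of_lt_of_le (mul_pos hI0 (pow_pos (hX x) 2)) (hIle x)
  have hex : ∀ n : ℕ, ∃ x, N x ≤ (I + 1 / ((n : ℝ) + 1)) * X x ^ 2 := fun n => by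
    obtain ⟨x, hx⟩ := exists_lt_of_ciInf_lt
      (show (⨅ x, N x / X x ^ 2) < I + 1 / ((n : ℝ) + 1) from
        lt_add_of_pos_right _ Nat.one_div_pos_of_nat)
    exact ⟨x, ((div_lt_iff₀ (pow_pos (hX x) 2)).1 hx).le⟩
  choose x hx using hex
  let φ : ℕ → Fin a × Fin b × Fin c → ℂ := fun n =>
    (((√(N (x n)))⁻¹ : ℝ) : ℂ) • (tens (x n).1.1 (x n).1.2.1 (x n).1.2.2 *ᵥ ψ)
  have hnorm : ∀ n, ‖(((√(N (x n)))⁻¹ : ℝ) : ℂ)‖ ^ 2 = (N (x n))⁻¹ := fun n => by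
    rw [Complex.norm_real, Real.norm_eq_abs, sq_abs, inv_pow, Real.sq_sqrt (hN _).le]
  have hφ1 : ∀ n, φ n ∈ {φ : Fin a × Fin b × Fin c → ℂ | nsq φ = 1} := fun n => by
    change nsq (φ n) = 1
    rw [nsq_smul, hnorm]
    exact inv_mul_cancel₀ (hN _).ne'
  obtain ⟨φ₀, hφ₀, g, hgm, hg⟩ := isCompact_nsq_eq_one.tendsto_subseq hφ1
  refine ⟨φ₀, hφ₀, fun P Q R hP hQ hR => ?_⟩
  have hlim : Tendsto (fun n => nsq (tens P Q R *ᵥ φ (g n))) atTop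
      (𝓝 (nsq (tens P Q R *ᵥ φ₀))) := by
    have hc : Continuous fun φ : Fin a × Fin b × Fin c → ℂ => nsq (tens P Q R *ᵥ φ) :=
      continuous_nsq.comp (by fun_prop)
    exact (hc.tendsto φ₀).comp hg
  set t := (chi lA P * chi lB Q * chi lC R) ^ 2 with ht
  have hbound : ∀ n : ℕ, t * I / (I + 1 / ((n : ℝ) + 1)) ≤ nsq (tens P Q R *ᵥ φ n) := by
    intro n
    let y : G := ⟨(P * (x n).1.1, Q * (x n).1.2.1, R * (x n).1.2.2),
      hP.mul (x n).2.1, hQ.mul (x n).2.2.1, hR.mul (x n).2.2.2⟩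
    have hXy : X y ^ 2 = t * X (x n) ^ 2 := by
      change (chi lA (P * (x n).1.1) * chi lB (Q * (x n).1.2.1) *
        chi lC (R * (x n).1.2.2)) ^ 2 = _
      rw [chi_mul lA hP (x n).2.1, chi_mul lB hQ (x n).2.2.1, chi_mul lC hR (x n).2.2.2]
      simp only [X, t]
      ring
    have hNy : nsq (tens P Q R *ᵥ φ n) = (N (x n))⁻¹ * N y := by
      simp only [φ]
      rw [mulVec_smul, nsq_smul, hnorm, tens_mulVec_mulVec]
    have hy := hIle y
    rw [hXy] at hy
    have hε : 0 < I + 1 / ((n : ℝ) + 1) := add_pos hI0 Nat.one_div_pos_of_nat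
    rw [hNy, div_le_iff₀ hε, mul_comm _ (N y), mul_assoc, inv_mul_eq_div, mul_div_assoc',
      le_div_iff₀ (hN _)]
    have ht0 : 0 ≤ t := sq_nonneg _
    calc t * I * N (x n) ≤ t * I * ((I + 1 / ((n : ℝ) + 1)) * X (x n) ^ 2) :=
          mul_le_mul_of_nonneg_left (hx n) (mul_nonneg ht0 hI0.le)
      _ = (I * (t * X (x n) ^ 2)) * (I + 1 / ((n : ℝ) + 1)) := by ring
      _ ≤ _ := mul_le_mul_of_nonneg_right hy hε.le
  have hlim' : Tendsto (fun n : ℕ => t * I / (I + 1 / ((n : ℝ) + 1))) atTop (𝓝 t) := by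
    have h1 : Tendsto (fun n : ℕ => t * I / (I + 1 / ((n : ℝ) + 1))) atTop
        (𝓝 (t * I / (I + 0))) :=
      tendsto_const_nhds.div (tendsto_const_nhds.add tendsto_one_div_add_atTop_nhds_zero_nat)
        (by rw [add_zero]; exact hI0.ne')
    rwa [add_zero, mul_div_cancel_right₀ _ hI0.ne'] at h1
  exact le_of_tendsto_of_tendsto' (hlim'.comp hgm.tendsto_atTop) hlim fun n => hbound (g n)

theorem mem_kronCone_of_dualGood_of_sum_eq_one
    {lam : (Fin a → ℝ) × (Fin b → ℝ) × (Fin c → ℝ)} (hlam : DualGood lam)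
    (h1 : Antitone lam.1) (h2 : Antitone lam.2.1) (h3 : Antitone lam.2.2)
    (hs : ∑ i, lam.1 i = 1) : lam ∈ KronCone a b c := by
  obtain ⟨ψ, hψ⟩ := exists_generic (a := a) (b := b) (c := c)
  obtain ⟨φ, hφ, h⟩ := exists_minimizer _ _ _ (exists_chi_bound hψ hlam h1 h2 h3 hs)
  have hu : ∀ {n : ℕ}, (1 : Matrix (Fin n) (Fin n) ℂ) ∈ unitaryGroup (Fin n) ℂ :=
    fun {n} => one_mem _
  refine mem_kronCone_iff.2 ⟨⟨h1, h2, h3⟩, φ, ?_, ?_, ?_⟩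
  · refine eq_diagonal_of_chi_le (isHermitian_rhoA φ) (by rw [trace_rhoA, hφ]) fun P hP => ?_
    rw [← rhoA_tens P hu hu, trace_rhoA]
    simpa [chi_one] using h P 1 1 hP isLowerInv_one isLowerInv_one
  · refine eq_diagonal_of_chi_le (isHermitian_rhoB φ) (by rw [trace_rhoB, hφ]) fun P hP => ?_
    rw [← rhoB_tens P hu hu, trace_rhoB]
    simpa [chi_one] using h 1 P 1 isLowerInv_one hP isLowerInv_one
  · refine eq_diagonal_of_chi_le (isHermitian_rhoC φ) (by rw [trace_rhoC, hφ]) fun P hP => ?_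
    rw [← rhoC_tens P hu hu, trace_rhoC]
    simpa [chi_one] using h 1 1 P isLowerInv_one isLowerInv_one hP

theorem DualGood.nonneg {lam : (Fin a → ℝ) × (Fin b → ℝ) × (Fin c → ℝ)} (hlam : DualGood lam)
    (x : Fin a → ℝ) (y : Fin b → ℝ) (w : Fin c → ℝ)
    (h : ∀ p : Fin a × Fin b × Fin c, 0 ≤ x p.1 + y p.2.1 + w p.2.2) :
    0 ≤ ∑ i, x i * lam.1 i + ∑ j, y j * lam.2.1 j + ∑ k, w k * lam.2.2 k :=
  hlam _ denseOrbit_univ x y w fun p _ => h p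

theorem DualGood.sum_eq {lam : (Fin a → ℝ) × (Fin b → ℝ) × (Fin c → ℝ)} (hlam : DualGood lam) :
    ∑ j, lam.2.1 j = ∑ i, lam.1 i ∧ ∑ k, lam.2.2 k = ∑ i, lam.1 i := by
  have e1 := hlam.nonneg (fun _ => 1) (fun _ => -1) 0 (by simp)
  have e2 := hlam.nonneg (fun _ => -1) (fun _ => 1) 0 (by simp)
  have e3 := hlam.nonneg (fun _ => 1) 0 (fun _ => -1) (by simp)
  have e4 := hlam.nonneg (fun _ => -1) 0 (fun _ => 1) (by simp)
  simp only [one_mul, neg_mul, Finset.sum_neg_distrib, Pi.zero_apply, zero_mul,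
    Finset.sum_const_zero] at e1 e2 e3 e4
  constructor <;> linarith

theorem DualGood.apply_nonneg {lam : (Fin a → ℝ) × (Fin b → ℝ) × (Fin c → ℝ)}
    (hlam : DualGood lam) :
    (∀ i, 0 ≤ lam.1 i) ∧ (∀ j, 0 ≤ lam.2.1 j) ∧ ∀ k, 0 ≤ lam.2.2 k := by
  classical
  have hsg : ∀ {n : ℕ} (i j : Fin n), (0 : ℝ) ≤ (Pi.single i 1 : Fin n → ℝ) j := fun i j => by
    rw [Pi.single_apply]; split_ifs <;> simp
  refine ⟨fun i => ?_, fun j => ?_, fun k => ?_⟩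
  · simpa [Pi.single_apply] using hlam.nonneg (Pi.single i 1) 0 0 (by simp [hsg])
  · simpa [Pi.single_apply] using hlam.nonneg 0 (Pi.single j 1) 0 (by simp [hsg])
  · simpa [Pi.single_apply] using hlam.nonneg 0 0 (Pi.single k 1) (by simp [hsg])

theorem DualGood.smul {lam : (Fin a → ℝ) × (Fin b → ℝ) × (Fin c → ℝ)} (hlam : DualGood lam)
    {t : ℝ} (ht : 0 ≤ t) : DualGood (t • lam) := by
  intro S hS x y w hx
  have h := mul_nonneg ht (hlam S hS x y w hx)
  rw [mul_add, mul_add, Finset.mul_sum, Finset.mul_sum, Finset.mul_sum] at h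
  refine h.trans (le_of_eq ?_)
  congr 1
  · congr 1
    · exact Finset.sum_congr rfl fun i _ => mul_left_comm _ _ _
    · exact Finset.sum_congr rfl fun i _ => mul_left_comm _ _ _
  · exact Finset.sum_congr rfl fun i _ => mul_left_comm _ _ _

theorem mem_kronCone_smul {lam : (Fin a → ℝ) × (Fin b → ℝ) × (Fin c → ℝ)}
    (hlam : lam ∈ KronCone a b c) {t : ℝ} (ht : 0 ≤ t) : t • lam ∈ KronCone a b c := by
  rw [mem_kronCone_iff] at hlam ⊢
  obtain ⟨⟨h1, h2, h3⟩, ψ, hA, hB, hC⟩ := hlam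
  have hn : ‖((√t : ℝ) : ℂ)‖ ^ 2 = t := by
    rw [Complex.norm_real, Real.norm_eq_abs, sq_abs, Real.sq_sqrt ht]
  have hd : ∀ {n : ℕ} (x : Fin n → ℝ), (t : ℂ) • diagonal (fun i => (x i : ℂ)) =
      diagonal fun i => (((t • x) i : ℝ) : ℂ) := fun x => by
    rw [← diagonal_smul]
    congr 1
    funext i
    simp
  refine ⟨⟨fun i j hij => mul_le_mul_of_nonneg_left (h1 hij) ht,
    fun i j hij => mul_le_mul_of_nonneg_left (h2 hij) ht,
    fun i j hij => mul_le_mul_of_nonneg_left (h3 hij) ht⟩, ((√t : ℝ) : ℂ) • ψ, ?_, ?_, ?_⟩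
  · rw [rhoA_smul, hn, hA]; exact hd _
  · rw [rhoB_eq]; change rhoA (((√t : ℝ) : ℂ) • swapAB ψ) = _
    rw [rhoA_smul, hn, ← rhoB_eq, hB]; exact hd _
  · rw [rhoC_eq]; change rhoA (((√t : ℝ) : ℂ) • rotC ψ) = _
    rw [rhoA_smul, hn, ← rhoC_eq, hC]; exact hd _

theorem mem_kronCone_of_dualGood
    {lam : (Fin a → ℝ) × (Fin b → ℝ) × (Fin c → ℝ)} (hlam : DualGood lam)
    (h1 : Antitone lam.1) (h2 : Antitone lam.2.1) (h3 : Antitone lam.2.2) :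
    lam ∈ KronCone a b c := by
  obtain ⟨n1, n2, n3⟩ := hlam.apply_nonneg
  obtain ⟨s2, s3⟩ := hlam.sum_eq
  rcases (Finset.sum_nonneg fun i _ => n1 i : 0 ≤ ∑ i, lam.1 i).eq_or_lt with h0 | h0
  · rw [← h0] at s2 s3
    have z1 := (Finset.sum_eq_zero_iff_of_nonneg fun i _ => n1 i).1 h0.symm
    have z2 := (Finset.sum_eq_zero_iff_of_nonneg fun i _ => n2 i).1 s2
    have z3 := (Finset.sum_eq_zero_iff_of_nonneg fun i _ => n3 i).1 s3
    refine mem_kronCone_iff.2 ⟨⟨h1, h2, h3⟩, 0, ?_, ?_, ?_⟩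
    · ext i j; simp [rhoA, diagonal_apply, z1]
    · ext i j; simp [rhoB, diagonal_apply, z2]
    · ext i j; simp [rhoC, diagonal_apply, z3]
  · set s := ∑ i, lam.1 i with hs
    have hi : 0 ≤ s⁻¹ := inv_nonneg.2 h0.le
    have h := mem_kronCone_of_dualGood_of_sum_eq_one (hlam.smul hi)
      (fun i j hij => mul_le_mul_of_nonneg_left (h1 hij) hi)
      (fun i j hij => mul_le_mul_of_nonneg_left (h2 hij) hi)
      (fun i j hij => mul_le_mul_of_nonneg_left (h3 hij) hi)
      (by
        change ∑ i, s⁻¹ * lam.1 i = 1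
        rw [← Finset.mul_sum, ← hs, inv_mul_cancel₀ h0.ne'])
    have := mem_kronCone_smul h h0.le
    rwa [smul_inv_smul₀ h0.ne'] at this

/-- The Kronecker cone is closed under addition. -/
theorem mem_kronCone_add {lam mu : (Fin a → ℝ) × (Fin b → ℝ) × (Fin c → ℝ)}
    (hlam : lam ∈ KronCone a b c) (hmu : mu ∈ KronCone a b c) : lam + mu ∈ KronCone a b c := by
  obtain ⟨h1, h2, h3⟩ := (mem_kronCone_iff.1 hlam).1
  obtain ⟨g1, g2, g3⟩ := (mem_kronCone_iff.1 hmu).1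
  exact mem_kronCone_of_dualGood ((mem_kronCone.dualGood hlam).add (mem_kronCone.dualGood hmu))
    (h1.add g1) (h2.add g2) (h3.add g3)

end
end

section

open Matrix Filter Topology

/-- If a probability vector has mean zero deviation and small variance around `x`, and all values
but one are far from `x`, then that one is quadratically close to `x`. -/
theorem abs_le_of_variance_le {n : ℕ} {p y : Fin n → ℝ} (hp : ∀ m, 0 ≤ p m)
    (hp1 : ∑ m, p m = 1) (hmean : ∑ m, p m * y m = 0) {v G : ℝ} (hG : 0 < G)
    (hv : ∑ m, p m * y m ^ 2 ≤ v) (i : Fin n) (hfar : ∀ m, m ≠ i → G ≤ |y m|)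
    (hvG : 2 * v ≤ G ^ 2) : |y i| ≤ 2 * v / G := by
  have hsplit : ∀ f : Fin n → ℝ, ∑ m, f m = f i + ∑ m ∈ Finset.univ.erase i, f m := fun f =>
    (Finset.add_sum_erase _ f (Finset.mem_univ i)).symm
  have hv' : ∑ m ∈ Finset.univ.erase i, p m * y m ^ 2 ≤ v := by
    rw [hsplit] at hv
    have := mul_nonneg (hp i) (sq_nonneg (y i))
    linarith
  have hmass : (∑ m ∈ Finset.univ.erase i, p m) * G ^ 2 ≤ v := by
    refine le_trans ?_ hv'
    rw [Finset.sum_mul]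
    refine Finset.sum_le_sum fun m hm => mul_le_mul_of_nonneg_left ?_ (hp m)
    rw [← sq_abs (y m)]
    exact pow_le_pow_left₀ hG.le (hfar m (Finset.ne_of_mem_erase hm)) 2
  have hpi : 1 / 2 ≤ p i := by
    rw [hsplit] at hp1
    by_contra! hlt
    have h1 : 1 / 2 < ∑ m ∈ Finset.univ.erase i, p m := by linarith
    have := mul_lt_mul_of_pos_right h1 (pow_pos hG 2)
    linarith
  have habs : p i * |y i| * G ≤ v := by
    rw [hsplit] at hmean
    have h1 : p i * |y i| ≤ ∑ m ∈ Finset.univ.erase i, p m * |y m| := by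
      calc p i * |y i| = |p i * y i| := by rw [abs_mul, abs_of_nonneg (hp i)]
        _ = |∑ m ∈ Finset.univ.erase i, p m * y m| := by
          rw [eq_neg_of_add_eq_zero_left hmean, abs_neg]
        _ ≤ ∑ m ∈ Finset.univ.erase i, |p m * y m| := Finset.abs_sum_le_sum_abs _ _
        _ = _ := Finset.sum_congr rfl fun m _ => by rw [abs_mul, abs_of_nonneg (hp m)]
    refine (mul_le_mul_of_nonneg_right h1 hG.le).trans (le_trans ?_ hv')
    rw [Finset.sum_mul]
    refine Finset.sum_le_sum fun m hm => ?_
    rw [mul_assoc, ← sq_abs (y m), sq]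
    exact mul_le_mul_of_nonneg_left (mul_le_mul_of_nonneg_left
      (hfar m (Finset.ne_of_mem_erase hm)) (abs_nonneg _)) (hp m)
  rw [le_div_iff₀ hG]
  have : 1 / 2 * (|y i| * G) ≤ p i * (|y i| * G) :=
    mul_le_mul_of_nonneg_right hpi (mul_nonneg (abs_nonneg _) hG.le)
  linarith

theorem strictMono_fin_eq {n : ℕ} {f : Fin n → Fin n} (hf : StrictMono f) (i : Fin n) :
    f i = i := by
  have hs : Function.Surjective f := Finite.surjective_of_injective hf.injective
  have := Subsingleton.elim (hf.orderIsoOfSurjective f hs) (OrderIso.refl (Fin n))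
  exact congrArg (fun e : Fin n ≃o Fin n => e i) this

theorem conj_diagonal_apply {n : ℕ} (k : Matrix (Fin n) (Fin n) ℂ) (mu : Fin n → ℝ)
    (i : Fin n) : (k * diagonal (fun m => (mu m : ℂ)) * kᴴ) i i =
      ((∑ m, ‖k i m‖ ^ 2 * mu m : ℝ) : ℂ) := by
  rw [mul_apply]
  push_cast
  refine Finset.sum_congr rfl fun m _ => ?_
  rw [mul_diagonal, conjTranspose_apply, mul_right_comm, Complex.star_def, Complex.mul_conj,
    Complex.normSq_eq_norm_sq]
  push_cast
  rfl

/-- Second-order perturbation bound for the eigenvalues of a Hermitian matrix close to a diagonal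
matrix with simple spectrum. -/
theorem exists_spec_perturbation {n : ℕ} {lam : Fin n → ℝ} (hlam : StrictAnti lam) :
    ∃ ε₀ > 0, ∃ K : ℝ, ∀ (M : Matrix (Fin n) (Fin n) ℂ) (mu : Fin n → ℝ) (ε : ℝ),
      IsSpecDown M mu → ε ≤ ε₀ →
      (∀ i j, ‖M i j - diagonal (fun i => (lam i : ℂ)) i j‖ ≤ ε) →
      ∀ i, |mu i - (M i i).re| ≤ K * ε ^ 2 := by
  obtain ⟨g, hg0, hg⟩ : ∃ g > 0, ∀ i j, i < j → g ≤ lam i - lam j := by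
    classical
    rcases (Finset.univ.filter fun p : Fin n × Fin n => p.1 < p.2).eq_empty_or_nonempty with h | h
    · refine ⟨1, one_pos, fun i j hij => ?_⟩
      have : (i, j) ∈ Finset.univ.filter fun p : Fin n × Fin n => p.1 < p.2 := by simpa using hij
      rw [h] at this
      simp at this
    · obtain ⟨p, hp, hmin⟩ := Finset.exists_min_image _
        (fun p : Fin n × Fin n => lam p.1 - lam p.2) h
      exact ⟨_, sub_pos.2 (hlam (Finset.mem_filter.1 hp).2), fun i j hij =>
        hmin (i, j) (by simpa using hij)⟩
  set N : ℝ := n + 1 with hN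
  have hN1 : 1 ≤ N := by simp [hN]
  refine ⟨g / (8 * N), by positivity, 2 * N / (g / 2), ?_⟩
  intro M mu ε hspec hε hM i₀
  have hε0 : 0 ≤ ε := (norm_nonneg _).trans (hM i₀ i₀)
  have hεg : ε * (8 * N) ≤ g := (le_div_iff₀ (by positivity)).1 hε
  obtain ⟨k, hk, hMk⟩ := hspec.exists_unitary
  have hkk : k * kᴴ = 1 := mem_unitaryGroup_iff.1 hk
  have hkk' : kᴴ * k = 1 := mem_unitaryGroup_iff'.1 hk
  have hH : M.IsHermitian := by rw [hMk]; exact isHermitian_conj_diagonal k mu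
  set x : Fin n → ℝ := fun i => (M i i).re with hx
  have hMx : ∀ i, M i i = (x i : ℂ) := fun i => (hH.coe_re_apply_self i).symm
  have hxl : ∀ i, |x i - lam i| ≤ ε := fun i => by
    have := hM i i
    rwa [diagonal_apply_eq, hMx, ← Complex.ofReal_sub, Complex.norm_real, Real.norm_eq_abs] at this
  have hp1 : ∀ i, ∑ m, ‖k i m‖ ^ 2 = 1 := fun i => by
    have := conj_diagonal_apply k (fun _ => 1) i
    simp only [Complex.ofReal_one, diagonal_one, hkk, one_apply_eq, mul_one] at this
    exact_mod_cast this.symm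
  have hshift : ∀ i, M - (x i : ℂ) • (1 : Matrix (Fin n) (Fin n) ℂ) =
      k * diagonal (fun m => ((mu m - x i : ℝ) : ℂ)) * kᴴ := fun i => by
    have : diagonal (fun m => ((mu m - x i : ℝ) : ℂ)) =
        diagonal (fun m => (mu m : ℂ)) - (x i : ℂ) • (1 : Matrix (Fin n) (Fin n) ℂ) := by
      ext a b
      by_cases hab : a = b
      · subst hab; simp
      · simp [hab]
    rw [this, Matrix.mul_sub, Matrix.sub_mul, ← hMk, Matrix.mul_smul, Matrix.mul_one,
      Matrix.smul_mul, hkk]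
  have hmean : ∀ i, ∑ m, ‖k i m‖ ^ 2 * (mu m - x i) = 0 := fun i => by
    have := conj_diagonal_apply k (fun m => mu m - x i) i
    rw [← hshift] at this
    simp only [Matrix.sub_apply, Matrix.smul_apply, one_apply_eq, smul_eq_mul, mul_one, hMx, sub_self] at this
    exact_mod_cast this.symm
  have hvar : ∀ i, ∑ m, ‖k i m‖ ^ 2 * (mu m - x i) ^ 2 ≤ N * ε ^ 2 := fun i => by
    have h1 := conj_diagonal_apply k (fun m => (mu m - x i) ^ 2) i
    set A := M - (x i : ℂ) • (1 : Matrix (Fin n) (Fin n) ℂ) with hA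
    have hAs : A = k * diagonal (fun m => ((mu m - x i : ℝ) : ℂ)) * kᴴ := hshift i
    have hAH : Aᴴ = A := by
      rw [hAs]
      exact isHermitian_conj_diagonal k _
    have h2 : k * diagonal (fun m => (((mu m - x i) ^ 2 : ℝ) : ℂ)) * kᴴ = A * Aᴴ := by
      rw [hAH, hAs]
      have : diagonal (fun m => (((mu m - x i) ^ 2 : ℝ) : ℂ)) =
          diagonal (fun m => ((mu m - x i : ℝ) : ℂ)) *
            diagonal (fun m => ((mu m - x i : ℝ) : ℂ)) := by
        rw [diagonal_mul_diagonal]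
        congr 1; funext m; push_cast; ring
      rw [this]
      calc _ = k * diagonal (fun m => ((mu m - x i : ℝ) : ℂ)) * 1 *
            diagonal (fun m => ((mu m - x i : ℝ) : ℂ)) * kᴴ := by
              simp only [Matrix.mul_assoc, Matrix.one_mul]
        _ = _ := by rw [← hkk']; simp only [Matrix.mul_assoc]
    have h3 : (A * Aᴴ) i i = ((∑ j, ‖A i j‖ ^ 2 : ℝ) : ℂ) := by
      rw [mul_apply]
      push_cast
      refine Finset.sum_congr rfl fun j _ => ?_
      rw [conjTranspose_apply, Complex.star_def, Complex.mul_conj, Complex.normSq_eq_norm_sq]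
      push_cast
      rfl
    rw [h2, h3] at h1
    have h4 : ∑ j, ‖A i j‖ ^ 2 = ∑ m, ‖k i m‖ ^ 2 * (mu m - x i) ^ 2 := by exact_mod_cast h1
    rw [← h4]
    have h5 : ∀ j, ‖A i j‖ ^ 2 ≤ ε ^ 2 := fun j => by
      refine pow_le_pow_left₀ (norm_nonneg _) ?_ 2
      by_cases hij : i = j
      · subst hij
        simpa [hA, hMx] using hε0
      · simpa [hA, hij] using hM i j
    refine (Finset.sum_le_sum fun j _ => h5 j).trans ?_
    simp only [Finset.sum_const, Finset.card_univ, Fintype.card_fin, nsmul_eq_mul]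
    exact mul_le_mul_of_nonneg_right (by simp [hN]) (sq_nonneg ε)
  have hnear : ∀ i, ∃ m, |mu m - x i| ≤ N * ε := fun i => by
    by_contra! hfar
    have hlt : ∑ m, ‖k i m‖ ^ 2 * (N * ε) ^ 2 < N ^ 2 * ε ^ 2 + 1 := by
      rw [← Finset.sum_mul, hp1]; linarith [mul_pow N ε 2]
    have h1 : ∀ m, (N * ε) ^ 2 < (mu m - x i) ^ 2 := fun m => by
      rw [← sq_abs (mu m - x i)]
      exact pow_lt_pow_left₀ (hfar m) (by positivity) two_ne_zero
    have hne : ∃ m, 0 < ‖k i m‖ ^ 2 := by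
      by_contra! h
      have : ∑ m, ‖k i m‖ ^ 2 ≤ 0 := Finset.sum_nonpos fun m _ => h m
      linarith [hp1 i]
    have h2 : ∑ m, ‖k i m‖ ^ 2 * (N * ε) ^ 2 < ∑ m, ‖k i m‖ ^ 2 * (mu m - x i) ^ 2 := by
      obtain ⟨m, hm⟩ := hne
      exact Finset.sum_lt_sum (fun m _ => mul_le_mul_of_nonneg_left (h1 m).le (sq_nonneg _))
        ⟨m, Finset.mem_univ _, mul_lt_mul_of_pos_left (h1 m) hm⟩
    rw [← Finset.sum_mul, hp1, one_mul] at h2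
    have h3 := hvar i
    have : N * ε ^ 2 ≤ (N * ε) ^ 2 := by
      rw [mul_pow]
      exact mul_le_mul_of_nonneg_right (by nlinarith) (sq_nonneg ε)
    linarith
  choose f hf using hnear
  have hNε : ε ≤ N * ε := by nlinarith
  have hmono : StrictMono f := by
    intro i j hij
    by_contra! hle
    have h1 := hspec.1 hle
    have h2 := abs_le.1 (hf i)
    have h3 := abs_le.1 (hf j)
    have h4 := abs_le.1 (hxl i)
    have h5 := abs_le.1 (hxl j)
    have h6 := hg i j hij
    linarith
  have hclose : ∀ i, |mu i - x i| ≤ N * ε := fun i => by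
    have := hf i
    rwa [strictMono_fin_eq hmono] at this
  have h := abs_le_of_variance_le (fun m => sq_nonneg ‖k i₀ m‖) (hp1 i₀) (hmean i₀)
    (half_pos hg0) (hvar i₀) i₀ (fun m hm => by
      have h2 := abs_le.1 (hclose m)
      have h4 := abs_le.1 (hxl m)
      have h5 := abs_le.1 (hxl i₀)
      rcases lt_or_gt_of_ne hm with hlt | hlt
      · have := hg _ _ hlt
        refine le_trans ?_ (le_abs_self _)
        linarith
      · have := hg _ _ hlt
        refine le_trans ?_ (neg_le_abs _)
        linarith) (by nlinarith)
  refine h.trans (le_of_eq ?_)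
  ring
end

section

open Matrix

theorem exists_norm_rhoA_sub_le {a b c : ℕ} (ψ χ : Fin a × Fin b × Fin c → ℂ) :
    ∃ C : ℝ, 0 ≤ C ∧ ∀ t : ℝ, 0 ≤ t → t ≤ 1 → ∀ i i',
      ‖rhoA (ψ - (t : ℂ) • χ) i i' - rhoA ψ i i'‖ ≤ C * t := by
  obtain ⟨X, hX⟩ : ∃ X : Fin a → Fin a → ℂ, ∀ i i', X i i' = ∑ j, ∑ k,
      (ψ (i, j, k) * (starRingEnd ℂ) (χ (i', j, k)) +
        χ (i, j, k) * (starRingEnd ℂ) (ψ (i', j, k))) := ⟨_, fun _ _ => rfl⟩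
  refine ⟨∑ p : Fin a × Fin a, (‖X p.1 p.2‖ + ‖rhoA χ p.1 p.2‖), by positivity,
    fun t ht ht1 i i' => ?_⟩
  have h : rhoA (ψ - (t : ℂ) • χ) i i' - rhoA ψ i i' =
      -((t : ℂ) * X i i') + (t : ℂ) * ((t : ℂ) * rhoA χ i i') := by
    simp only [rhoA, of_apply, hX, Pi.sub_apply, Pi.smul_apply, smul_eq_mul, Finset.mul_sum,
      ← Finset.sum_sub_distrib, ← Finset.sum_neg_distrib, ← Finset.sum_add_distrib, map_sub, map_mul,
      Complex.conj_ofReal]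
    refine Finset.sum_congr rfl fun j _ => Finset.sum_congr rfl fun k _ => ?_
    ring
  rw [h]
  have h1 : ‖X i i'‖ + ‖rhoA χ i i'‖ ≤ ∑ p : Fin a × Fin a, (‖X p.1 p.2‖ + ‖rhoA χ p.1 p.2‖) :=
    Finset.single_le_sum (f := fun p : Fin a × Fin a => ‖X p.1 p.2‖ + ‖rhoA χ p.1 p.2‖)
      (fun p _ => by positivity) (Finset.mem_univ (i, i'))
  refine (norm_add_le _ _).trans ?_
  rw [norm_neg, norm_mul, norm_mul, norm_mul, Complex.norm_real, Real.norm_of_nonneg ht]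
  have h2 : t * ‖rhoA χ i i'‖ ≤ ‖rhoA χ i i'‖ := mul_le_of_le_one_left (norm_nonneg _) ht1
  calc t * ‖X i i'‖ + t * (t * ‖rhoA χ i i'‖) ≤ t * (‖X i i'‖ + ‖rhoA χ i i'‖) := by
        rw [mul_add]; gcongr
    _ ≤ (∑ p : Fin a × Fin a, (‖X p.1 p.2‖ + ‖rhoA χ p.1 p.2‖)) * t := by
        rw [mul_comm]; exact mul_le_mul_of_nonneg_right h1 ht

theorem exists_spec_rhoA_expansion {a b c : ℕ} {lam : Fin a → ℝ} (hlam : StrictAnti lam)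
    {ψ : Fin a × Fin b × Fin c → ℂ} (hψ : rhoA ψ = diagonal fun i => (lam i : ℂ))
    (χ : Fin a × Fin b × Fin c → ℂ) :
    ∃ t₀ > 0, ∃ K : ℝ, ∀ t : ℝ, 0 ≤ t → t ≤ t₀ → ∀ mu, IsSpecDown (rhoA (ψ - (t : ℂ) • χ)) mu →
      ∀ i, |mu i - (rhoA (ψ - (t : ℂ) • χ) i i).re| ≤ K * t ^ 2 := by
  obtain ⟨ε₀, hε₀, K, hK⟩ := exists_spec_perturbation hlam
  obtain ⟨C, hC0, hC⟩ := exists_norm_rhoA_sub_le ψ χ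
  refine ⟨min 1 (ε₀ / (C + 1)), by positivity, K * C ^ 2, fun t ht htt mu hmu i => ?_⟩
  have ht1 : t ≤ 1 := htt.trans (min_le_left _ _)
  have ht2 : t * (C + 1) ≤ ε₀ := (le_div_iff₀ (by positivity)).1 (htt.trans (min_le_right _ _))
  refine (hK _ mu (C * t) hmu (by nlinarith) (fun i j => ?_) i).trans_eq (by ring)
  rw [← hψ]
  exact hC t ht ht1 i j

theorem sum_mul_le_of_abs_sub_le {n : ℕ} (x : Fin n → ℝ) {mu d : Fin n → ℝ} {e : ℝ}
    (h : ∀ i, |mu i - d i| ≤ e) : ∑ i, x i * mu i ≤ ∑ i, x i * d i + (∑ i, |x i|) * e := by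
  rw [Finset.sum_mul, ← Finset.sum_add_distrib]
  refine Finset.sum_le_sum fun i _ => ?_
  have h1 : x i * (mu i - d i) ≤ |x i| * e :=
    (le_abs_self _).trans (by rw [abs_mul]; exact mul_le_mul_of_nonneg_left (h i) (abs_nonneg _))
  linarith

theorem wtPair_eq {a b c : ℕ} (HA : Fin a → ℝ) (HB : Fin b → ℝ) (HC : Fin c → ℝ) (z : ℝ)
    (lam : (Fin a → ℝ) × (Fin b → ℝ) × (Fin c → ℝ)) :
    wtPair HA HB HC z lam =
      ∑ i, (HA i + z) * lam.1 i + ∑ j, HB j * lam.2.1 j + ∑ k, HC k * lam.2.2 k := by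
  simp only [wtPair, add_mul, Finset.sum_add_distrib, Finset.mul_sum]
  ring

theorem nonpos_of_forall_le_mul {S L t₀ : ℝ} (ht₀ : 0 < t₀)
    (h : ∀ t, 0 < t → t ≤ t₀ → t * S ≤ t ^ 2 * L) : S ≤ 0 := by
  by_contra! hS
  have hL : 0 < |L| + 1 := by positivity
  set t := min t₀ (S / (2 * (|L| + 1)))
  have ht : 0 < t := lt_min ht₀ (by positivity)
  have h1 := h t ht (min_le_left _ _)
  have h2 : t * (2 * (|L| + 1)) ≤ S := (le_div_iff₀ (by positivity)).1 (min_le_right _ _)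
  have h3 : S ≤ t * L := by
    have : t * S ≤ t * (t * L) := by linarith [h1, (by ring : t ^ 2 * L = t * (t * L))]
    exact le_of_mul_le_mul_left this ht
  nlinarith [le_abs_self L]

/-- A point with simple spectra on the face cut out by a valid inequality is realised by a vector
supported on zero weights. -/
theorem weight_mul_eq_zero_of_regular {a b c : ℕ} {HA : Fin a → ℝ} {HB : Fin b → ℝ}
    {HC : Fin c → ℝ} {z : ℝ} (hval : ∀ lam ∈ KronCone a b c, 0 ≤ wtPair HA HB HC z lam)
    {lam : (Fin a → ℝ) × (Fin b → ℝ) × (Fin c → ℝ)} (hlam0 : wtPair HA HB HC z lam = 0)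
    (hA : StrictAnti lam.1) (hB : StrictAnti lam.2.1) (hC : StrictAnti lam.2.2)
    {ψ : Fin a × Fin b × Fin c → ℂ} (hψA : rhoA ψ = diagonal fun i => (lam.1 i : ℂ))
    (hψB : rhoB ψ = diagonal fun i => (lam.2.1 i : ℂ))
    (hψC : rhoC ψ = diagonal fun i => (lam.2.2 i : ℂ)) (p : Fin a × Fin b × Fin c) :
    HA p.1 + HB p.2.1 + HC p.2.2 + z = 0 ∨ ψ p = 0 := by
  set w : Fin a × Fin b × Fin c → ℝ := fun p => (HA p.1 + z) + HB p.2.1 + HC p.2.2 with hw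
  set χ : Fin a × Fin b × Fin c → ℂ := fun p => (w p : ℂ) * ψ p with hχ
  obtain ⟨tA, htA, KA, hKA⟩ := exists_spec_rhoA_expansion hA hψA χ
  obtain ⟨tB, htB, KB, hKB⟩ :=
    exists_spec_rhoA_expansion hB (ψ := swapAB ψ) (by rw [← rhoB_eq, hψB]) (swapAB χ)
  obtain ⟨tC, htC, KC, hKC⟩ :=
    exists_spec_rhoA_expansion hC (ψ := rotC ψ) (by rw [← rhoC_eq, hψC]) (rotC χ)
  have hzero : ∑ p, w p * ‖ψ p‖ ^ 2 = 0 := by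
    rw [hw, sum_weight_mul (fun i => HA i + z) HB HC ψ, ← hlam0, wtPair_eq, hψA, hψB, hψC]
    simp
  have hS : ∑ p, w p ^ 2 * ‖ψ p‖ ^ 2 ≤ 0 := by
    have : 2 * ∑ p, w p ^ 2 * ‖ψ p‖ ^ 2 ≤ 0 := by
      refine nonpos_of_forall_le_mul (L := ∑ p, w p ^ 3 * ‖ψ p‖ ^ 2 + ((∑ i, |HA i + z|) * KA +
        (∑ i, |HB i|) * KB + (∑ i, |HC i|) * KC)) (lt_min htA (lt_min htB htC))
        fun t ht htt => ?_
      have h1 := htt.trans (min_le_left _ _)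
      have h2 := (htt.trans (min_le_right _ _)).trans (min_le_left _ _)
      have h3 := (htt.trans (min_le_right _ _)).trans (min_le_right _ _)
      set φ := ψ - (t : ℂ) • χ with hφ
      obtain ⟨mA, hmA⟩ := exists_isSpecDown (isHermitian_rhoA φ)
      obtain ⟨mB, hmB⟩ := exists_isSpecDown (isHermitian_rhoB φ)
      obtain ⟨mC, hmC⟩ := exists_isSpecDown (isHermitian_rhoC φ)
      have h4 := hval (mA, mB, mC) ⟨φ, hmA, hmB, hmC⟩
      rw [wtPair_eq] at h4
      have h5 := sum_mul_le_of_abs_sub_le (fun i => HA i + z) (hKA t ht.le h1 mA hmA)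
      have h6 := sum_mul_le_of_abs_sub_le HB (hKB t ht.le h2 mB hmB)
      have h7 := sum_mul_le_of_abs_sub_le HC (hKC t ht.le h3 mC hmC)
      have h8 := sum_weight_mul (fun i => HA i + z) HB HC φ
      have h9 : ∑ p, w p * ‖φ p‖ ^ 2 = ∑ p, w p * ‖ψ p‖ ^ 2 - 2 * t * ∑ p, w p ^ 2 * ‖ψ p‖ ^ 2 +
          t ^ 2 * ∑ p, w p ^ 3 * ‖ψ p‖ ^ 2 := by
        rw [Finset.mul_sum, Finset.mul_sum, ← Finset.sum_sub_distrib, ← Finset.sum_add_distrib]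
        refine Finset.sum_congr rfl fun p _ => ?_
        have : φ p = ((1 - t * w p : ℝ) : ℂ) * ψ p := by
          simp only [hφ, hχ, Pi.sub_apply, Pi.smul_apply, smul_eq_mul]
          push_cast; ring
        rw [this, norm_mul, Complex.norm_real, mul_pow, Real.norm_eq_abs, sq_abs]
        ring
      rw [hzero] at h9
      have h10 : ∑ p, w p * ‖φ p‖ ^ 2 = ∑ i, (HA i + z) * (rhoA φ i i).re +
        ∑ i, HB i * (rhoB φ i i).re + ∑ i, HC i * (rhoC φ i i).re := h8
      have h6' : ∑ i, HB i * mB i ≤ ∑ i, HB i * (rhoB φ i i).re + (∑ i, |HB i|) * (KB * t ^ 2) := h6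
      have h7' : ∑ i, HC i * mC i ≤ ∑ i, HC i * (rhoC φ i i).re + (∑ i, |HC i|) * (KC * t ^ 2) := h7
      simp only at h4 h5
      linear_combination h4 + h5 + h6' + h7' - h10 + h9
    linarith
  have hp := (Finset.sum_eq_zero_iff_of_nonneg (fun p _ => by positivity)).1
    (le_antisymm hS (Finset.sum_nonneg fun p _ => by positivity)) p (Finset.mem_univ p)
  rcases mul_eq_zero.1 hp with h | h
  · left
    have := pow_eq_zero_iff two_ne_zero |>.1 h
    simp only [hw] at this
    linarith
  · right
    simpa using h

/-- The weights on which `(H, z)` vanishes. -/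
def zeroWeights {a b c : ℕ} (HA : Fin a → ℝ) (HB : Fin b → ℝ) (HC : Fin c → ℝ) (z : ℝ) :
    Set ((Fin a → ℝ) × (Fin b → ℝ) × (Fin c → ℝ)) :=
  {w | ∃ i j k, HA i + HB j + HC k + z = 0 ∧
    w = (Pi.single i 1, Pi.single j 1, Pi.single k 1)}

theorem mem_span_zeroWeights_of_regular {a b c : ℕ} {HA : Fin a → ℝ} {HB : Fin b → ℝ}
    {HC : Fin c → ℝ} {z : ℝ} (hval : ∀ lam ∈ KronCone a b c, 0 ≤ wtPair HA HB HC z lam)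
    {lam : (Fin a → ℝ) × (Fin b → ℝ) × (Fin c → ℝ)} (hlam : lam ∈ KronCone a b c)
    (hlam0 : wtPair HA HB HC z lam = 0)
    (hA : StrictAnti lam.1) (hB : StrictAnti lam.2.1) (hC : StrictAnti lam.2.2) :
    lam ∈ Submodule.span ℝ (zeroWeights HA HB HC z) := by
  obtain ⟨-, ψ, hψA, hψB, hψC⟩ := mem_kronCone_iff.1 hlam
  have key := weight_mul_eq_zero_of_regular hval hlam0 hA hB hC hψA hψB hψC
  have hsum : lam = ∑ p : Fin a × Fin b × Fin c, ‖ψ p‖ ^ 2 •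
      ((Pi.single p.1 1, Pi.single p.2.1 1, Pi.single p.2.2 1) :
        (Fin a → ℝ) × (Fin b → ℝ) × (Fin c → ℝ)) := by
    refine Prod.ext ?_ (Prod.ext ?_ ?_)
    · funext i
      have h := sum_mul_rhoA (Pi.single i 1) ψ
      rw [hψA] at h
      simp only [diagonal_apply_eq, Complex.ofReal_re, Pi.single_apply, ite_mul, one_mul, zero_mul,
        Finset.sum_ite_eq', Finset.mem_univ, if_true] at h
      simp [Prod.fst_sum, Finset.sum_apply, Pi.single_apply, h, eq_comm]
    · funext i
      have h := sum_mul_rhoB (Pi.single i 1) ψ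
      rw [hψB] at h
      simp only [diagonal_apply_eq, Complex.ofReal_re, Pi.single_apply, ite_mul, one_mul, zero_mul,
        Finset.sum_ite_eq', Finset.mem_univ, if_true] at h
      simp [Prod.fst_sum, Prod.snd_sum, Finset.sum_apply, Pi.single_apply, h, eq_comm]
    · funext i
      have h := sum_mul_rhoC (Pi.single i 1) ψ
      rw [hψC] at h
      simp only [diagonal_apply_eq, Complex.ofReal_re, Pi.single_apply, ite_mul, one_mul, zero_mul,
        Finset.sum_ite_eq', Finset.mem_univ, if_true] at h
      simp [Prod.snd_sum, Finset.sum_apply, Pi.single_apply, h, eq_comm]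
  rw [hsum]
  refine Submodule.sum_mem _ fun p _ => ?_
  rcases key p with h | h
  · exact Submodule.smul_mem _ _ (Submodule.subset_span ⟨p.1, p.2.1, p.2.2, h, rfl⟩)
  · simp [h]

end

section

open Matrix

variable {a b c : ℕ}

/-- The pairing with `(H, z)` as a linear functional. -/
def wtPairL (HA : Fin a → ℝ) (HB : Fin b → ℝ) (HC : Fin c → ℝ) (z : ℝ) :
    ((Fin a → ℝ) × (Fin b → ℝ) × (Fin c → ℝ)) →ₗ[ℝ] ℝ where
  toFun := wtPair HA HB HC z
  map_add' x y := by
    simp only [wtPair, Prod.fst_add, Prod.snd_add, Pi.add_apply, mul_add, Finset.sum_add_distrib]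
    ring
  map_smul' t x := by
    simp only [wtPair, Prod.smul_fst, Prod.smul_snd, Pi.smul_apply, smul_eq_mul,
      RingHom.id_apply, Finset.mul_sum, mul_add]
    simp only [mul_left_comm t]

theorem wtPairL_apply (HA : Fin a → ℝ) (HB : Fin b → ℝ) (HC : Fin c → ℝ) (z : ℝ)
    (lam : (Fin a → ℝ) × (Fin b → ℝ) × (Fin c → ℝ)) :
    wtPairL HA HB HC z lam = wtPair HA HB HC z lam := rfl

/-- The difference of the first two traces. -/
def traceDiffB (a b c : ℕ) : ((Fin a → ℝ) × (Fin b → ℝ) × (Fin c → ℝ)) →ₗ[ℝ] ℝ :=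
  wtPairL 0 (fun _ => -1) 0 1

/-- The difference of the first and third traces. -/
def traceDiffC (a b c : ℕ) : ((Fin a → ℝ) × (Fin b → ℝ) × (Fin c → ℝ)) →ₗ[ℝ] ℝ :=
  wtPairL 0 0 (fun _ => -1) 1

theorem traceDiffB_apply (lam : (Fin a → ℝ) × (Fin b → ℝ) × (Fin c → ℝ)) :
    traceDiffB a b c lam = ∑ i, lam.1 i - ∑ j, lam.2.1 j := by
  simp [traceDiffB, wtPairL_apply, wtPair]
  ring

theorem traceDiffC_apply (lam : (Fin a → ℝ) × (Fin b → ℝ) × (Fin c → ℝ)) :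
    traceDiffC a b c lam = ∑ i, lam.1 i - ∑ k, lam.2.2 k := by
  simp [traceDiffC, wtPairL_apply, wtPair]
  ring

theorem eq_smul_of_combination_eq (ha : 0 < a) (hb : 0 < b) (hc : 0 < c)
    {HA GA : Fin a → ℝ} {HB GB : Fin b → ℝ} {HC GC : Fin c → ℝ} {z : ℝ}
    (hH : Traceless HA HB HC) (hG : Traceless GA GB GC) {x y w : ℝ}
    (h : x • traceDiffB a b c + y • traceDiffC a b c + w • wtPairL HA HB HC z =
      wtPairL GA GB GC 0) :
    x = 0 ∧ y = 0 ∧ w * z = 0 ∧ w • HA = GA ∧ w • HB = GB ∧ w • HC = GC := by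
  have hA : ∀ i, x + y + w * (HA i + z) = GA i := fun i => by
    have := LinearMap.congr_fun h (Pi.single i 1, 0, 0)
    simpa [traceDiffB_apply, traceDiffC_apply, wtPairL_apply, wtPair, Pi.single_apply] using this
  have hB : ∀ j, -x + w * HB j = GB j := fun j => by
    have := LinearMap.congr_fun h (0, Pi.single j 1, 0)
    simpa [traceDiffB_apply, traceDiffC_apply, wtPairL_apply, wtPair, Pi.single_apply] using this
  have hC : ∀ k, -y + w * HC k = GC k := fun k => by
    have := LinearMap.congr_fun h (0, 0, Pi.single k 1)
    simpa [traceDiffB_apply, traceDiffC_apply, wtPairL_apply, wtPair, Pi.single_apply] using this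
  have hx : x = 0 := by
    have := Finset.sum_congr rfl fun j (_ : j ∈ Finset.univ) => hB j
    rw [hG.2.1, Finset.sum_add_distrib, ← Finset.mul_sum, hH.2.1] at this
    simpa [hb.ne'] using this
  have hy : y = 0 := by
    have := Finset.sum_congr rfl fun j (_ : j ∈ Finset.univ) => hC j
    rw [hG.2.2, Finset.sum_add_distrib, ← Finset.mul_sum, hH.2.2] at this
    simpa [hc.ne'] using this
  subst hx hy
  have hz : w * z = 0 := by
    have := Finset.sum_congr rfl fun j (_ : j ∈ Finset.univ) => hA j
    rw [hG.1, Finset.sum_add_distrib, ← Finset.mul_sum, Finset.sum_add_distrib (f := HA), hH.1]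
      at this
    simp only [add_zero, Finset.sum_const_zero, zero_add, Finset.sum_const, Finset.card_univ,
      Fintype.card_fin, nsmul_eq_mul] at this
    rw [mul_left_comm] at this
    exact (mul_eq_zero.1 this).resolve_left (by exact_mod_cast ha.ne')
  refine ⟨rfl, rfl, hz, funext fun i => ?_, funext fun i => ?_, funext fun i => ?_⟩
  · have := hA i
    rw [mul_add, hz] at this
    simpa using this
  · simpa using hB i
  · simpa using hC i

/-- The face of the Kronecker cone on which `(H, z)` vanishes. -/
def kronFace (HA : Fin a → ℝ) (HB : Fin b → ℝ) (HC : Fin c → ℝ) (z : ℝ) :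
    AddSubmonoid ((Fin a → ℝ) × (Fin b → ℝ) × (Fin c → ℝ)) where
  carrier := {lam ∈ KronCone a b c | wtPair HA HB HC z lam = 0}
  add_mem' {x y} hx hy := ⟨mem_kronCone_add hx.1 hy.1, by
    have := (wtPairL HA HB HC z).map_add x y
    simp only [wtPairL_apply, hx.2, hy.2, add_zero] at this
    exact this⟩
  zero_mem' := by
    refine ⟨mem_kronCone_iff.2 ⟨⟨antitone_const, antitone_const, antitone_const⟩, 0, ?_, ?_, ?_⟩,
      (wtPairL HA HB HC z).map_zero⟩
    · ext i j; by_cases h : i = j <;> simp [rhoA, h]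
    · ext i j; by_cases h : i = j <;> simp [rhoB, h]
    · ext i j; by_cases h : i = j <;> simp [rhoC, h]

theorem traceDiff_eq_zero {lam : (Fin a → ℝ) × (Fin b → ℝ) × (Fin c → ℝ)}
    (hlam : lam ∈ KronCone a b c) : traceDiffB a b c lam = 0 ∧ traceDiffC a b c lam = 0 := by
  obtain ⟨h1, h2⟩ := (mem_kronCone.dualGood hlam).sum_eq
  exact ⟨by rw [traceDiffB_apply, h1, sub_self], by rw [traceDiffC_apply, h2, sub_self]⟩

theorem finrank_span_kronFace {HA : Fin a → ℝ} {HB : Fin b → ℝ} {HC : Fin c → ℝ} {z : ℝ}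
    (hfacet : IsFacetNormal a b c HA HB HC z) :
    Module.finrank ℝ (Submodule.span ℝ
      (kronFace HA HB HC z : Set ((Fin a → ℝ) × (Fin b → ℝ) × (Fin c → ℝ)))) =
      a + b + c - 3 := by
  have h0 : (0 : (Fin a → ℝ) × (Fin b → ℝ) × (Fin c → ℝ)) ∈
      {lam ∈ KronCone a b c | wtPair HA HB HC z lam = 0} := (kronFace HA HB HC z).zero_mem
  have h1 := vectorSpan_eq_span_vsub_set_right ℝ h0
  simp only [vsub_eq_sub, sub_zero, Set.image_id'] at h1
  rw [← hfacet.2.2.2, direction_affineSpan, h1]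
  rfl

/-- Functionals vanishing on the face are combinations of the defining ones. -/
theorem exists_combination_of_vanish (ha : 0 < a) (hb : 0 < b) (hc : 0 < c)
    {HA : Fin a → ℝ} {HB : Fin b → ℝ} {HC : Fin c → ℝ} {z : ℝ}
    (hfacet : IsFacetNormal a b c HA HB HC z)
    {f : ((Fin a → ℝ) × (Fin b → ℝ) × (Fin c → ℝ)) →ₗ[ℝ] ℝ}
    (hf : ∀ lam ∈ kronFace HA HB HC z, f lam = 0) :
    ∃ x y w : ℝ, x • traceDiffB a b c + y • traceDiffC a b c + w • wtPairL HA HB HC z = f := by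
  set v : Fin 3 → Module.Dual ℝ ((Fin a → ℝ) × (Fin b → ℝ) × (Fin c → ℝ)) :=
    ![traceDiffB a b c, traceDiffC a b c, wtPairL HA HB HC z] with hv
  set S := Submodule.span ℝ (kronFace HA HB HC z : Set ((Fin a → ℝ) × (Fin b → ℝ) × (Fin c → ℝ)))
  have hmem : ∀ g : Module.Dual ℝ ((Fin a → ℝ) × (Fin b → ℝ) × (Fin c → ℝ)),
      (∀ lam ∈ kronFace HA HB HC z, g lam = 0) → g ∈ S.dualAnnihilator := fun g hg => by
    rw [Submodule.mem_dualAnnihilator]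
    intro lam hlam
    have : S ≤ LinearMap.ker g := Submodule.span_le.2 fun lam h => hg lam h
    exact this hlam
  have hli : LinearIndependent ℝ v := by
    rw [Fintype.linearIndependent_iff]
    intro g hg
    rw [Fin.sum_univ_three] at hg
    have h0 : wtPairL (0 : Fin a → ℝ) (0 : Fin b → ℝ) (0 : Fin c → ℝ) 0 = 0 := by
      ext <;> simp [wtPairL_apply, wtPair]
    obtain ⟨h1, h2, h3, h4, h5, h6⟩ := eq_smul_of_combination_eq ha hb hc hfacet.1
      (GA := 0) (GB := 0) (GC := 0) (by simp [Traceless]) (hg.trans h0.symm)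
    have : g 2 = 0 := by
      by_contra hne
      exact hfacet.2.1 ⟨(smul_eq_zero.1 h4).resolve_left hne, (smul_eq_zero.1 h5).resolve_left hne,
        (smul_eq_zero.1 h6).resolve_left hne, (mul_eq_zero.1 h3).resolve_left hne⟩
    intro i
    fin_cases i
    exacts [h1, h2, this]
  have hle : Submodule.span ℝ (Set.range v) ≤ S.dualAnnihilator := by
    rw [Submodule.span_le]
    rintro _ ⟨i, rfl⟩
    refine hmem _ fun lam hlam => ?_
    fin_cases i
    exacts [(traceDiff_eq_zero hlam.1).1, (traceDiff_eq_zero hlam.1).2, hlam.2]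
  have heq : Submodule.span ℝ (Set.range v) = S.dualAnnihilator := by
    refine Submodule.eq_of_le_of_finrank_eq hle ?_
    have h1 := Subspace.finrank_add_finrank_dualAnnihilator_eq S
    rw [finrank_span_kronFace hfacet] at h1
    simp only [Module.finrank_prod, Module.finrank_fintype_fun_eq_card, Fintype.card_fin] at h1
    rw [finrank_span_eq_card hli, Fintype.card_fin]
    omega
  have hfS := hmem f hf
  rw [← heq, Submodule.mem_span_range_iff_exists_fun] at hfS
  obtain ⟨g, hg⟩ := hfS
  exact ⟨g 0, g 1, g 2, by rw [← hg, Fin.sum_univ_three]; rfl⟩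

theorem span_kronFace (ha : 0 < a) (hb : 0 < b) (hc : 0 < c)
    {HA : Fin a → ℝ} {HB : Fin b → ℝ} {HC : Fin c → ℝ} {z : ℝ}
    (hfacet : IsFacetNormal a b c HA HB HC z)
    {lam : (Fin a → ℝ) × (Fin b → ℝ) × (Fin c → ℝ)} (h1 : ∑ i, lam.1 i = ∑ j, lam.2.1 j)
    (h2 : ∑ i, lam.1 i = ∑ k, lam.2.2 k) (h3 : wtPair HA HB HC z lam = 0) :
    lam ∈ Submodule.span ℝ (kronFace HA HB HC z : Set _) := by
  rw [← Subspace.forall_mem_dualAnnihilator_apply_eq_zero_iff]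
  intro f hf
  rw [Submodule.mem_dualAnnihilator] at hf
  obtain ⟨x, y, w, rfl⟩ := exists_combination_of_vanish ha hb hc hfacet
    (f := f) fun lam hlam => hf lam (Submodule.subset_span hlam)
  simp [traceDiffB_apply, traceDiffC_apply, wtPairL_apply, h1, ← h2, h3]

theorem exists_kronFace_pos (ha : 0 < a) (hb : 0 < b) (hc : 0 < c)
    {HA GA : Fin a → ℝ} {HB GB : Fin b → ℝ} {HC GC : Fin c → ℝ} {z : ℝ}
    (hfacet : IsFacetNormal a b c HA HB HC z) (hG : Traceless GA GB GC)
    (hnn : ∀ lam ∈ KronCone a b c, 0 ≤ wtPair GA GB GC 0 lam)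
    (hpos : ∃ lam ∈ KronCone a b c, 0 < wtPair GA GB GC 0 lam)
    (hnt : ¬ ∃ t : ℝ, 0 < t ∧ HA = t • GA ∧ HB = t • GB ∧ HC = t • GC ∧ z = 0) :
    ∃ lam ∈ kronFace HA HB HC z, 0 < wtPairL GA GB GC 0 lam := by
  by_contra! hcon
  obtain ⟨x, y, w, h⟩ := exists_combination_of_vanish ha hb hc hfacet
    (f := wtPairL GA GB GC 0) fun lam hlam => le_antisymm (hcon lam hlam) (hnn lam hlam.1)
  obtain ⟨rfl, rfl, hz, rfl, rfl, rfl⟩ := eq_smul_of_combination_eq ha hb hc hfacet.1 hG h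
  obtain ⟨lam, hlam, hlt⟩ := hpos
  have hw : 0 < w := by
    have h1 := hfacet.2.2.1 lam hlam
    have h2 : w * wtPair HA HB HC z lam = wtPair (w • HA) (w • HB) (w • HC) 0 lam := by
      simpa [wtPairL_apply] using LinearMap.congr_fun h lam
    rw [← h2] at hlt
    exact pos_of_mul_pos_left hlt h1
  refine hnt ⟨w⁻¹, inv_pos.2 hw, ?_, ?_, ?_, (mul_eq_zero.1 hz).resolve_left hw.ne'⟩ <;>
    rw [smul_smul, inv_mul_cancel₀ hw.ne', one_smul]

theorem exists_rhoA_eq_indicator (h : a ≤ b * c) (m : Fin a) :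
    ∃ ψ : Fin a × Fin b × Fin c → ℂ,
      rhoA ψ = diagonal fun i => (((if i ≤ m then 1 else 0 : ℝ)) : ℂ) := by
  obtain ⟨g⟩ : Nonempty (Fin a ↪ Fin b × Fin c) :=
    Function.Embedding.nonempty_of_card_le (by simpa using h)
  refine ⟨fun p => if p.2 = g p.1 ∧ p.1 ≤ m then 1 else 0, ?_⟩
  ext i i'
  have : rhoA (fun p : Fin a × Fin b × Fin c => if p.2 = g p.1 ∧ p.1 ≤ m then (1 : ℂ) else 0) i i' =
      ∑ q : Fin b × Fin c, (if q = g i ∧ i ≤ m then (1 : ℂ) else 0) *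
        (starRingEnd ℂ) (if q = g i' ∧ i' ≤ m then (1 : ℂ) else 0) := by
    rw [Fintype.sum_prod_type]
    rfl
  rw [this, Finset.sum_eq_single (g i)]
  · by_cases hii : i = i'
    · subst hii
      by_cases him : i ≤ m <;> simp [him]
    · simp [hii]
  · intro q _ hq
    simp [hq]
  · simp

theorem isSpecDown_indicator {n : ℕ} {ρ : Matrix (Fin n) (Fin n) ℂ} {m : Fin n}
    (h : ρ = diagonal fun i => (((if i ≤ m then 1 else 0 : ℝ)) : ℂ)) :
    IsSpecDown ρ fun i => if i ≤ m then 1 else 0 := by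
  refine isSpecDown_of_unitary (k := 1) (fun i j hij => ?_) (one_mem _) (by simpa using h)
  by_cases hj : j ≤ m
  · simp [hj, hij.trans hj]
  · simp only [hj, if_false]
    split_ifs <;> norm_num

theorem exists_kronCone_gapA (h : a ≤ b * c) {i i' : Fin a} (hii : i < i') :
    ∃ lam ∈ KronCone a b c, lam.1 i' < lam.1 i := by
  obtain ⟨ψ, hψ⟩ := exists_rhoA_eq_indicator h i
  obtain ⟨mB, hmB⟩ := exists_isSpecDown (isHermitian_rhoB ψ)
  obtain ⟨mC, hmC⟩ := exists_isSpecDown (isHermitian_rhoC ψ)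
  exact ⟨(fun x => if x ≤ i then 1 else 0, mB, mC), ⟨ψ, isSpecDown_indicator hψ, hmB, hmC⟩,
    by simp [hii.not_ge]⟩

theorem exists_kronCone_gapB (h : b ≤ a * c) {i i' : Fin b} (hii : i < i') :
    ∃ lam ∈ KronCone a b c, lam.2.1 i' < lam.2.1 i := by
  obtain ⟨φ, hφ⟩ := exists_rhoA_eq_indicator h i
  set ψ : Fin a × Fin b × Fin c → ℂ := swapAB φ
  have hψ : rhoB ψ = rhoA φ := rfl
  obtain ⟨mA, hmA⟩ := exists_isSpecDown (isHermitian_rhoA ψ)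
  obtain ⟨mC, hmC⟩ := exists_isSpecDown (isHermitian_rhoC ψ)
  exact ⟨(mA, fun x => if x ≤ i then 1 else 0, mC), ⟨ψ, hmA, isSpecDown_indicator (hψ.trans hφ), hmC⟩,
    by simp [hii.not_ge]⟩

theorem exists_kronCone_gapC (h : c ≤ a * b) {i i' : Fin c} (hii : i < i') :
    ∃ lam ∈ KronCone a b c, lam.2.2 i' < lam.2.2 i := by
  obtain ⟨φ, hφ⟩ := exists_rhoA_eq_indicator h i
  set ψ : Fin a × Fin b × Fin c → ℂ := fun p => φ (p.2.2, p.1, p.2.1)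
  have hψ : rhoC ψ = rhoA φ := rfl
  obtain ⟨mA, hmA⟩ := exists_isSpecDown (isHermitian_rhoA ψ)
  obtain ⟨mB, hmB⟩ := exists_isSpecDown (isHermitian_rhoB ψ)
  exact ⟨(mA, mB, fun x => if x ≤ i then 1 else 0), ⟨ψ, hmA, hmB, isSpecDown_indicator (hψ.trans hφ)⟩,
    by simp [hii.not_ge]⟩

theorem AddSubmonoid.exists_forall_pos {E ι : Type*} [AddCommGroup E] [Module ℝ E] [Finite ι]
    (P : AddSubmonoid E) (l : ι → E →ₗ[ℝ] ℝ) (hnn : ∀ s, ∀ x ∈ P, 0 ≤ l s x)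
    (hpos : ∀ s, ∃ x ∈ P, 0 < l s x) : ∃ x ∈ P, ∀ s, 0 < l s x := by
  classical
  cases nonempty_fintype ι
  choose f hf hfpos using hpos
  refine ⟨∑ s, f s, P.sum_mem fun s _ => hf s, fun s => ?_⟩
  rw [map_sum]
  exact Finset.sum_pos' (fun s' _ => hnn s _ (hf s')) ⟨s, Finset.mem_univ s, hfpos s⟩

theorem sum_single_sub_single {n : ℕ} (i i' : Fin n) :
    ∑ m, (Pi.single i 1 - Pi.single i' 1 : Fin n → ℝ) m = 0 := by
  simp

theorem sum_single_sub_single_mul {n : ℕ} (i i' : Fin n) (x : Fin n → ℝ) :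
    ∑ m, (Pi.single i 1 - Pi.single i' 1 : Fin n → ℝ) m * x m = x i - x i' := by
  simp [sub_mul, Pi.single_apply]

theorem exists_regular_mem_kronFace (ha : 0 < a) (hb : 0 < b) (hc : 0 < c)
    (hA : a ≤ b * c) (hB : b ≤ a * c) (hC : c ≤ a * b)
    {HA : Fin a → ℝ} {HB : Fin b → ℝ} {HC : Fin c → ℝ} {z : ℝ}
    (hfacet : IsFacetNormal a b c HA HB HC z) (hnt : ¬ IsTrivialNormal HA HB HC z) :
    ∃ lam ∈ kronFace HA HB HC z, StrictAnti lam.1 ∧ StrictAnti lam.2.1 ∧ StrictAnti lam.2.2 := by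
  have eA : ∀ (i i' : Fin a) (lam : (Fin a → ℝ) × (Fin b → ℝ) × (Fin c → ℝ)),
      wtPair (Pi.single i 1 - Pi.single i' 1) 0 0 0 lam = lam.1 i - lam.1 i' := fun i i' lam => by
    rw [wtPair, sum_single_sub_single_mul]; simp
  have eB : ∀ (i i' : Fin b) (lam : (Fin a → ℝ) × (Fin b → ℝ) × (Fin c → ℝ)),
      wtPair 0 (Pi.single i 1 - Pi.single i' 1) 0 0 lam = lam.2.1 i - lam.2.1 i' :=
    fun i i' lam => by rw [wtPair, sum_single_sub_single_mul]; simp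
  have eC : ∀ (i i' : Fin c) (lam : (Fin a → ℝ) × (Fin b → ℝ) × (Fin c → ℝ)),
      wtPair 0 0 (Pi.single i 1 - Pi.single i' 1) 0 lam = lam.2.2 i - lam.2.2 i' :=
    fun i i' lam => by rw [wtPair, sum_single_sub_single_mul]; simp
  have nA : ∀ i i' : Fin a, i < i' → ∀ lam ∈ KronCone a b c,
      0 ≤ wtPair (Pi.single i 1 - Pi.single i' 1) 0 0 0 lam := fun i i' hii lam hlam => by
    rw [eA]; exact sub_nonneg.2 ((mem_kronCone_iff.1 hlam).1.1 hii.le)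
  have nB : ∀ i i' : Fin b, i < i' → ∀ lam ∈ KronCone a b c,
      0 ≤ wtPair 0 (Pi.single i 1 - Pi.single i' 1) 0 0 lam := fun i i' hii lam hlam => by
    rw [eB]; exact sub_nonneg.2 ((mem_kronCone_iff.1 hlam).1.2.1 hii.le)
  have nC : ∀ i i' : Fin c, i < i' → ∀ lam ∈ KronCone a b c,
      0 ≤ wtPair 0 0 (Pi.single i 1 - Pi.single i' 1) 0 lam := fun i i' hii lam hlam => by
    rw [eC]; exact sub_nonneg.2 ((mem_kronCone_iff.1 hlam).1.2.2 hii.le)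
  obtain ⟨lA, hlA, hA'⟩ := (kronFace HA HB HC z).exists_forall_pos
    (fun p : {p : Fin a × Fin a // p.1 < p.2} =>
      wtPairL (Pi.single p.1.1 1 - Pi.single p.1.2 1) 0 0 0)
    (fun p lam hlam => nA _ _ p.2 lam hlam.1) (fun p => by
      refine exists_kronFace_pos ha hb hc hfacet ⟨sum_single_sub_single _ _, by simp, by simp⟩
        (nA _ _ p.2) ?_ ?_
      · obtain ⟨lam, h1, h2⟩ := exists_kronCone_gapA hA p.2
        exact ⟨lam, h1, by rw [eA]; exact sub_pos.2 h2⟩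
      · rintro ⟨t, ht, h1, h2, h3, h4⟩
        exact hnt ⟨t, ht, Or.inl ⟨_, _, p.2, h1, by simpa using h2, by simpa using h3, h4⟩⟩)
  obtain ⟨lB, hlB, hB'⟩ := (kronFace HA HB HC z).exists_forall_pos
    (fun p : {p : Fin b × Fin b // p.1 < p.2} =>
      wtPairL 0 (Pi.single p.1.1 1 - Pi.single p.1.2 1) 0 0)
    (fun p lam hlam => nB _ _ p.2 lam hlam.1) (fun p => by
      refine exists_kronFace_pos ha hb hc hfacet ⟨by simp, sum_single_sub_single _ _, by simp⟩
        (nB _ _ p.2) ?_ ?_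
      · obtain ⟨lam, h1, h2⟩ := exists_kronCone_gapB hB p.2
        exact ⟨lam, h1, by rw [eB]; exact sub_pos.2 h2⟩
      · rintro ⟨t, ht, h1, h2, h3, h4⟩
        exact hnt ⟨t, ht, Or.inr (Or.inl
          ⟨_, _, p.2, h2, by simpa using h1, by simpa using h3, h4⟩)⟩)
  obtain ⟨lC, hlC, hC'⟩ := (kronFace HA HB HC z).exists_forall_pos
    (fun p : {p : Fin c × Fin c // p.1 < p.2} =>
      wtPairL 0 0 (Pi.single p.1.1 1 - Pi.single p.1.2 1) 0)
    (fun p lam hlam => nC _ _ p.2 lam hlam.1) (fun p => by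
      refine exists_kronFace_pos ha hb hc hfacet ⟨by simp, by simp, sum_single_sub_single _ _⟩
        (nC _ _ p.2) ?_ ?_
      · obtain ⟨lam, h1, h2⟩ := exists_kronCone_gapC hC p.2
        exact ⟨lam, h1, by rw [eC]; exact sub_pos.2 h2⟩
      · rintro ⟨t, ht, h1, h2, h3, h4⟩
        exact hnt ⟨t, ht, Or.inr (Or.inr
          ⟨_, _, p.2, h3, by simpa using h1, by simpa using h2, h4⟩)⟩)
  have sA : StrictAnti lA.1 := fun i i' hii => by
    have := hA' ⟨(i, i'), hii⟩
    rw [wtPairL_apply, eA] at this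
    exact sub_pos.1 this
  have sB : StrictAnti lB.2.1 := fun i i' hii => by
    have := hB' ⟨(i, i'), hii⟩
    rw [wtPairL_apply, eB] at this
    exact sub_pos.1 this
  have sC : StrictAnti lC.2.2 := fun i i' hii => by
    have := hC' ⟨(i, i'), hii⟩
    rw [wtPairL_apply, eC] at this
    exact sub_pos.1 this
  obtain ⟨-, aA2, aA3⟩ := (mem_kronCone_iff.1 hlA.1).1
  obtain ⟨aB1, -, aB3⟩ := (mem_kronCone_iff.1 hlB.1).1
  obtain ⟨aC1, aC2, -⟩ := (mem_kronCone_iff.1 hlC.1).1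
  exact ⟨lA + lB + lC, add_mem (add_mem hlA hlB) hlC, (sA.add_antitone aB1).add_antitone aC1,
    (aA2.add_strictAnti sB).add_antitone aC2, (aA3.add aB3).add_strictAnti sC⟩

end

/-- every non-trivial facet normal is admissible. -/
theorem admissible_of_facet (a b c : ℕ)
    (ha : 1 < a) (hab : a ≤ b) (hbc : b ≤ c) (hcab : c ≤ a * b)
    (HA : Fin a → ℝ) (HB : Fin b → ℝ) (HC : Fin c → ℝ) (z : ℝ)
    (hfacet : IsFacetNormal a b c HA HB HC z)
    (hnt : ¬ IsTrivialNormal HA HB HC z) :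
    Admissible HA HB HC z := by
  have ha0 : 0 < a := by omega
  have hb0 : 0 < b := by omega
  have hc0 : 0 < c := by omega
  obtain ⟨lam₀, hlam₀, rA, rB, rC⟩ := exists_regular_mem_kronFace ha0 hb0 hc0
    (by nlinarith) (by nlinarith) hcab hfacet hnt
  have hval := hfacet.2.2.1
  refine Set.Subset.antisymm ?_ ?_
  · intro lam hlam
    have hle : Submodule.span ℝ (zeroWeights HA HB HC z) ≤ LinearMap.ker (traceDiffB a b c) ⊓
        LinearMap.ker (traceDiffC a b c) ⊓ LinearMap.ker (wtPairL HA HB HC z) := by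
      rw [Submodule.span_le]
      rintro _ ⟨i, j, k, h, rfl⟩
      refine ⟨⟨?_, ?_⟩, ?_⟩
      · simp [traceDiffB_apply]
      · simp [traceDiffC_apply]
      · simp [wtPairL_apply, wtPair, Pi.single_apply, h]
    obtain ⟨⟨h1, h2⟩, h3⟩ := hle hlam
    rw [SetLike.mem_coe, LinearMap.mem_ker] at h1 h2
    rw [traceDiffB_apply, sub_eq_zero] at h1
    rw [traceDiffC_apply, sub_eq_zero] at h2
    exact ⟨h1, h2, h3⟩
  · rintro lam ⟨h1, h2, h3⟩
    have hle : Submodule.span ℝ (kronFace HA HB HC z : Set _) ≤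
        Submodule.span ℝ (zeroWeights HA HB HC z) := by
      rw [Submodule.span_le]
      intro mu hmu
      obtain ⟨m1, m2, m3⟩ := (mem_kronCone_iff.1 hmu.1).1
      have hsum := add_mem hmu hlam₀
      have e1 := mem_span_zeroWeights_of_regular hval hsum.1 hsum.2
        (m1.add_strictAnti rA) (m2.add_strictAnti rB) (m3.add_strictAnti rC)
      have e2 := mem_span_zeroWeights_of_regular hval hlam₀.1 hlam₀.2 rA rB rC
      have := Submodule.sub_mem _ e1 e2
      rwa [add_sub_cancel_right] at this
    exact hle (span_kronFace ha0 hb0 hc0 hfacet h1 h2 h3)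

end
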